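/- arXiv:0901.4324 — 2 statements merged into one kernel-verified Lean document; each statement's English description precedes it below -/
import Mathlib

section
/- Let f be continuous satisfying (P) and (KO), and let U₀ be sufficiently large so that the iteration v₀(u) = √(2F(u)), v_{k+1}(u) = √( 2·( F(u) − (N−1)·∫_{U₀}^u v_k(t)/(1 − ∫_t^{+∞} ds/v_k(s)) dt ) ) is well defined on [U₀,∞) (each v_k is positive, continuous, comparable to v₀, and its tail integrals converge). For each k let u_k be the solution of u_k'(r) = v_k(u_k(r)) on an interval (r_k,1) with u_k(r) → +∞ as r → 1⁻. Then: (i) for every k, ∫_{u_k(r)}^{u_{k+1}(r)} dt/√(2F(t)) = o( ∫_{u_k(r)}^{+∞} dt/√(2F(t)) ) as r → 1⁻; and (ii) for every k and every large solution u of Δu = f(u) in B, ( ∫_{u_k(‖x‖)}^{u(x)} dt/√(2F(t)) ) / ( ∫_{u_k(‖x‖)}^{+∞} dt/√(2F(t)) ) → 0 as x → ∂B within B. -/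
open MeasureTheory Filter Metric Set

/-- The Laplacian of `u : ℝ^N → ℝ` at a point, as the sum of the second
derivatives in the coordinate directions. -/
noncomputable def lapl {N : ℕ} (u : EuclideanSpace ℝ (Fin N) → ℝ)
    (x : EuclideanSpace ℝ (Fin N)) : ℝ :=
  ∑ i : Fin N, iteratedFDeriv ℝ 2 u x ![EuclideanSpace.single i 1, EuclideanSpace.single i 1]

/-- A large solution of Δu = f(u) on the open unit ball of ℝ^N. -/
def IsLargeSolution {N : ℕ} (f : ℝ → ℝ) (u : EuclideanSpace ℝ (Fin N) → ℝ) : Prop :=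
  ContDiffOn ℝ 2 u (ball 0 1) ∧
  (∀ x ∈ ball (0 : EuclideanSpace ℝ (Fin N)) 1, lapl u x = f (u x)) ∧
  ∀ x₀ ∈ sphere (0 : EuclideanSpace ℝ (Fin N)) 1,
    Tendsto u (nhdsWithin x₀ (ball 0 1)) atTop

/-- First- and second-order necessary conditions at a local maximum on the line. -/
lemma IsLocalMax.second_order {g g' : ℝ → ℝ} {x c : ℝ} (hmax : IsLocalMax g x)
    (hg : ∀ᶠ t in nhds x, HasDerivAt g (g' t) t) (hg' : HasDerivAt g' c x) :
    g' x = 0 ∧ c ≤ 0 := by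
  have h0 : g' x = 0 := hmax.hasDerivAt_eq_zero hg.self_of_nhds
  refine ⟨h0, ?_⟩
  by_contra! hc
  have hd : deriv g =ᶠ[nhds x] g' := hg.mono fun t ht => ht.deriv
  have hdd : deriv (deriv g) x = c := by rw [hd.deriv_eq, hg'.deriv]
  have hmin : IsLocalMin g x :=
    isLocalMin_of_deriv_deriv_pos (hdd ▸ hc) (by rw [hg.self_of_nhds.deriv, h0])
      hg.self_of_nhds.continuousAt
  have hconst : g =ᶠ[nhds x] fun _ => g x := by
    filter_upwards [hmax, hmin] with t h1 h2 using le_antisymm h1 h2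
  have hdz : deriv g =ᶠ[nhds x] fun _ => 0 := by
    filter_upwards [hconst.eventuallyEq_nhds] with t ht
    rw [ht.deriv_eq, deriv_const]
  rw [hdz.deriv_eq, deriv_const] at hdd
  exact hc.ne hdd

/-- Necessary conditions in the direction `e` at a local maximum of `T ∘ u - A ‖·‖²`. -/
lemma IsLocalMax.second_order_line {E : Type*} [NormedAddCommGroup E] [InnerProductSpace ℝ E]
    {u : E → ℝ} {x : E} (hu : ContDiffAt ℝ 2 u x) {T T' : ℝ → ℝ} {T'' A : ℝ}
    (hT : ∀ᶠ s in nhds (u x), HasDerivAt T (T' s) s) (hT' : HasDerivAt T' T'' (u x))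
    (hmax : IsLocalMax (fun z => T (u z) - A * ‖z‖ ^ 2) x) (e : E) :
    T' (u x) * fderiv ℝ u x e = 2 * A * inner ℝ x e ∧
      T'' * (fderiv ℝ u x e) ^ 2 + T' (u x) * iteratedFDeriv ℝ 2 u x ![e, e]
        ≤ 2 * A * ‖e‖ ^ 2 := by
  have hline : ∀ t : ℝ, HasDerivAt (fun t : ℝ => x + t • e) e t := fun t => by
    simpa using ((hasDerivAt_id t).smul_const e).const_add x
  have hl0 : x + (0 : ℝ) • e = x := by simp
  have hlc : Tendsto (fun t : ℝ => x + t • e) (nhds 0) (nhds x) := by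
    have := (hline 0).continuousAt.tendsto
    rwa [hl0] at this
  have hdiff : ∀ᶠ z in nhds x, DifferentiableAt ℝ u z := by
    filter_upwards [hu.eventually (by norm_num)] with z hz
    exact hz.differentiableAt (by norm_num)
  have hφ : ∀ᶠ t : ℝ in nhds 0,
      HasDerivAt (fun t : ℝ => u (x + t • e)) (fderiv ℝ u (x + t • e) e) t := by
    filter_upwards [hlc.eventually hdiff] with t ht
    exact ht.hasFDerivAt.comp_hasDerivAt t (hline t)
  have hφ' : HasDerivAt (fun t : ℝ => fderiv ℝ u (x + t • e) e)
      (iteratedFDeriv ℝ 2 u x ![e, e]) 0 := by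
    have h1 : HasFDerivAt (fderiv ℝ u) (fderiv ℝ (fderiv ℝ u) x) x :=
      ((hu.fderiv_right (m := 1) (by norm_num)).differentiableAt (by norm_num)).hasFDerivAt
    have h2 : HasDerivAt (fun t : ℝ => fderiv ℝ u (x + t • e)) (fderiv ℝ (fderiv ℝ u) x e) 0 :=
      h1.comp_hasDerivAt_of_eq (0 : ℝ) (hline 0) hl0.symm
    have h3 := h2.clm_apply (hasDerivAt_const (0 : ℝ) e)
    rw [iteratedFDeriv_two_apply]
    simpa using h3
  have hnorm : ∀ t : ℝ, ‖x + t • e‖ ^ 2 = ‖x‖ ^ 2 + 2 * inner ℝ x e * t + ‖e‖ ^ 2 * t ^ 2 :=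
    fun t => by
      rw [norm_add_sq_real, inner_smul_right, norm_smul, mul_pow, Real.norm_eq_abs, sq_abs]
      ring
  have hφ0 : Tendsto (fun t : ℝ => u (x + t • e)) (nhds 0) (nhds (u x)) :=
    hu.continuousAt.tendsto.comp hlc
  have hsq : ∀ t : ℝ, HasDerivAt (fun t : ℝ => A * ‖x + t • e‖ ^ 2)
      (A * (2 * inner ℝ x e + 2 * ‖e‖ ^ 2 * t)) t := fun t => by
    simp_rw [hnorm]
    refine HasDerivAt.const_mul A ?_
    have h3 := (((hasDerivAt_id t).const_mul (2 * inner ℝ x e)).const_add (‖x‖ ^ 2)).add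
      (((hasDerivAt_id t).pow 2).const_mul (‖e‖ ^ 2))
    refine h3.congr_deriv ?_
    simp
    ring
  have hg : ∀ᶠ t : ℝ in nhds 0, HasDerivAt (fun t : ℝ => T (u (x + t • e)) - A * ‖x + t • e‖ ^ 2)
      (T' (u (x + t • e)) * fderiv ℝ u (x + t • e) e
        - A * (2 * inner ℝ x e + 2 * ‖e‖ ^ 2 * t)) t := by
    filter_upwards [hφ, hφ0.eventually hT] with t h1 h2
    exact (h2.comp t h1).sub (hsq t)
  have hg' : HasDerivAt
      (fun t : ℝ => T' (u (x + t • e)) * fderiv ℝ u (x + t • e) e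
        - A * (2 * inner ℝ x e + 2 * ‖e‖ ^ 2 * t))
      (T'' * (fderiv ℝ u x e) ^ 2 + T' (u x) * iteratedFDeriv ℝ 2 u x ![e, e]
        - 2 * A * ‖e‖ ^ 2) 0 := by
    have h1 : HasDerivAt (fun t : ℝ => T' (u (x + t • e))) (T'' * fderiv ℝ u x e) 0 := by
      have h2 := hφ.self_of_nhds
      rw [hl0] at h2
      have h3 : HasDerivAt T' T'' (u (x + (0 : ℝ) • e)) := by rwa [hl0]
      exact h3.comp (0 : ℝ) h2
    have h4 := (h1.mul hφ').sub
      ((((hasDerivAt_id (0 : ℝ)).const_mul (2 * ‖e‖ ^ 2)).const_add (2 * inner ℝ x e)).const_mul A)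
    refine h4.congr_deriv ?_
    rw [hl0]
    ring
  have hlm : IsLocalMax (fun t : ℝ => T (u (x + t • e)) - A * ‖x + t • e‖ ^ 2) 0 := by
    filter_upwards [hlc.eventually hmax] with t ht
    simpa using ht
  have hfin := hlm.second_order hg hg'
  rw [hl0] at hfin
  exact ⟨by linarith [hfin.1], by linarith [hfin.2]⟩

/-- Necessary conditions at a local maximum of `T ∘ u - A ‖·‖²`. The number `G` is the squared
length of the gradient of `u` at the maximum. -/
lemma exists_gradient_sq_of_isLocalMax {N : ℕ} {u : EuclideanSpace ℝ (Fin N) → ℝ}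
    {x : EuclideanSpace ℝ (Fin N)} (hu : ContDiffAt ℝ 2 u x) {T T' : ℝ → ℝ} {T'' A : ℝ}
    (hT : ∀ᶠ s in nhds (u x), HasDerivAt T (T' s) s) (hT' : HasDerivAt T' T'' (u x))
    (hmax : IsLocalMax (fun z => T (u z) - A * ‖z‖ ^ 2) x) :
    ∃ G : ℝ, T' (u x) ^ 2 * G = 4 * A ^ 2 * ‖x‖ ^ 2 ∧
      T'' * G + T' (u x) * lapl u x ≤ 2 * A * N := by
  have key := fun i : Fin N => hmax.second_order_line hu hT hT' (EuclideanSpace.single i (1 : ℝ))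
  simp only [EuclideanSpace.inner_single_right, PiLp.norm_single] at key
  refine ⟨∑ i : Fin N, (fderiv ℝ u x (EuclideanSpace.single i 1)) ^ 2, ?_, ?_⟩
  · rw [EuclideanSpace.real_norm_sq_eq, Finset.mul_sum, Finset.mul_sum]
    refine Finset.sum_congr rfl fun i _ => ?_
    rw [← mul_pow, (key i).1]
    simp
    ring
  · rw [lapl, Finset.mul_sum, Finset.mul_sum, ← Finset.sum_add_distrib]
    refine (Finset.sum_le_sum fun i _ => (key i).2).trans_eq ?_
    simp
    ring

/-- The condition at a local maximum of `T ∘ u - A ‖·‖²` when `T' = 1 / V`. -/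
lemma lapl_div_sub_le_of_isLocalMax {N : ℕ} {u : EuclideanSpace ℝ (Fin N) → ℝ}
    {x : EuclideanSpace ℝ (Fin N)} (hu : ContDiffAt ℝ 2 u x) {T V : ℝ → ℝ} {V' A : ℝ}
    (hT : ∀ᶠ s in nhds (u x), HasDerivAt T (V s)⁻¹ s) (hV : HasDerivAt V V' (u x))
    (hV0 : V (u x) ≠ 0) (hmax : IsLocalMax (fun z => T (u z) - A * ‖z‖ ^ 2) x) :
    lapl u x / V (u x) - 4 * A ^ 2 * ‖x‖ ^ 2 * V' ≤ 2 * A * N := by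
  obtain ⟨G, h1, h2⟩ := exists_gradient_sq_of_isLocalMax hu hT (hV.inv hV0) hmax
  rw [← h1]
  convert h2 using 1
  field_simp
  ring

/-- A large solution blows up uniformly at the boundary. -/
lemma IsLargeSolution.tendsto_atTop {N : ℕ} {f : ℝ → ℝ} {u : EuclideanSpace ℝ (Fin N) → ℝ}
    (hu : IsLargeSolution f u) :
    Tendsto u (comap (fun x : EuclideanSpace ℝ (Fin N) => ‖x‖) (nhdsWithin 1 (Iio 1))) atTop := by
  rw [Filter.tendsto_atTop]
  intro b
  have h1 : ∀ᶠ z in nhdsSet (sphere (0 : EuclideanSpace ℝ (Fin N)) 1),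
      z ∈ ball (0 : EuclideanSpace ℝ (Fin N)) 1 → b ≤ u z := by
    rw [eventually_nhdsSet_iff_forall]
    intro x₀ hx₀
    exact eventually_nhdsWithin_iff.1 ((hu.2.2 x₀ hx₀).eventually_ge_atTop b)
  obtain ⟨W, hW, hSW, hWb⟩ := mem_nhdsSet_iff_exists.1 h1
  obtain ⟨δ, hδ, hδW⟩ :=
    (isCompact_sphere (0 : EuclideanSpace ℝ (Fin N)) 1).exists_thickening_subset_open hW hSW
  have h2 : ∀ᶠ r : ℝ in nhdsWithin 1 (Iio 1), r ∈ Ioo (max 0 (1 - δ)) 1 :=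
    Ioo_mem_nhdsLT (by simp [hδ])
  filter_upwards [h2.comap (fun x : EuclideanSpace ℝ (Fin N) => ‖x‖)] with x hx
  have hx0 : 0 < ‖x‖ := (le_max_left _ _).trans_lt hx.1
  have hxδ : 1 - δ < ‖x‖ := (le_max_right _ _).trans_lt hx.1
  refine hWb (hδW ?_) (by simpa using hx.2)
  rw [mem_thickening_iff]
  refine ⟨‖x‖⁻¹ • x, by simp [norm_smul, hx0.ne'], ?_⟩
  have : x - ‖x‖⁻¹ • x = (1 - ‖x‖⁻¹) • x := by rw [sub_smul, one_smul]
  rw [dist_eq_norm, this, norm_smul, Real.norm_eq_abs]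
  have h3 : 1 ≤ ‖x‖⁻¹ := (one_le_inv₀ hx0).2 hx.2.le
  rw [abs_of_nonpos (by linarith)]
  have h4 : ‖x‖⁻¹ * ‖x‖ = 1 := inv_mul_cancel₀ hx0.ne'
  nlinarith

/-- The derivative of a tail integral. -/
lemma hasDerivAt_integral_Ioi {q : ℝ → ℝ} {L t : ℝ} (hq : IntegrableOn q (Ioi L)) (ht : L < t)
    (hc : ContinuousAt q t) : HasDerivAt (fun s => ∫ σ in Ioi s, q σ) (-(q t)) t := by
  have hii : IntervalIntegrable q volume L t :=
    (intervalIntegrable_iff_integrableOn_Ioc_of_le ht.le).2 (hq.mono_set Ioc_subset_Ioi_self)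
  have h1 := (intervalIntegral.integral_hasDerivAt_right hii
    ⟨Ioi L, Ioi_mem_nhds ht, hq.aestronglyMeasurable⟩ hc).const_sub (∫ σ in Ioi L, q σ)
  refine h1.congr_of_eventuallyEq ?_
  filter_upwards [Ioi_mem_nhds ht] with s hs
  rw [← intervalIntegral.integral_interval_add_Ioi hq (hq.mono_set (Ioi_subset_Ioi hs.le))]
  ring

lemma integral_Ioi_pos {q : ℝ → ℝ} {t : ℝ} (hq : IntegrableOn q (Ioi t))
    (hpos : ∀ s, t < s → 0 < q s) : 0 < ∫ s in Ioi t, q s := by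
  rw [setIntegral_pos_iff_support_of_nonneg_ae
    ((ae_restrict_mem measurableSet_Ioi).mono fun s hs => (hpos s hs).le) hq]
  have : Function.support q ∩ Ioi t = Ioi t :=
    inter_eq_right.2 fun s hs => (hpos s hs).ne'
  simp [this]

lemma antitoneOn_integral_Ioi {q : ℝ → ℝ} {L : ℝ} (hq : IntegrableOn q (Ioi L))
    (hpos : ∀ s, L < s → 0 ≤ q s) : AntitoneOn (fun t => ∫ s in Ioi t, q s) (Ici L) :=
  fun _ hs _ _ hst => setIntegral_mono_set (hq.mono_set (Ioi_subset_Ioi hs))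
    ((ae_restrict_mem measurableSet_Ioi).mono fun σ hσ => hpos σ (lt_of_le_of_lt hs hσ))
    (Ioi_subset_Ioi hst).eventuallyLE

/-- Asymptotically equivalent integrands have asymptotically equivalent tail integrals. -/
lemma tendsto_integral_Ioi_div {p q : ℝ → ℝ} {L : ℝ} (hp : IntegrableOn p (Ioi L))
    (hq : IntegrableOn q (Ioi L)) (hpos : ∀ s, L < s → 0 < q s)
    (hlim : Tendsto (fun s => p s / q s) atTop (nhds 1)) :
    Tendsto (fun t => (∫ s in Ioi t, p s) / (∫ s in Ioi t, q s)) atTop (nhds 1) := by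
  rw [Metric.tendsto_atTop] at hlim ⊢
  intro ε hε
  obtain ⟨S, hS⟩ := hlim (ε / 2) (by positivity)
  refine ⟨max S L, fun t ht => ?_⟩
  have hLt : L ≤ t := (le_max_right _ _).trans ht
  have hSt : S ≤ t := (le_max_left _ _).trans ht
  have hpt := hp.mono_set (Ioi_subset_Ioi hLt)
  have hqt := hq.mono_set (Ioi_subset_Ioi hLt)
  have hQ := integral_Ioi_pos hqt fun s hs => hpos s (hLt.trans_lt hs)
  have hpw : ∀ s ∈ Ioi t, ‖p s - q s‖ ≤ ε / 2 * q s := by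
    intro s hs
    have hqs := hpos s (hLt.trans_lt hs)
    have h1 := (hS s (hSt.trans hs.le)).le
    have h2 : p s - q s = (p s / q s - 1) * q s := by field_simp
    rw [h2, norm_mul, Real.norm_eq_abs (q s), abs_of_pos hqs, ← dist_eq_norm]
    gcongr
  have h3 : ‖∫ s in Ioi t, (p s - q s)‖ ≤ ∫ s in Ioi t, ε / 2 * q s :=
    norm_integral_le_of_norm_le (hqt.const_mul _)
      ((ae_restrict_mem measurableSet_Ioi).mono hpw)
  rw [integral_sub hpt hqt, integral_const_mul] at h3
  have h4 : (∫ s in Ioi t, p s) / (∫ s in Ioi t, q s) - 1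
      = ((∫ s in Ioi t, p s) - ∫ s in Ioi t, q s) / ∫ s in Ioi t, q s := by
    field_simp
  rw [dist_eq_norm, h4, norm_div, Real.norm_eq_abs (∫ s in Ioi t, q s), abs_of_pos hQ,
    div_lt_iff₀ hQ]
  nlinarith

/-- The standing hypotheses: `f` is nonnegative on `[a, ∞)`, and its primitive `F`
vanishing at `a` is positive on `(a, ∞)` and satisfies the Keller–Osserman condition. -/
structure KellerOsserman (f F : ℝ → ℝ) (a : ℝ) : Prop where
  nonneg : ∀ t, a ≤ t → 0 ≤ f t
  hasDerivAt : ∀ t, HasDerivAt F (f t) t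
  apply_base : F a = 0
  pos : ∀ t, a < t → 0 < F t
  integrableOn : ∀ t, a < t → IntegrableOn (fun s => 1 / √(2 * F s)) (Ioi t)

namespace KellerOsserman

variable {f F : ℝ → ℝ} {a : ℝ}

lemma continuous (h : KellerOsserman f F a) : Continuous F :=
  continuous_iff_continuousAt.2 fun t => (h.hasDerivAt t).continuousAt

lemma monotoneOn (h : KellerOsserman f F a) : MonotoneOn F (Ici a) := by
  refine monotoneOn_of_deriv_nonneg (convex_Ici a) h.continuous.continuousOn
    (fun t _ => (h.hasDerivAt t).differentiableAt.differentiableWithinAt) fun t ht => ?_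
  rw [interior_Ici] at ht
  rw [(h.hasDerivAt t).deriv]
  exact h.nonneg t (le_of_lt ht)

lemma tendsto_atTop (h : KellerOsserman f F a) : Tendsto F atTop atTop := by
  rw [Filter.tendsto_atTop]
  intro B
  by_cases hB : ∃ t, a ≤ t ∧ B ≤ F t
  · obtain ⟨t, hat, ht⟩ := hB
    filter_upwards [eventually_ge_atTop t] with s hs
    exact ht.trans (h.monotoneOn hat (hat.trans hs) hs)
  · push Not at hB
    exfalso
    have hBpos : 0 < B := (h.apply_base ▸ hB a le_rfl)
    have h1 : IntegrableOn (fun _ : ℝ => 1 / √(2 * B)) (Ioi (a + 1)) := by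
      refine (h.integrableOn (a + 1) (by linarith)).mono' aestronglyMeasurable_const
        ((ae_restrict_mem measurableSet_Ioi).mono fun s hs => ?_)
      have has : a < s := by have := mem_Ioi.1 hs; linarith
      have h2 := h.pos s has
      have h3 := hB s has.le
      rw [Real.norm_eq_abs, abs_of_nonneg (by positivity)]
      gcongr
    rw [integrableOn_const_iff] at h1
    simp [(Real.sqrt_pos.2 hBpos).ne'] at h1

/-- Integrals of functions controlled by `√F` are negligible with respect to `F`. -/
lemma tendsto_integral_div (h : KellerOsserman f F a) {φ : ℝ → ℝ} {b T C : ℝ} (hbT : b ≤ T)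
    (hint : ∀ u, b ≤ u → IntervalIntegrable φ volume b u)
    (hφ : ∀ s, T ≤ s → |φ s| ≤ C * √(2 * F s)) :
    Tendsto (fun u => (∫ s in b..u, φ s) / F u) atTop (nhds 0) := by
  have hC : 0 ≤ |C| := abs_nonneg C
  have htail := tendsto_integral_Ioi_zero (f := fun s => 1 / √(2 * F s)) (μ := volume)
    (tendsto_id (α := ℝ) (x := atTop))
  rw [Metric.tendsto_atTop]
  intro ε hε
  obtain ⟨S, hS1, hS2, hS3⟩ : ∃ S, a < S ∧ T ≤ S ∧
      (∫ s in Ioi S, 1 / √(2 * F s)) < ε / (4 * (|C| + 1)) := by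
    have h1 := (htail.eventually (gt_mem_nhds (show 0 < ε / (4 * (|C| + 1)) by positivity)))
    exact ((eventually_gt_atTop a).and ((eventually_ge_atTop T).and h1)).exists
  set K := |∫ s in b..S, φ s| with hK
  obtain ⟨R, hR⟩ := eventually_atTop.1 (h.tendsto_atTop.eventually_gt_atTop (2 * K / ε))
  refine ⟨max R S, fun u hu => ?_⟩
  have hSu : S ≤ u := (le_max_right _ _).trans hu
  have hFu : 0 < F u := h.pos u (hS1.trans_le hSu)
  have hKF : 2 * K < F u * ε := by
    have := hR u ((le_max_left _ _).trans hu)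
    rwa [div_lt_iff₀ hε] at this
  have hiS := hint S (hbT.trans hS2)
  have hiu := hint u (hbT.trans (hS2.trans hSu))
  have hII : IntervalIntegrable (fun s => 1 / √(2 * F s)) volume S u :=
    (intervalIntegrable_iff_integrableOn_Ioc_of_le hSu).2
      ((h.integrableOn S hS1).mono_set Ioc_subset_Ioi_self)
  have h1 : ‖∫ s in S..u, φ s‖ ≤ ∫ s in S..u, (|C| * (2 * F u)) * (1 / √(2 * F s)) := by
    refine intervalIntegral.norm_integral_le_of_norm_le hSu (ae_of_all _ fun s hs => ?_)
      (hII.const_mul _)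
    have has : a < s := hS1.trans hs.1
    have hFs := h.pos s has
    have hmono : F s ≤ F u := h.monotoneOn has.le (has.le.trans hs.2) hs.2
    have hsq : 0 < √(2 * F s) := by positivity
    rw [Real.norm_eq_abs, mul_assoc]
    refine (hφ s (hS2.trans hs.1.le)).trans (mul_le_mul (le_abs_self C) ?_ hsq.le hC)
    rw [mul_one_div, le_div_iff₀ hsq, Real.mul_self_sqrt (by positivity)]
    linarith
  have h2 : (∫ s in S..u, 1 / √(2 * F s)) ≤ ∫ s in Ioi S, 1 / √(2 * F s) := by
    rw [intervalIntegral.integral_of_le hSu]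
    exact setIntegral_mono_set (h.integrableOn S hS1) (ae_of_all _ fun s => by positivity)
      Ioc_subset_Ioi_self.eventuallyLE
  rw [intervalIntegral.integral_const_mul] at h1
  have h3 : ‖∫ s in S..u, φ s‖ ≤ F u * (ε / 2) := by
    refine h1.trans ?_
    have h4 : (∫ s in S..u, 1 / √(2 * F s)) ≤ ε / (4 * (|C| + 1)) := h2.trans hS3.le
    calc |C| * (2 * F u) * (∫ s in S..u, 1 / √(2 * F s))
        ≤ |C| * (2 * F u) * (ε / (4 * (|C| + 1))) := by gcongr
      _ = F u * (ε / 2) * (|C| / (|C| + 1)) := by field_simp; norm_num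
      _ ≤ F u * (ε / 2) * 1 := by
          gcongr
          rw [div_le_one (by positivity)]
          linarith
      _ = _ := mul_one _
  rw [dist_zero_right, norm_div, Real.norm_eq_abs (F u), abs_of_pos hFu, div_lt_iff₀ hFu,
    ← intervalIntegral.integral_add_adjacent_intervals hiS (hiS.symm.trans hiu)]
  refine (norm_add_le _ _).trans_lt ?_
  rw [Real.norm_eq_abs, ← hK]
  linarith

/-- Perturbing `F` by a negligible term does not change the asymptotics of `√(2F)`. -/
lemma tendsto_sqrt_div (h : KellerOsserman f F a) {g : ℝ → ℝ}
    (hg : Tendsto (fun t => g t / F t) atTop (nhds 0)) :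
    Tendsto (fun t => √(2 * (F t + g t)) / √(2 * F t)) atTop (nhds 1) := by
  have hlim : Tendsto (fun t => √(1 + g t / F t)) atTop (nhds 1) := by
    simpa using (hg.const_add 1).sqrt
  refine hlim.congr' ?_
  filter_upwards [eventually_gt_atTop a] with t hat
  have hF := h.pos t hat
  rw [← Real.sqrt_div' _ (by positivity)]
  congr 1
  field_simp

/-- One step of the iteration yields a function asymptotic to `√(2F)`. -/
lemma tendsto_iterate_div (h : KellerOsserman f F a) {w w' : ℝ → ℝ} {U₀ C n : ℝ}
    (hC : ∀ t ∈ Ici U₀, w t ≤ C * √(2 * F t)) (hw : ∀ t ∈ Ici U₀, 0 < w t)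
    (hrec : ∀ t ∈ Ici U₀, w' t =
      √(2 * (F t - n * ∫ s in U₀..t, w s / (1 - ∫ σ in Ioi s, (w σ)⁻¹)))) :
    Tendsto (fun t => w' t / √(2 * F t)) atTop (nhds 1) := by
  set φ : ℝ → ℝ := fun s => w s / (1 - ∫ σ in Ioi s, (w σ)⁻¹) with hφ
  have hsmall : Tendsto (fun u => (∫ s in U₀..u, φ s) / F u) atTop (nhds 0) := by
    by_cases hint : ∀ u, U₀ ≤ u → IntervalIntegrable φ volume U₀ u
    · have htail := tendsto_integral_Ioi_zero (f := fun s => (w s)⁻¹) (μ := volume)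
        (tendsto_id (α := ℝ) (x := atTop))
      obtain ⟨T, hT⟩ := eventually_atTop.1 (htail.eventually (gt_mem_nhds one_half_pos))
      refine h.tendsto_integral_div (T := max U₀ T) (C := 2 * C) (le_max_left _ _) hint
        fun s hs => ?_
      have hsU : s ∈ Ici U₀ := (le_max_left _ _).trans hs
      have h1 : 1 / 2 ≤ 1 - ∫ σ in Ioi s, (w σ)⁻¹ := by
        have : (∫ σ in Ioi s, (w σ)⁻¹) < 1 / 2 := hT s ((le_max_right _ _).trans hs)
        linarith
      have h2 := hw s hsU
      rw [hφ, abs_of_nonneg (div_nonneg h2.le (by linarith)), div_le_iff₀ (by linarith)]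
      have h3 := hC s hsU
      nlinarith
    · push Not at hint
      obtain ⟨u₀, hu₀, hn⟩ := hint
      refine tendsto_const_nhds.congr' ?_
      filter_upwards [eventually_ge_atTop u₀] with u hu
      rw [intervalIntegral.integral_undef, zero_div]
      intro hi
      refine hn (hi.mono_set ?_)
      rw [uIcc_of_le hu₀, uIcc_of_le (hu₀.trans hu)]
      exact Icc_subset_Icc_right hu
  have hg : Tendsto (fun u => -(n * ∫ s in U₀..u, φ s) / F u) atTop (nhds 0) := by
    have := hsmall.const_mul (-n)
    rw [mul_zero] at this
    exact this.congr fun u => by ring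
  refine (h.tendsto_sqrt_div hg).congr' ?_
  filter_upwards [eventually_ge_atTop U₀] with u hu
  rw [hrec u hu, ← sub_eq_add_neg]

/-- If `v ~ √(2F)` then a solution of `y' = v(y)` blowing up at `1` satisfies
`∫_{y(r)}^∞ 1/√(2F) ~ 1 - r`. -/
lemma tendsto_tail_div_one_sub (h : KellerOsserman f F a) {v y : ℝ → ℝ} {U₀ r₀ : ℝ} (hr₀ : r₀ < 1)
    (hpos : ∀ t ∈ Ici U₀, 0 < v t) (hcont : ContinuousOn v (Ici U₀))
    (hint : IntegrableOn (fun s => (v s)⁻¹) (Ioi U₀))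
    (hlim : Tendsto (fun t => v t / √(2 * F t)) atTop (nhds 1))
    (hy : ∀ r ∈ Ioo r₀ 1, HasDerivAt y (v (y r)) r)
    (hblow : Tendsto y (nhdsWithin 1 (Iio 1)) atTop) :
    Tendsto (fun r => (∫ s in Ioi (y r), 1 / √(2 * F s)) / (1 - r))
      (nhdsWithin 1 (Iio 1)) (nhds 1) := by
  obtain ⟨r₁, hr₁, hr₁y⟩ : ∃ r₁ < 1, ∀ r ∈ Ioo r₁ 1, r ∈ Ioo r₀ 1 ∧ U₀ < y r := by
    have h1 := (eventually_mem_set.2 (Ioo_mem_nhdsLT hr₀)).and (hblow.eventually_gt_atTop U₀)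
    exact (mem_nhdsLT_iff_exists_Ioo_subset.1 h1)
  have hD : ∀ r ∈ Ioo r₁ 1, HasDerivAt (fun r => (∫ s in Ioi (y r), (v s)⁻¹) + r) 0 r := by
    intro r hr
    obtain ⟨hr0, hyr⟩ := hr₁y r hr
    have hvr := hpos (y r) hyr.le
    have h1 := (hasDerivAt_integral_Ioi hint hyr
      ((hcont.continuousAt (Ici_mem_nhds hyr)).inv₀ hvr.ne')).comp r (hy r hr0)
    refine (h1.add (hasDerivAt_id r)).congr_deriv ?_
    field_simp
    ring
  obtain ⟨c, hc⟩ := isOpen_Ioo.exists_is_const_of_deriv_eq_zero isPreconnected_Ioo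
    (fun r hr => (hD r hr).differentiableAt.differentiableWithinAt) fun r hr => (hD r hr).deriv
  have hev : ∀ᶠ r in nhdsWithin (1 : ℝ) (Iio 1), r ∈ Ioo r₁ 1 := Ioo_mem_nhdsLT hr₁
  have hc1 : c = 1 := by
    have h1 : Tendsto (fun r => (∫ s in Ioi (y r), (v s)⁻¹) + r) (nhdsWithin 1 (Iio 1))
        (nhds (0 + 1)) :=
      (tendsto_integral_Ioi_zero hblow).add (tendsto_id.mono_left nhdsWithin_le_nhds)
    have h2 : Tendsto (fun r => (∫ s in Ioi (y r), (v s)⁻¹) + r) (nhdsWithin 1 (Iio 1))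
        (nhds c) := tendsto_const_nhds.congr' (hev.mono fun r hr => (hc r hr).symm)
    rw [tendsto_nhds_unique h2 h1, zero_add]
  have hlim' : Tendsto (fun s => 1 / √(2 * F s) / (v s)⁻¹) atTop (nhds 1) := by
    refine hlim.congr fun s => ?_
    rw [div_inv_eq_mul, one_div_mul_eq_div]
  have hL := (tendsto_integral_Ioi_div (L := max U₀ (a + 1))
    ((h.integrableOn (a + 1) (by linarith)).mono_set (Ioi_subset_Ioi (le_max_right _ _)))
    (hint.mono_set (Ioi_subset_Ioi (le_max_left _ _)))
    (fun s hs => inv_pos.2 (hpos s ((le_max_left _ _).trans hs.le))) hlim').comp hblow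
  refine hL.congr' (hev.mono fun r hr => ?_)
  have := hc r hr
  rw [hc1] at this
  simp only [Function.comp_apply]
  rw [← this, add_sub_cancel_right]

end KellerOsserman

/-- A maximum principle on the annulus `r₀ ≤ ‖x‖ < 1`. -/
lemma le_zero_of_forall_not_isLocalMax {N : ℕ} {Θ : EuclideanSpace ℝ (Fin N) → ℝ} {r₀ : ℝ}
    (hcont : ∀ x, r₀ ≤ ‖x‖ → ‖x‖ < 1 → ContinuousAt Θ x)
    (hinner : ∀ x, ‖x‖ = r₀ → Θ x ≤ 0)
    (houter : ∀ θ > 0, ∀ᶠ x in comap (fun x : EuclideanSpace ℝ (Fin N) => ‖x‖)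
      (nhdsWithin 1 (Iio 1)), Θ x < θ)
    (hmax : ∀ x, r₀ < ‖x‖ → ‖x‖ < 1 → 0 < Θ x → ¬ IsLocalMax Θ x)
    {x : EuclideanSpace ℝ (Fin N)} (hx₀ : r₀ ≤ ‖x‖) (hx₁ : ‖x‖ < 1) : Θ x ≤ 0 := by
  by_contra! hpos
  obtain ⟨W, hW, hWΘ⟩ := mem_comap.1 (houter _ hpos)
  obtain ⟨r₁, hr₁, hr₁W⟩ := mem_nhdsLT_iff_exists_Ioo_subset.1 hW
  have hr₁ : r₁ < 1 := hr₁
  have hout : ∀ z : EuclideanSpace ℝ (Fin N), r₁ < ‖z‖ → ‖z‖ < 1 → Θ z < Θ x :=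
    fun z h1 h2 => hWΘ (hr₁W ⟨h1, h2⟩)
  obtain ⟨r₂, hr₂, hr₂'⟩ := exists_between (max_lt hr₁ hx₁)
  have hxr₂ : ‖x‖ < r₂ := (le_max_right _ _).trans_lt hr₂
  have hr₁₂ : r₁ < r₂ := (le_max_left _ _).trans_lt hr₂
  have hcpt : IsCompact {z : EuclideanSpace ℝ (Fin N) | r₀ ≤ ‖z‖ ∧ ‖z‖ ≤ r₂} := by
    refine (isCompact_closedBall (0 : EuclideanSpace ℝ (Fin N)) r₂).of_isClosed_subset
      ((isClosed_le continuous_const continuous_norm).inter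
        (isClosed_le continuous_norm continuous_const)) fun z hz => ?_
    simpa using hz.2
  obtain ⟨z, hz, hzmax⟩ := hcpt.exists_isMaxOn ⟨x, hx₀, hxr₂.le⟩
    fun z hz => (hcont z hz.1 (hz.2.trans_lt hr₂')).continuousWithinAt
  have hzx : Θ x ≤ Θ z := hzmax ⟨hx₀, hxr₂.le⟩
  have hz₀ : r₀ < ‖z‖ := by
    refine lt_of_le_of_ne hz.1 fun heq => ?_
    linarith [hinner z heq.symm]
  have hz₂ : ‖z‖ < r₂ := by
    refine lt_of_le_of_ne hz.2 fun heq => ?_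
    linarith [hout z (heq ▸ hr₁₂) (heq ▸ hr₂')]
  refine hmax z hz₀ (hz₂.trans hr₂') (hpos.trans_le hzx) (hzmax.isLocalMax ?_)
  filter_upwards [(isOpen_lt continuous_const continuous_norm).mem_nhds hz₀,
    (isOpen_lt continuous_norm continuous_const).mem_nhds hz₂] with w h1 h2
  exact ⟨le_of_lt h1, le_of_lt h2⟩

lemma IsLargeSolution.contDiffAt {N : ℕ} {f : ℝ → ℝ} {u : EuclideanSpace ℝ (Fin N) → ℝ}
    (hu : IsLargeSolution f u) {x : EuclideanSpace ℝ (Fin N)} (hx : ‖x‖ < 1) :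
    ContDiffAt ℝ 2 u x :=
  hu.1.contDiffAt (isOpen_ball.mem_nhds (by simpa using hx))

lemma eventually_norm_mem_Ioo {N : ℕ} {r : ℝ} (hr : r < 1) :
    ∀ᶠ x in comap (fun x : EuclideanSpace ℝ (Fin N) => ‖x‖) (nhdsWithin 1 (Iio 1)),
      ‖x‖ ∈ Ioo r 1 := by
  have h : ∀ᶠ r' : ℝ in nhdsWithin 1 (Iio 1), r' ∈ Ioo r 1 := Ioo_mem_nhdsLT hr
  exact h.comap _

namespace KellerOsserman

variable {f F : ℝ → ℝ} {a : ℝ}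

/-- The tails of `1 / √(2(F + C))` are small for large `C`. -/
lemma exists_integral_lt (h : KellerOsserman f F a) {b η : ℝ} (hb : a < b) (hη : 0 < η) :
    ∃ C : ℝ, 0 ≤ C ∧ ∫ s in Ioi b, 1 / √(2 * (F s + C)) < η := by
  have hlim : Tendsto (fun n : ℕ => ∫ s in Ioi b, 1 / √(2 * (F s + n))) atTop
      (nhds (∫ s in Ioi b, (0 : ℝ))) := by
    refine tendsto_integral_of_dominated_convergence (fun s => 1 / √(2 * F s))
      (fun n => ?_) (h.integrableOn b hb) (fun n => ?_) (ae_of_all _ fun s => ?_)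
    · have := h.continuous.measurable
      exact Measurable.aestronglyMeasurable (by fun_prop)
    · refine (ae_restrict_mem measurableSet_Ioi).mono fun s hs => ?_
      have hF := h.pos s (hb.trans hs)
      rw [Real.norm_eq_abs, abs_of_nonneg (by positivity)]
      gcongr
      linarith [n.cast_nonneg (α := ℝ)]
    · have h1 : Tendsto (fun n : ℕ => 2 * (F s + n)) atTop atTop :=
        (tendsto_atTop_add_const_left _ _ tendsto_natCast_atTop_atTop).const_mul_atTop two_pos
      exact ((Real.tendsto_sqrt_atTop.comp h1).inv_tendsto_atTop).congr fun n => (one_div _).symm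
  rw [integral_zero] at hlim
  obtain ⟨n, hn⟩ := (hlim.eventually (gt_mem_nhds hη)).exists
  exact ⟨n, n.cast_nonneg, hn⟩

/-- Comparison from below: a large solution grows at least as fast as the one-dimensional
profile. -/
lemma tail_le (h : KellerOsserman f F a) {N : ℕ} (hN : 1 ≤ N) {u : EuclideanSpace ℝ (Fin N) → ℝ}
    (hu : IsLargeSolution f u) {δ : ℝ} (hδ : 0 < δ) :
    ∀ᶠ x in comap (fun x : EuclideanSpace ℝ (Fin N) => ‖x‖) (nhdsWithin 1 (Iio 1)),
      ∫ s in Ioi (u x), 1 / √(2 * F s) ≤ (1 + δ) ^ 2 * (1 - ‖x‖) := by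
  obtain ⟨W, hW, hWu⟩ := mem_comap.1 (hu.tendsto_atTop.eventually_gt_atTop (a + 1))
  obtain ⟨r', hr', hr'W⟩ := mem_nhdsLT_iff_exists_Ioo_subset.1 hW
  have hδ1 : 1 / (1 + δ) < 1 := by
    rw [div_lt_one (by positivity)]
    linarith
  obtain ⟨r₀, hr₀, hr₀1⟩ := exists_between (max_lt (show r' < 1 from hr') hδ1)
  have hr₀δ : 1 < (1 + δ) * r₀ := by
    have := (le_max_right _ _).trans_lt hr₀
    rw [div_lt_iff₀ (by positivity)] at this
    linarith
  have hr₀pos : 0 < r₀ := lt_trans (by positivity) ((le_max_right _ _).trans_lt hr₀)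
  have hua : ∀ x : EuclideanSpace ℝ (Fin N), r₀ ≤ ‖x‖ → ‖x‖ < 1 → a + 1 < u x :=
    fun x h1 h2 => hWu (hr'W ⟨((le_max_left _ _).trans_lt hr₀).trans_le h1, h2⟩)
  set A : ℝ := (1 + δ) / 2 with hA
  have hApos : 0 < A := by positivity
  obtain ⟨C, hC, hCη⟩ := h.exists_integral_lt (b := a + 1) (η := A * (1 - r₀ ^ 2)) (by linarith)
    (mul_pos hApos (by nlinarith))
  set q : ℝ → ℝ := fun s => 1 / √(2 * (F s + C)) with hq
  have hqpos : ∀ s, a + 1 < s → 0 < q s := fun s hs => by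
    have := h.pos s (by linarith)
    positivity
  have hqint : IntegrableOn q (Ioi (a + 1)) := by
    refine (h.integrableOn (a + 1) (by linarith)).mono' ?_
      ((ae_restrict_mem measurableSet_Ioi).mono fun s hs => ?_)
    · have := h.continuous.measurable
      exact Measurable.aestronglyMeasurable (by fun_prop)
    · have hs' : a + 1 < s := hs
      have hF := h.pos s (by linarith)
      rw [Real.norm_eq_abs, abs_of_pos (hqpos s hs)]
      simp only [hq]
      gcongr
      linarith
  have hV : ∀ s, a + 1 < s →
      HasDerivAt (fun s => -√(2 * (F s + C))) (-(f s / √(2 * (F s + C)))) s :=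
    fun s hs => by
      have hF := h.pos s (by linarith)
      have h1 := ((((h.hasDerivAt s).add_const C).const_mul 2).sqrt (by positivity)).neg
      refine h1.congr_deriv ?_
      field_simp
  set y : ℝ → ℝ := fun t => ∫ s in Ioi t, q s with hy
  have hyd : ∀ t, a + 1 < t → HasDerivAt y (-√(2 * (F t + C)))⁻¹ t := fun t ht => by
    have hF := h.pos t (by linarith)
    have hqc : ContinuousAt q t := by
      have := h.continuous.continuousAt (x := t)
      exact ContinuousAt.div continuousAt_const (by fun_prop) (by positivity)
    refine (hasDerivAt_integral_Ioi hqint ht hqc).congr_deriv ?_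
    simp only [hq, inv_neg, one_div]
  have hyanti := antitoneOn_integral_Ioi hqint fun s hs => (hqpos s hs).le
  have hΘ : ∀ x : EuclideanSpace ℝ (Fin N), r₀ ≤ ‖x‖ → ‖x‖ < 1 →
      y (u x) - A * (1 - ‖x‖ ^ 2) ≤ 0 := by
    intro x hx₀ hx₁
    refine le_zero_of_forall_not_isLocalMax (Θ := fun x => y (u x) - A * (1 - ‖x‖ ^ 2))
      (r₀ := r₀) ?_ ?_ ?_ ?_ hx₀ hx₁
    · intro x h1 h2
      have h3 : ContinuousAt (fun x => y (u x)) x :=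
        ContinuousAt.comp (hyd _ (hua x h1 h2)).continuousAt (hu.contDiffAt h2).continuousAt
      exact h3.sub (Continuous.continuousAt (by fun_prop))
    · intro x hx
      have hux := hua x hx.ge (hx ▸ hr₀1)
      have : y (u x) ≤ y (a + 1) := hyanti self_mem_Ici hux.le hux.le
      rw [hx]
      linarith
    · intro θ hθ
      have h1 := (tendsto_integral_Ioi_zero (f := q) (μ := volume) hu.tendsto_atTop).eventually
        (gt_mem_nhds hθ)
      filter_upwards [h1, eventually_norm_mem_Ioo (N := N) hr₀1] with x h2 h3
      have h4 : 0 ≤ A * (1 - ‖x‖ ^ 2) :=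
        mul_nonneg hApos.le (by nlinarith [h3.1, h3.2, norm_nonneg x])
      have h5 : y (u x) < θ := h2
      linarith
    · intro x h1 h2 _ hmax
      have hux := hua x h1.le h2
      have hS : 0 < √(2 * (F (u x) + C)) := by
        have hF := h.pos (u x) (by linarith)
        positivity
      have hmax' : IsLocalMax (fun z => y (u z) - (-A) * ‖z‖ ^ 2) x := by
        filter_upwards [hmax] with z hz
        linarith
      have key := lapl_div_sub_le_of_isLocalMax (hu.contDiffAt h2) (T := y)
        (by filter_upwards [Ioi_mem_nhds hux] with s hs using hyd s hs) (hV _ hux)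
        (neg_ne_zero.2 hS.ne') hmax'
      rw [hu.2.1 x (by simpa using h2)] at key
      have hg : 0 ≤ f (u x) / √(2 * (F (u x) + C)) :=
        div_nonneg (h.nonneg _ (by linarith)) hS.le
      have hNpos : (0 : ℝ) < N := by exact_mod_cast hN
      have hAx : 1 ≤ 4 * A ^ 2 * ‖x‖ ^ 2 := by
        have : 1 ≤ (1 + δ) * ‖x‖ := hr₀δ.le.trans (by gcongr)
        rw [hA]
        nlinarith
      rw [div_neg, neg_sq] at key
      nlinarith [mul_pos hApos hNpos]
  have hratio : Tendsto (fun t => (∫ s in Ioi t, 1 / √(2 * F s)) / y t) atTop (nhds 1) := by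
    refine tendsto_integral_Ioi_div (h.integrableOn (a + 1) (by linarith)) hqint hqpos ?_
    refine (h.tendsto_sqrt_div (g := fun _ => C)
      (h.tendsto_atTop.const_div_atTop C)).congr fun s => ?_
    rw [hq, div_div_eq_mul_div, one_div_mul_eq_div, div_one]
  have hev := (hratio.comp hu.tendsto_atTop).eventually
    (gt_mem_nhds (show (1 : ℝ) < 1 + δ by linarith))
  filter_upwards [hev, eventually_norm_mem_Ioo (N := N) hr₀1] with x h1 h2
  have hux := hua x h2.1.le h2.2
  have hypos : 0 < y (u x) :=
    integral_Ioi_pos (hqint.mono_set (Ioi_subset_Ioi hux.le)) fun s hs => hqpos s (hux.trans hs)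
  have h3 : (∫ s in Ioi (u x), 1 / √(2 * F s)) < (1 + δ) * y (u x) := (div_lt_iff₀ hypos).1 h1
  have h4 := hΘ x h2.1.le h2.2
  have h5 : A * (1 - ‖x‖ ^ 2) ≤ (1 + δ) * (1 - ‖x‖) := by
    have : A * (1 - ‖x‖ ^ 2) = (1 + δ) * (1 - ‖x‖) * ((1 + ‖x‖) / 2) := by rw [hA]; ring
    rw [this]
    refine mul_le_of_le_one_right (mul_nonneg (by positivity) (by linarith [h2.2])) ?_
    linarith [h2.2]
  nlinarith

/-- A continuous positive function asymptotic to `√(2F)` has an integrable inverse. -/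
lemma integrableOn_inv (h : KellerOsserman f F a) {V : ℝ → ℝ} (hV : Continuous V)
    (hpos : ∀ s, 0 < V s) (hlim : Tendsto (fun s => V s / √(2 * F s)) atTop (nhds 1)) (t : ℝ) :
    IntegrableOn (fun s => (V s)⁻¹) (Ioi t) := by
  have hc : Continuous fun s => (V s)⁻¹ := hV.inv₀ fun s => (hpos s).ne'
  obtain ⟨S, hS⟩ := eventually_atTop.1 (hlim.eventually (lt_mem_nhds one_half_lt_one))
  set R := max (max S t) (a + 1) with hR
  have htR : t ≤ R := (le_max_right _ _).trans (le_max_left _ _)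
  have haR : a < R := (lt_add_one a).trans_le (le_max_right _ _)
  rw [← Ioc_union_Ioi_eq_Ioi htR]
  refine ((hc.integrableOn_Icc (a := t) (b := R)).mono_set Ioc_subset_Icc_self).union ?_
  refine ((h.integrableOn R haR).const_mul 2).mono' hc.aestronglyMeasurable
    ((ae_restrict_mem measurableSet_Ioi).mono fun s hs => ?_)
  have hs' : R < s := hs
  have hF := h.pos s (haR.trans hs')
  have hSs : S ≤ s := ((le_max_left _ _).trans (le_max_left _ _)).trans hs'.le
  have h1 := hS s hSs
  have hVs := hpos s
  rw [lt_div_iff₀ (by positivity)] at h1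
  rw [Real.norm_eq_abs, abs_of_pos (inv_pos.2 hVs), mul_one_div, ← one_div,
    div_le_div_iff₀ hVs (by positivity)]
  linarith

/-- The lower tail of a profile whose slope is `-K` below `m`. -/
lemma one_le_integral_linear {K e m M : ℝ} (hK : 0 < K) (he : 0 < e) (hM : M < m)
    (heK : e ≤ K * (m - M) * Real.exp (-K)) : 1 ≤ ∫ s in M..m, (e + K * (m - s))⁻¹ := by
  have hpos : ∀ s ∈ uIcc M m, 0 < e + K * (m - s) := fun s hs => by
    rw [uIcc_of_le hM.le] at hs
    have : 0 ≤ K * (m - s) := mul_nonneg hK.le (by linarith [hs.2])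
    linarith
  have hd : ∀ s ∈ uIcc M m,
      HasDerivAt (fun s => -(1 / K) * Real.log (e + K * (m - s))) (e + K * (m - s))⁻¹ s := by
    intro s hs
    have h1 := hpos s hs
    have h2 := (((((hasDerivAt_id s).const_sub m).const_mul K).const_add e).log h1.ne').const_mul
      (-(1 / K))
    refine h2.congr_deriv ?_
    simp only [id]
    field_simp
  have hi : IntervalIntegrable (fun s => (e + K * (m - s))⁻¹) volume M m :=
    ContinuousOn.intervalIntegrable
      (ContinuousOn.inv₀ (by fun_prop) fun s hs => (hpos s hs).ne')
  rw [intervalIntegral.integral_eq_sub_of_hasDerivAt hd hi, sub_self, mul_zero, add_zero]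
  have h3 : K + Real.log e ≤ Real.log (e + K * (m - M)) := by
    have h4 : Real.exp K * e ≤ e + K * (m - M) := by
      have h5 : Real.exp K * e ≤ Real.exp K * (K * (m - M) * Real.exp (-K)) := by gcongr
      have h6 : Real.exp K * (K * (m - M) * Real.exp (-K)) = K * (m - M) := by
        rw [Real.exp_neg]
        field_simp
      linarith
    have h7 := Real.log_le_log (by positivity) h4
    rwa [Real.log_mul (Real.exp_pos K).ne' he.ne', Real.log_exp] at h7
  have h8 : -(1 / K) * Real.log e - -(1 / K) * Real.log (e + K * (m - M))
      = (Real.log (e + K * (m - M)) - Real.log e) / K := by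
    field_simp
    ring
  rw [h8, le_div_iff₀ hK]
  linarith

/-- The function `F - K ∫ √(2F)` has arbitrarily large points to the right of which it stays above
its value there. -/
lemma exists_forall_ge_le (h : KellerOsserman f F a) (K M : ℝ) :
    ∃ m, M < m ∧ 1 ≤ F m - K * (∫ s in a..m, √(2 * F s)) ∧
      ∀ s, m ≤ s → F m - K * (∫ s in a..m, √(2 * F s)) ≤ F s - K * ∫ s in a..s, √(2 * F s) := by
  have hcF : Continuous fun s => √(2 * F s) := by
    have := h.continuous
    fun_prop
  set g : ℝ → ℝ := fun t => F t - K * ∫ s in a..t, √(2 * F s) with hg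
  have hgc : Continuous g :=
    h.continuous.sub (continuous_const.mul
      (intervalIntegral.continuous_primitive (fun _ _ => hcF.intervalIntegrable _ _) a))
  have hG := h.tendsto_integral_div (φ := fun s => √(2 * F s)) (C := 1) le_rfl
    (fun u _ => hcF.intervalIntegrable a u)
    (fun s _ => by rw [one_mul, abs_of_nonneg (Real.sqrt_nonneg _)])
  have hgtop : Tendsto g atTop atTop := by
    have h1 : Tendsto (fun t => F t * (1 - K * ((∫ s in a..t, √(2 * F s)) / F t))) atTop atTop := by
      refine h.tendsto_atTop.atTop_mul_pos one_pos ?_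
      simpa using (hG.const_mul K).const_sub 1
    refine h1.congr' ?_
    filter_upwards [eventually_gt_atTop a] with t ht
    have := h.pos t ht
    rw [hg]
    field_simp
  obtain ⟨L, hL⟩ := eventually_atTop.1
    ((hgtop.eventually_ge_atTop 1).and (eventually_gt_atTop M))
  obtain ⟨R, hR⟩ := eventually_atTop.1 (hgtop.eventually_ge_atTop (g L))
  obtain ⟨m, hm, hmin⟩ := (isCompact_Icc (a := L) (b := max L R)).exists_isMinOn
    ⟨L, le_rfl, le_max_left _ _⟩ hgc.continuousOn
  refine ⟨m, (hL m hm.1).2, (hL m hm.1).1, fun s hs => ?_⟩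
  by_cases hsR : s ≤ max L R
  · exact hmin ⟨hm.1.trans hs, hsR⟩
  · push Not at hsR
    exact (hmin ⟨le_rfl, le_max_left _ _⟩).trans (hR s ((le_max_right _ _).trans hsR.le))

/-- A one-dimensional profile that is a strict supersolution: near every value `s ≥ a` the function
`-y` is touched from below by a smooth `T` whose slope `1 / W` satisfies a strict differential
inequality. -/
lemma exists_profile (h : KellerOsserman f F a) {n : ℝ} (hn : 0 < n) (M : ℝ) :
    ∃ y : ℝ → ℝ, Continuous y ∧ Antitone y ∧ (∀ t, 0 < y t) ∧ 1 ≤ y M ∧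
      Tendsto (fun t => (∫ s in Ioi t, 1 / √(2 * F s)) / y t) atTop (nhds 1) ∧
      ∀ s, a ≤ s → ∃ (T W : ℝ → ℝ) (W' : ℝ), (∀ᶠ σ in nhds s, HasDerivAt T (W σ)⁻¹ σ) ∧
        HasDerivAt W W' s ∧ 0 < W s ∧ (∀ᶠ σ in nhds s, T σ ≤ -y σ) ∧ T s = -y s ∧
        ∀ ρ, 1 / 4 ≤ ρ → ρ ≤ 1 → n < f s / W s - ρ * W' := by
  set K : ℝ := 5 * n with hK
  have hKpos : 0 < K := by positivity
  obtain ⟨m, hMm, hm1, hmin⟩ := h.exists_forall_ge_le K (max M a)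
  have hMm' : M < m := (le_max_left _ _).trans_lt hMm
  have ham : a < m := (le_max_right _ _).trans_lt hMm
  have hcF : Continuous fun s => √(2 * F s) := by
    have := h.continuous
    fun_prop
  set g : ℝ → ℝ := fun t => F t - K * ∫ s in a..t, √(2 * F s) with hg
  have hgd : ∀ t, HasDerivAt g (f t - K * √(2 * F t)) t := fun t =>
    (h.hasDerivAt t).sub ((hcF.integral_hasStrictDerivAt a t).hasDerivAt.const_mul K)
  have hgc : Continuous g := continuous_iff_continuousAt.2 fun t => (hgd t).continuousAt
  have hg'm : 0 ≤ f m - K * √(2 * F m) := by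
    have hs : Tendsto (slope g m) (nhdsWithin m (Ioi m)) (nhds (f m - K * √(2 * F m))) :=
      (hgd m).tendsto_slope.mono_left (nhdsWithin_mono m fun s hs => ne_of_gt hs)
    refine ge_of_tendsto hs ?_
    filter_upwards [self_mem_nhdsWithin] with s hs
    rw [slope_def_field]
    exact div_nonneg (sub_nonneg.2 (hmin s (le_of_lt hs))) (sub_nonneg.2 (le_of_lt hs))
  set e : ℝ := min 1 (K * (m - M) * Real.exp (-K)) with he
  have hepos : 0 < e :=
    lt_min one_pos (mul_pos (mul_pos hKpos (by linarith)) (Real.exp_pos _))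
  have he1 : e ≤ 1 := min_le_left _ _
  set P : ℝ → ℝ := fun s => 2 * (g s - g m) + e ^ 2 with hP
  have hPm : P m = e ^ 2 := by simp [hP]
  have hPd : ∀ s, HasDerivAt P (2 * (f s - K * √(2 * F s))) s := fun s =>
    (((hgd s).sub_const (g m)).const_mul 2).add_const (e ^ 2)
  have hPc : Continuous P := continuous_iff_continuousAt.2 fun t => (hPd t).continuousAt
  have hPpos : ∀ s, m ≤ s → 0 < P s := fun s hs => by
    have h1 : g m ≤ g s := hmin s hs
    have h2 : 0 < e ^ 2 := by positivity
    simp only [hP]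
    linarith
  set V : ℝ → ℝ := fun s => if s ≤ m then e + K * (m - s) else √(P s) with hV
  have hVl : ∀ s, s ≤ m → V s = e + K * (m - s) := fun s hs => if_pos hs
  have hVr : ∀ s, m ≤ s → V s = √(P s) := fun s hs => by
    rcases hs.eq_or_lt with rfl | hs
    · rw [hVl m le_rfl, hPm, Real.sqrt_sq hepos.le]
      simp
    · exact if_neg (not_le.2 hs)
  have hVc : Continuous V := by
    refine Continuous.if_le (by fun_prop) (by fun_prop) continuous_id continuous_const ?_
    intro s hs
    rw [hs, hPm, Real.sqrt_sq hepos.le]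
    simp
  have hVpos : ∀ s, 0 < V s := fun s => by
    rcases le_total s m with hs | hs
    · rw [hVl s hs]
      have : 0 ≤ K * (m - s) := mul_nonneg hKpos.le (by linarith)
      linarith
    · rw [hVr s hs]
      exact Real.sqrt_pos.2 (hPpos s hs)
  have hVlim : Tendsto (fun s => V s / √(2 * F s)) atTop (nhds 1) := by
    have hG := h.tendsto_integral_div (φ := fun s => √(2 * F s)) (C := 1) le_rfl
      (fun u _ => hcF.intervalIntegrable a u)
      (fun s _ => by rw [one_mul, abs_of_nonneg (Real.sqrt_nonneg _)])
    have h1 : Tendsto (fun t => (-K * (∫ s in a..t, √(2 * F s)) + (e ^ 2 / 2 - g m)) / F t)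
        atTop (nhds 0) := by
      have := (hG.const_mul (-K)).add (h.tendsto_atTop.const_div_atTop (e ^ 2 / 2 - g m))
      rw [mul_zero, add_zero] at this
      exact this.congr fun t => by ring
    refine (h.tendsto_sqrt_div h1).congr' ?_
    filter_upwards [eventually_ge_atTop m] with s hs
    rw [hVr s hs]
    congr 2
    simp only [hP, hg]
    ring
  have hVint := h.integrableOn_inv hVc hVpos hVlim
  have hVic : Continuous fun s => (V s)⁻¹ := hVc.inv₀ fun s => (hVpos s).ne'
  set y : ℝ → ℝ := fun t => ∫ s in Ioi t, (V s)⁻¹ with hy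
  have hyd : ∀ t, HasDerivAt y (-(V t)⁻¹) t := fun t =>
    hasDerivAt_integral_Ioi (hVint (t - 1)) (by linarith) hVic.continuousAt
  have hysub : ∀ s t, y s - y t = ∫ σ in s..t, (V σ)⁻¹ := fun s t =>
    intervalIntegral.integral_Ioi_sub_Ioi' (hVint s) (hVint t)
  have hypos : ∀ t, 0 < y t := fun t =>
    integral_Ioi_pos (hVint t) fun s _ => inv_pos.2 (hVpos s)
  refine ⟨y, continuous_iff_continuousAt.2 fun t => (hyd t).continuousAt, ?_, hypos, ?_, ?_, ?_⟩
  · intro s t hst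
    exact antitoneOn_integral_Ioi (hVint s) (fun σ _ => (inv_pos.2 (hVpos σ)).le)
      self_mem_Ici hst hst
  · have h1 := one_le_integral_linear hKpos hepos hMm' (min_le_right _ _)
    have h2 : ∫ s in M..m, (e + K * (m - s))⁻¹ = ∫ s in M..m, (V s)⁻¹ := by
      refine intervalIntegral.integral_congr fun s hs => ?_
      rw [uIcc_of_le hMm'.le] at hs
      simp only [hVl s hs.2]
    linarith [hysub M m, hypos m]
  · refine tendsto_integral_Ioi_div (h.integrableOn (a + 1) (by linarith)) (hVint (a + 1))
      (fun s _ => inv_pos.2 (hVpos s)) (hVlim.congr fun s => ?_)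
    rw [div_inv_eq_mul, one_div_mul_eq_div]
  · intro s has
    have hfs := h.nonneg s has
    rcases lt_or_ge s m with hsm | hsm
    · refine ⟨fun t => -y t, V, -K, Eventually.of_forall fun t => ?_, ?_, hVpos s,
        Eventually.of_forall fun _ => le_rfl, rfl, fun ρ h1 _ => ?_⟩
      · exact (hyd t).neg.congr_deriv (neg_neg _)
      · have h1 := (((hasDerivAt_id s).const_sub m).const_mul K).const_add e
        refine (h1.congr_deriv (by ring)).congr_of_eventuallyEq ?_
        filter_upwards [Iio_mem_nhds hsm] with t ht
        exact hVl t (le_of_lt ht)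
      · have h2 := div_nonneg hfs (hVpos s).le
        nlinarith
    · set W : ℝ → ℝ := fun t => √(P t) with hW
      have hWc : Continuous W := by fun_prop
      have hWs : 0 < W s := Real.sqrt_pos.2 (hPpos s hsm)
      have hWpos : ∀ᶠ t in nhds s, 0 < W t := hWc.continuousAt.eventually (lt_mem_nhds hWs)
      have hWle : ∀ᶠ t in nhds s, W t ≤ V t := by
        rcases hsm.eq_or_lt with rfl | hsm
        · have hd : HasDerivAt (fun t => (e + K * (m - t)) ^ 2 - P t)
              (-2 * K * e - 2 * (f m - K * √(2 * F m))) m := by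
            have h1 := ((((hasDerivAt_id m).const_sub m).const_mul K).const_add e).pow 2
            refine (h1.sub (hPd m)).congr_deriv ?_
            simp
            ring
          have hneg : -2 * K * e - 2 * (f m - K * √(2 * F m)) < 0 := by
            nlinarith [mul_pos hKpos hepos]
          have hsl := hd.tendsto_slope.eventually (gt_mem_nhds hneg)
          rw [eventually_nhdsWithin_iff] at hsl
          filter_upwards [hsl] with t ht
          rcases lt_or_ge t m with htm | htm
          · have h2 := ht htm.ne
            rw [slope_def_field, div_lt_iff_of_neg (by linarith), zero_mul, hPm] at h2
            have h3 : 0 < e + K * (m - t) := by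
              have := mul_pos hKpos (sub_pos.2 htm)
              linarith
            rw [hVl t htm.le]
            refine Real.sqrt_le_iff.2 ⟨h3.le, ?_⟩
            simp only [sub_self, mul_zero, add_zero] at h2
            linarith
          · exact (hVr t htm).ge
        · filter_upwards [Ioi_mem_nhds hsm] with t ht
          exact (hVr t (le_of_lt ht)).ge
      obtain ⟨l, r, hlr, hball⟩ := mem_nhds_iff_exists_Ioo_subset.1 (hWpos.and hWle)
      have hIc : ContinuousOn (fun t => (W t)⁻¹) (Ioo l r) :=
        hWc.continuousOn.inv₀ fun t ht => (hball ht).1.ne'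
      have hII : ∀ t ∈ Ioo l r, IntervalIntegrable (fun t => (W t)⁻¹) volume s t := fun t ht =>
        (hIc.mono ((convex_Ioo l r).ordConnected.uIcc_subset hlr ht)).intervalIntegrable
      refine ⟨fun t => -y s + ∫ σ in s..t, (W σ)⁻¹, W, (f s - K * √(2 * F s)) / W s, ?_, ?_, hWs,
        ?_, by simp, fun ρ h1 h2 => ?_⟩
      · filter_upwards [Ioo_mem_nhds hlr.1 hlr.2] with t ht
        exact (intervalIntegral.integral_hasDerivAt_right (hII t ht)
          (hIc.stronglyMeasurableAtFilter isOpen_Ioo t ht)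
          (hIc.continuousAt (isOpen_Ioo.mem_nhds ht))).const_add _
      · refine ((hPd s).sqrt (hPpos s hsm).ne').congr_deriv ?_
        exact mul_div_mul_left _ _ two_ne_zero
      · filter_upwards [Ioo_mem_nhds hlr.1 hlr.2] with t ht
        suffices (∫ σ in s..t, (W σ)⁻¹) ≤ ∫ σ in s..t, (V σ)⁻¹ by
          linarith [hysub s t]
        rcases le_total s t with hst | hst
        · refine (intervalIntegral.integral_congr fun σ hσ => ?_).le
          rw [uIcc_of_le hst] at hσ
          simp only [hVr σ (hsm.trans hσ.1), hW]
        · rw [intervalIntegral.integral_symm t s, intervalIntegral.integral_symm t s,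
            neg_le_neg_iff]
          refine intervalIntegral.integral_mono_on hst (hVic.intervalIntegrable _ _)
            (hII t ht).symm fun σ hσ => ?_
          have hσ' := hball ⟨ht.1.trans_le hσ.1, hσ.2.trans_lt hlr.2⟩
          exact inv_anti₀ hσ'.1 hσ'.2
      · have hG0 : 0 ≤ ∫ σ in a..s, √(2 * F σ) :=
          intervalIntegral.integral_nonneg has fun _ _ => Real.sqrt_nonneg _
        have hWF : W s ≤ √(2 * F s) := by
          refine Real.sqrt_le_sqrt ?_
          have h3 : e ^ 2 ≤ 1 := by nlinarith
          have h4 : 1 ≤ g m := hm1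
          have h5 : g s ≤ F s := by
            simp only [hg]
            have := mul_nonneg hKpos.le hG0
            linarith
          simp only [hP]
          linarith
        have h6 : f s / W s - ρ * ((f s - K * √(2 * F s)) / W s)
            = (f s * (1 - ρ) + ρ * K * √(2 * F s)) / W s := by ring
        rw [h6, lt_div_iff₀ hWs]
        have h7 : 0 ≤ f s * (1 - ρ) := mul_nonneg hfs (by linarith)
        have h8 : n < ρ * K := by nlinarith
        have h9 : ρ * K * W s ≤ ρ * K * √(2 * F s) := by gcongr
        nlinarith

/-- Comparison from above: a large solution grows at most as fast as the one-dimensional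
profile. -/
lemma le_tail (h : KellerOsserman f F a) {N : ℕ} (hN : 1 ≤ N) {u : EuclideanSpace ℝ (Fin N) → ℝ}
    (hu : IsLargeSolution f u) {δ : ℝ} (hδ : 0 < δ) (hδ1 : δ < 1) :
    ∀ᶠ x in comap (fun x : EuclideanSpace ℝ (Fin N) => ‖x‖) (nhdsWithin 1 (Iio 1)),
      (1 - δ) ^ 2 * (1 - ‖x‖) ≤ ∫ s in Ioi (u x), 1 / √(2 * F s) := by
  obtain ⟨Z, hZ, hZu⟩ := mem_comap.1 (hu.tendsto_atTop.eventually_ge_atTop a)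
  obtain ⟨r', hr', hr'Z⟩ := mem_nhdsLT_iff_exists_Ioo_subset.1 hZ
  obtain ⟨r₀, hr₀, hr₀1⟩ := exists_between (max_lt (show r' < 1 from hr') one_half_lt_one)
  have hr₀h : 1 / 2 < r₀ := (le_max_right _ _).trans_lt hr₀
  have hua : ∀ x : EuclideanSpace ℝ (Fin N), r₀ ≤ ‖x‖ → ‖x‖ < 1 → a ≤ u x :=
    fun x h1 h2 => hZu (hr'Z ⟨((le_max_left _ _).trans_lt hr₀).trans_le h1, h2⟩)
  obtain ⟨M, hM⟩ : ∃ M, ∀ x : EuclideanSpace ℝ (Fin N), ‖x‖ = r₀ → u x ≤ M := by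
    obtain ⟨M, hM⟩ := ((isCompact_sphere (0 : EuclideanSpace ℝ (Fin N)) r₀).image_of_continuousOn
      (f := u) fun x hx => (hu.contDiffAt (by
        rw [mem_sphere_zero_iff_norm] at hx
        rwa [hx])).continuousAt.continuousWithinAt).bddAbove
    exact ⟨M, fun x hx => hM ⟨x, by simpa using hx, rfl⟩⟩
  have hNpos : (0 : ℝ) < N := by exact_mod_cast hN
  obtain ⟨y, hyc, hyanti, hypos, hyM, hyratio, hytouch⟩ := h.exists_profile hNpos M
  have hΘ : ∀ x : EuclideanSpace ℝ (Fin N), r₀ ≤ ‖x‖ → ‖x‖ < 1 →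
      (1 - ‖x‖ ^ 2) / 2 - y (u x) ≤ 0 := by
    intro x hx₀ hx₁
    refine le_zero_of_forall_not_isLocalMax (Θ := fun x => (1 - ‖x‖ ^ 2) / 2 - y (u x))
      (r₀ := r₀) ?_ ?_ ?_ ?_ hx₀ hx₁
    · intro x _ h2
      have h3 := (hu.contDiffAt h2).continuousAt
      fun_prop
    · intro x hx
      have := hyanti (hM x hx)
      nlinarith [norm_nonneg x]
    · intro θ hθ
      filter_upwards [eventually_norm_mem_Ioo (N := N) (show max 0 (1 - θ) < 1 by simp [hθ])]
        with x hx
      have h3 : 1 - θ < ‖x‖ := (le_max_right _ _).trans_lt hx.1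
      have h4 := hx.2
      have h5 := hypos (u x)
      nlinarith [norm_nonneg x]
    · intro x h1 h2 _ hmax
      have hux := hua x h1.le h2
      obtain ⟨T, W, W', hT, hW, hWpos, hTle, hTeq, hstrict⟩ := hytouch (u x) hux
      have hmax' : IsLocalMax (fun z => T (u z) - 1 / 2 * ‖z‖ ^ 2) x := by
        filter_upwards [hmax, (hu.contDiffAt h2).continuousAt.eventually hTle] with z hz hz'
        linarith
      have key := lapl_div_sub_le_of_isLocalMax (hu.contDiffAt h2) hT hW hWpos.ne' hmax'
      rw [hu.2.1 x (by simpa using h2)] at key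
      have := hstrict (‖x‖ ^ 2) (by nlinarith) (by nlinarith [norm_nonneg x])
      linarith
  have hev := (hyratio.comp hu.tendsto_atTop).eventually
    (lt_mem_nhds (show 1 - δ < (1 : ℝ) by linarith))
  filter_upwards [hev, eventually_norm_mem_Ioo (N := N) hr₀1,
    eventually_norm_mem_Ioo (N := N) (show 1 - δ < 1 by linarith)] with x h1 h2 h3
  have h4 : (1 - δ) * y (u x) < ∫ s in Ioi (u x), 1 / √(2 * F s) := (lt_div_iff₀ (hypos _)).1 h1
  have h5 := hΘ x h2.1.le h2.2
  have h6 : (1 - δ) * (1 - ‖x‖) ≤ (1 - ‖x‖ ^ 2) / 2 := by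
    have : (1 - ‖x‖ ^ 2) / 2 = ((1 + ‖x‖) / 2) * (1 - ‖x‖) := by ring
    rw [this]
    refine mul_le_mul_of_nonneg_right ?_ (by linarith [h2.2])
    linarith [h3.1, h3.2]
  nlinarith

/-- The hypotheses of positivity and Keller–Osserman type in terms of the primitive based at `a`. -/
lemma of_integrableOn (hf : Continuous f) (ha : 0 < f a) (hfpos : ∀ t, a < t → 0 ≤ f t)
    (hF : ∀ t, F t = ∫ s in a..t, f s) {M : ℝ}
    (hint : IntegrableOn (fun t => 1 / √(F t)) (Ici M)) : KellerOsserman f F a := by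
  have hnn : ∀ t, a ≤ t → 0 ≤ f t := fun t ht => by
    rcases ht.eq_or_lt with rfl | ht
    exacts [ha.le, hfpos t ht]
  have hd : ∀ t, HasDerivAt F (f t) t := fun t => by
    rw [funext hF]
    exact (hf.integral_hasStrictDerivAt a t).hasDerivAt
  have hc : Continuous F := continuous_iff_continuousAt.2 fun t => (hd t).continuousAt
  have hpos : ∀ t, a < t → 0 < F t := fun t ht => by
    rw [hF]
    exact intervalIntegral.integral_pos ht hf.continuousOn (fun s hs => hnn s hs.1.le)
      ⟨a, left_mem_Icc.2 ht.le, ha⟩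
  refine ⟨hnn, hd, by simp [hF], hpos, fun t ht => ?_⟩
  refine IntegrableOn.mono_set (t := Icc t M ∪ Ici M) (.union ?_ ?_) fun s hs => ?_
  · refine ContinuousOn.integrableOn_Icc (continuousOn_const.div (by fun_prop) fun s hs => ?_)
    have := hpos s (ht.trans_le hs.1)
    positivity
  · refine IntegrableOn.congr_fun (hint.const_mul (1 / √2)) (fun s _ => ?_) measurableSet_Ici
    simp only [Real.sqrt_mul zero_le_two, one_div_mul_one_div]
  · rcases le_total s M with h | h
    exacts [.inl ⟨le_of_lt hs, h⟩, .inr h]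

/-- Two functions whose tails are equivalent to the same function are close relative to the
tails. -/
lemma tendsto_integral_div_tail (h : KellerOsserman f F a) {ι : Type*} {l : Filter ι}
    {p q ρ : ι → ℝ} (hp : Tendsto p l atTop) (hq : Tendsto q l atTop)
    (hpρ : Tendsto (fun x => (∫ s in Ioi (p x), 1 / √(2 * F s)) / ρ x) l (nhds 1))
    (hqρ : Tendsto (fun x => (∫ s in Ioi (q x), 1 / √(2 * F s)) / ρ x) l (nhds 1)) :
    Tendsto (fun x => (∫ s in p x..q x, 1 / √(2 * F s)) / ∫ s in Ioi (p x), 1 / √(2 * F s))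
      l (nhds 0) := by
  have h1 := (hqρ.div hpρ one_ne_zero).const_sub 1
  rw [div_one, sub_self] at h1
  refine h1.congr' ?_
  filter_upwards [hp.eventually_gt_atTop a, hq.eventually_gt_atTop a,
    hpρ.eventually (lt_mem_nhds one_pos)] with x hpx hqx hx
  have hρ : ρ x ≠ 0 := fun h0 => by
    simp only [h0, div_zero, lt_irrefl] at hx
  have hΨ : (∫ s in Ioi (p x), 1 / √(2 * F s)) ≠ 0 := fun h0 => by
    simp only [h0, zero_div, lt_irrefl] at hx
  rw [← intervalIntegral.integral_Ioi_sub_Ioi' (h.integrableOn _ hpx) (h.integrableOn _ hqx),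
    Pi.div_apply, div_div_div_cancel_right₀ hρ, sub_div, div_self hΨ]

/-- The tail at a large solution is equivalent to the distance to the boundary. -/
lemma tendsto_tail_div_one_sub_norm (h : KellerOsserman f F a) {N : ℕ} (hN : 1 ≤ N)
    {u : EuclideanSpace ℝ (Fin N) → ℝ} (hu : IsLargeSolution f u) :
    Tendsto (fun x => (∫ s in Ioi (u x), 1 / √(2 * F s)) / (1 - ‖x‖))
      (comap (fun x : EuclideanSpace ℝ (Fin N) => ‖x‖) (nhdsWithin 1 (Iio 1))) (nhds 1) := by
  have hlt : ∀ᶠ x in comap (fun x : EuclideanSpace ℝ (Fin N) => ‖x‖) (nhdsWithin 1 (Iio 1)),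
      0 < 1 - ‖x‖ := by
    filter_upwards [eventually_norm_mem_Ioo (N := N) zero_lt_one] with x hx
    linarith [hx.2]
  refine tendsto_order.2 ⟨fun b hb => ?_, fun b hb => ?_⟩
  · have hlim : Tendsto (fun δ : ℝ => (1 - δ) ^ 2) (nhdsWithin 0 (Ioi 0)) (nhds 1) := by
      have : Continuous fun δ : ℝ => (1 - δ) ^ 2 := by fun_prop
      simpa using (this.tendsto 0).mono_left nhdsWithin_le_nhds
    obtain ⟨δ, hδb, hδ, hδ1⟩ := ((hlim.eventually (lt_mem_nhds hb)).and
      (Ioo_mem_nhdsGT (zero_lt_one (α := ℝ)))).exists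
    filter_upwards [h.le_tail hN hu hδ hδ1, hlt] with x hx h0
    exact hδb.trans_le ((le_div_iff₀ h0).2 hx)
  · have hlim : Tendsto (fun δ : ℝ => (1 + δ) ^ 2) (nhdsWithin 0 (Ioi 0)) (nhds 1) := by
      have : Continuous fun δ : ℝ => (1 + δ) ^ 2 := by fun_prop
      simpa using (this.tendsto 0).mono_left nhdsWithin_le_nhds
    obtain ⟨δ, hδb, hδ⟩ := ((hlim.eventually (gt_mem_nhds hb)).and self_mem_nhdsWithin).exists
    filter_upwards [h.tail_le hN hu hδ, hlt] with x hx h0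
    exact ((div_le_iff₀ h0).2 hx).trans_lt hδb

end KellerOsserman

theorem stmt6 {N : ℕ} (hN : 1 ≤ N)
    (f : ℝ → ℝ) (hf : Continuous f)
    (a : ℝ) (ha : 0 < f a) (hfpos : ∀ t, a < t → 0 ≤ f t)
    (F : ℝ → ℝ) (hF : ∀ t, F t = ∫ s in a..t, f s)
    (hKO : ∃ M, a < M ∧ IntegrableOn (fun t => 1 / Real.sqrt (F t)) (Ici M))
    (U₀ : ℝ) (hU₀ : a < U₀)
    (v : ℕ → ℝ → ℝ)
    (hv0 : ∀ t ∈ Ici U₀, v 0 t = Real.sqrt (2 * F t))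
    -- well-definedness of the iteration: each vₖ is positive, continuous,
    -- comparable to v₀, and its tail integrals converge
    (hvpos : ∀ k, ∀ t ∈ Ici U₀, 0 < v k t)
    (hvcont : ∀ k, ContinuousOn (v k) (Ici U₀))
    (hvcomp : ∀ k, ∃ c > (0:ℝ), ∃ C > (0:ℝ), ∀ t ∈ Ici U₀,
      c * Real.sqrt (2 * F t) ≤ v k t ∧ v k t ≤ C * Real.sqrt (2 * F t))
    (hvint : ∀ k, ∀ t ∈ Ici U₀, IntegrableOn (fun s => (v k s)⁻¹) (Ioi t))
    (hvrec : ∀ k, ∀ t ∈ Ici U₀, v (k + 1) t = Real.sqrt (2 * (F t -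
      ((N : ℝ) - 1) * ∫ s in U₀..t, v k s / (1 - ∫ σ in Ioi s, (v k σ)⁻¹))))
    (uk : ℕ → ℝ → ℝ) (rk : ℕ → ℝ) (hrk : ∀ k, rk k < 1)
    (huk : ∀ k, ∀ r ∈ Ioo (rk k) 1, HasDerivAt (uk k) (v k (uk k r)) r)
    (hukblow : ∀ k, Tendsto (uk k) (nhdsWithin 1 (Iio 1)) atTop) :
    (∀ k, Tendsto (fun r =>
        (∫ t in uk k r..uk (k + 1) r, 1 / Real.sqrt (2 * F t)) /
        (∫ t in Ioi (uk k r), 1 / Real.sqrt (2 * F t)))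
      (nhdsWithin 1 (Iio 1)) (nhds 0)) ∧
    ∀ k, ∀ u : EuclideanSpace ℝ (Fin N) → ℝ, IsLargeSolution f u →
      Tendsto (fun x : EuclideanSpace ℝ (Fin N) =>
        (∫ t in uk k ‖x‖..u x, 1 / Real.sqrt (2 * F t)) /
        (∫ t in Ioi (uk k ‖x‖), 1 / Real.sqrt (2 * F t)))
      (comap (fun x : EuclideanSpace ℝ (Fin N) => ‖x‖) (nhdsWithin 1 (Iio 1)))
      (nhds 0) := by
  obtain ⟨M, -, hint⟩ := hKO
  have h := KellerOsserman.of_integrableOn hf ha hfpos hF hint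
  have hlim : ∀ k, Tendsto (fun t => v k t / √(2 * F t)) atTop (nhds 1) := by
    rintro (_ | k)
    · refine tendsto_const_nhds.congr' ?_
      filter_upwards [eventually_ge_atTop U₀] with t ht
      rw [← hv0 t ht, div_self (hvpos 0 t ht).ne']
    · obtain ⟨_, _, C, _, hC⟩ := hvcomp k
      exact h.tendsto_iterate_div (fun t ht => (hC t ht).2) (hvpos k) (hvrec k)
  have htail := fun k => h.tendsto_tail_div_one_sub (hrk k) (hvpos k) (hvcont k)
    (hvint k U₀ self_mem_Ici) (hlim k) (huk k) (hukblow k)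
  refine ⟨fun k => h.tendsto_integral_div_tail (hukblow k) (hukblow (k + 1)) (htail k)
    (htail (k + 1)), fun k u hu => ?_⟩
  exact h.tendsto_integral_div_tail ((hukblow k).comp tendsto_comap) hu.tendsto_atTop
    ((htail k).comp tendsto_comap) (h.tendsto_tail_div_one_sub_norm hN hu)
end

section
/- Let f be continuous satisfying (P) and (KO). Suppose v̲ is continuous on the closed unit ball of ℝ^N, twice continuously differentiable on the open unit ball B, and satisfies Δv̲(x) ≥ f(v̲(x)) for all x ∈ B. Then there exists a radial large solution V of Δu = f(u) in B (i.e. V is a large solution and V(x) = w(‖x‖) for some w : [0,1) → ℝ) such that V(x) ≥ v̲(x) for all x ∈ B. -/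
open MeasureTheory Filter Metric Set

/-- The weighted average `∫₀¹ τ^d h(rτ) dτ`. -/
noncomputable def radAvg (d : ℕ) (h : ℝ → ℝ) (r : ℝ) : ℝ :=
  ∫ τ in (0 : ℝ)..1, τ ^ d * h (r * τ)

theorem continuous_radAvg (d : ℕ) {h : ℝ → ℝ} (hh : Continuous h) : Continuous (radAvg d h) := by
  unfold radAvg
  apply intervalIntegral.continuous_parametric_intervalIntegral_of_continuous'
  unfold Function.uncurry
  fun_prop

theorem radAvg_mono_on (d : ℕ) {h k : ℝ → ℝ} (hh : Continuous h) (hk : Continuous k) {r : ℝ}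
    (hr : 0 ≤ r) (hle : ∀ s ∈ Icc 0 r, h s ≤ k s) : radAvg d h r ≤ radAvg d k r := by
  unfold radAvg
  apply intervalIntegral.integral_mono_on zero_le_one
  · exact Continuous.intervalIntegrable (by fun_prop) _ _
  · exact Continuous.intervalIntegrable (by fun_prop) _ _
  · intro τ hτ
    have h1 : h (r * τ) ≤ k (r * τ) :=
      hle _ ⟨mul_nonneg hr hτ.1, mul_le_of_le_one_right hr hτ.2⟩
    exact mul_le_mul_of_nonneg_left h1 (pow_nonneg hτ.1 d)

theorem radAvg_const (d : ℕ) (c r : ℝ) : radAvg d (fun _ => c) r = c / (d + 1) := by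
  unfold radAvg
  rw [intervalIntegral.integral_mul_const, integral_pow]
  simp
  ring

theorem radAvg_le (d : ℕ) {h : ℝ → ℝ} (hh : Continuous h) {r M : ℝ}
    (hr : 0 ≤ r) (hM : 0 ≤ M) (hle : ∀ s ∈ Icc 0 r, h s ≤ M) : radAvg d h r ≤ M := by
  refine (radAvg_mono_on d hh (continuous_const (y := M)) hr hle).trans ?_
  rw [radAvg_const]
  exact div_le_self hM (by simp)

theorem abs_radAvg_sub_le (d : ℕ) {h k : ℝ → ℝ} (hh : Continuous h) (hk : Continuous k)
    {r M : ℝ} (hM : ∀ τ ∈ Icc (0 : ℝ) 1, |h (r * τ) - k (r * τ)| ≤ M) :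
    |radAvg d h r - radAvg d k r| ≤ M := by
  unfold radAvg
  rw [← intervalIntegral.integral_sub]
  · have := intervalIntegral.norm_integral_le_of_norm_le_const (a := (0 : ℝ)) (b := 1) (C := M)
      (f := fun τ => τ ^ d * h (r * τ) - τ ^ d * k (r * τ)) ?_
    · simpa using this
    · intro τ hτ
      rw [uIoc_of_le zero_le_one] at hτ
      rw [← mul_sub, norm_mul, Real.norm_eq_abs, Real.norm_eq_abs, abs_pow, abs_of_pos hτ.1]
      have h1 := hM τ ⟨hτ.1.le, hτ.2⟩
      calc τ ^ d * |h (r * τ) - k (r * τ)| ≤ 1 * |h (r * τ) - k (r * τ)| :=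
            mul_le_mul_of_nonneg_right (pow_le_one₀ hτ.1.le hτ.2) (abs_nonneg _)
        _ ≤ M := by simpa using h1
  · exact Continuous.intervalIntegrable (by fun_prop) _ _
  · exact Continuous.intervalIntegrable (by fun_prop) _ _

theorem abs_radAvg_le (d : ℕ) {h : ℝ → ℝ} (hh : Continuous h)
    {r M : ℝ} (hM : ∀ τ ∈ Icc (0 : ℝ) 1, |h (r * τ)| ≤ M) :
    |radAvg d h r| ≤ M := by
  have := abs_radAvg_sub_le d hh (continuous_const (y := (0 : ℝ))) (r := r) (M := M)
    (by simpa using hM)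
  simpa [radAvg_const] using this

theorem pow_mul_radAvg (d : ℕ) (h : ℝ → ℝ) (r : ℝ) :
    r ^ (d + 1) * radAvg d h r = ∫ t in (0 : ℝ)..r, t ^ d * h t := by
  have := intervalIntegral.smul_integral_comp_mul_left (a := 0) (b := 1) (fun t => t ^ d * h t) r
  simp only [mul_zero, mul_one, smul_eq_mul, mul_pow] at this
  rw [← this, pow_succ', mul_assoc, radAvg, ← intervalIntegral.integral_const_mul]
  simp only [mul_assoc]

theorem hasDerivAt_pow_mul_radAvg (d : ℕ) {h : ℝ → ℝ} (hh : Continuous h) (r : ℝ) :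
    HasDerivAt (fun r => r ^ (d + 1) * radAvg d h r) (r ^ d * h r) r := by
  have : (fun r => r ^ (d + 1) * radAvg d h r) = fun r => ∫ t in (0 : ℝ)..r, t ^ d * h t :=
    funext fun r => pow_mul_radAvg d h r
  rw [this]
  have hc : Continuous fun t : ℝ => t ^ d * h t := by fun_prop
  exact (hc.integral_hasStrictDerivAt 0 r).hasDerivAt

/-- `u` solves the radial form of `Δu = g(u)` in dimension `d + 1`, in integrated form. -/
structure IsRadialSol (d : ℕ) (g u : ℝ → ℝ) : Prop where
  cont : Continuous u
  eq : ∀ r, u r = u 0 + ∫ s in (0 : ℝ)..r, s * radAvg d (g ∘ u) s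

namespace IsRadialSol

variable {d : ℕ} {g u : ℝ → ℝ}

theorem hasDerivAt (hu : IsRadialSol d g u) (hg : Continuous g) (r : ℝ) :
    HasDerivAt u (r * radAvg d (g ∘ u) r) r := by
  have hq := continuous_radAvg d (hg.comp hu.cont)
  have hc : Continuous fun s : ℝ => s * radAvg d (g ∘ u) s := by fun_prop
  have h1 := ((hc.integral_hasStrictDerivAt 0 r).hasDerivAt).const_add (u 0)
  exact h1.congr_of_eventuallyEq (Eventually.of_forall fun r => hu.eq r)

theorem monotoneOn_of_gt (hu : IsRadialSol d g u) (hg : Continuous g) {a : ℝ}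
    (hpos : ∀ t, a ≤ t → 0 ≤ g t) {ξ ρ : ℝ} (hξ : 0 ≤ ξ)
    (hP : 0 ≤ ξ ^ (d + 1) * radAvg d (g ∘ u) ξ) (hgt : ∀ s ∈ Ioo ξ ρ, a ≤ u s) :
    (∀ s ∈ Icc ξ ρ, 0 ≤ s ^ (d + 1) * radAvg d (g ∘ u) s) ∧ MonotoneOn u (Icc ξ ρ) := by
  have hgu := hg.comp hu.cont
  have hmono : MonotoneOn (fun s => s ^ (d + 1) * radAvg d (g ∘ u) s) (Icc ξ ρ) := by
    apply monotoneOn_of_deriv_nonneg (convex_Icc _ _)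
    · exact fun s _ => (hasDerivAt_pow_mul_radAvg d hgu s).continuousAt.continuousWithinAt
    · exact fun s _ => (hasDerivAt_pow_mul_radAvg d hgu s).differentiableAt.differentiableWithinAt
    · intro s hs
      rw [interior_Icc] at hs
      rw [(hasDerivAt_pow_mul_radAvg d hgu s).deriv]
      exact mul_nonneg (pow_nonneg (hξ.trans hs.1.le) d) (hpos _ (hgt s hs))
  have hP' : ∀ s ∈ Icc ξ ρ, 0 ≤ s ^ (d + 1) * radAvg d (g ∘ u) s := fun s hs =>
    hP.trans (hmono ⟨le_rfl, hs.1.trans hs.2⟩ hs hs.1)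
  refine ⟨hP', ?_⟩
  apply monotoneOn_of_deriv_nonneg (convex_Icc _ _) hu.cont.continuousOn
  · exact fun s _ => (hu.hasDerivAt hg s).differentiableAt.differentiableWithinAt
  · intro s hs
    rw [interior_Icc] at hs
    rw [(hu.hasDerivAt hg s).deriv]
    have hs0 : 0 < s := hξ.trans_lt hs.1
    have := hP' s ⟨hs.1.le, hs.2.le⟩
    exact mul_nonneg hs0.le (nonneg_of_mul_nonneg_right this (pow_pos hs0 _))

/-- Once a radial solution exceeds the level beyond which `g` is nonnegative, it increases. -/
theorem monotone_after (hu : IsRadialSol d g u) (hg : Continuous g) {a : ℝ}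
    (hpos : ∀ t, a ≤ t → 0 ≤ g t) {r : ℝ} (hr : 0 ≤ r) (hgt : a < u r) :
    MonotoneOn u (Ici r) ∧ ∀ s, r ≤ s → 0 ≤ s ^ (d + 1) * radAvg d (g ∘ u) s := by
  obtain ⟨ξ, hξ0, hξr, hPξ, hξgt⟩ : ∃ ξ, 0 ≤ ξ ∧ ξ ≤ r ∧
      0 ≤ ξ ^ (d + 1) * radAvg d (g ∘ u) ξ ∧ ∀ s ∈ Icc ξ r, a < u s := by
    by_cases hall : ∀ s ∈ Icc 0 r, a < u s
    · exact ⟨0, le_rfl, hr, by simp, hall⟩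
    · push Not at hall
      have hcomp : IsCompact (Icc 0 r ∩ {s | u s ≤ a}) :=
        isCompact_Icc.inter_right (isClosed_le hu.cont continuous_const)
      obtain ⟨r₁, ⟨hr₁, hur₁⟩, hmax⟩ := hcomp.exists_isGreatest hall
      have hlt : r₁ < r := lt_of_le_of_ne hr₁.2 (by rintro rfl; exact absurd hgt (not_lt.2 hur₁))
      obtain ⟨ξ, hξ, hd⟩ := exists_deriv_eq_slope u hlt hu.cont.continuousOn
        (fun s _ => (hu.hasDerivAt hg s).differentiableAt.differentiableWithinAt)
      have hξ0 : 0 < ξ := hr₁.1.trans_lt hξ.1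
      rw [(hu.hasDerivAt hg ξ).deriv] at hd
      have hur₁' : u r₁ ≤ a := hur₁
      have hd0 : 0 < ξ * radAvg d (g ∘ u) ξ := by
        rw [hd]; exact div_pos (by linarith) (by linarith)
      have := pos_of_mul_pos_right hd0 hξ0.le
      refine ⟨ξ, hξ0.le, hξ.2.le, by positivity, fun s hs => ?_⟩
      by_contra hcon
      have := hmax ⟨⟨hξ0.le.trans hs.1, hs.2⟩, not_lt.1 hcon⟩
      linarith [hξ.1, hs.1]
  have hgt' : ∀ s, ξ ≤ s → a < u s := by
    intro s' hs'
    by_contra hcon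
    have hcomp : IsCompact (Icc ξ s' ∩ {s | u s ≤ a}) :=
      isCompact_Icc.inter_right (isClosed_le hu.cont continuous_const)
    obtain ⟨ρ, ⟨hρ, huρ⟩, hmin⟩ := hcomp.exists_isLeast ⟨s', ⟨hs', le_rfl⟩, not_lt.1 hcon⟩
    have := (hu.monotoneOn_of_gt hg hpos (ρ := ρ) hξ0 hPξ (fun s hs => by
      by_contra h
      have := hmin ⟨⟨hs.1.le, hs.2.le.trans hρ.2⟩, (not_le.1 h).le⟩
      linarith [hs.2])).2 ⟨le_rfl, hρ.1⟩ ⟨hρ.1, le_rfl⟩ hρ.1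
    have h2 := hξgt ξ ⟨le_rfl, hξr⟩
    have huρ' : u ρ ≤ a := huρ
    linarith
  have key := fun ρ => hu.monotoneOn_of_gt hg hpos (ρ := ρ) hξ0 hPξ (fun s hs => (hgt' s hs.1.le).le)
  constructor
  · intro x hx y hy hxy
    exact (key y).2 ⟨hξr.trans hx, hxy⟩ ⟨hξr.trans hy, le_rfl⟩ hxy
  · intro s hs
    exact (key s).1 s ⟨hξr.trans hs, le_rfl⟩

/-- Climbing one level takes a definite amount of time. -/
theorem one_le_mul_sub (hu : IsRadialSol d g u) (hg : Continuous g) {a B M : ℝ}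
    (hpos : ∀ t, a ≤ t → 0 ≤ g t) (haB : a ≤ B) (hM : ∀ t ≤ B + 1, g t ≤ M) {r r' : ℝ}
    (hr : 0 ≤ r) (hrr' : r ≤ r') (hr' : r' ≤ 1) (hur : u r ≤ B) (hur' : B + 1 ≤ u r') :
    1 ≤ M * (r' - r) := by
  have hM0 : 0 ≤ M := (hpos B haB).trans (hM B (by linarith))
  obtain ⟨r₂, hr₂, hur₂⟩ := intermediate_value_Icc hrr' hu.cont.continuousOn
    (show B + 1 ∈ Icc (u r) (u r') from ⟨by linarith, hur'⟩)
  have hle : ∀ s ∈ Icc 0 r₂, u s ≤ B + 1 := by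
    intro s hs
    by_contra hcon
    have hm := (hu.monotone_after hg hpos hs.1 (by linarith : a < u s)).1 self_mem_Ici hs.2 hs.2
    linarith
  have h1 : u r₂ - u r ≤ M * (r₂ - r) := by
    apply (convex_Icc r r₂).image_sub_le_mul_sub_of_deriv_le hu.cont.continuousOn
    · exact fun s _ => (hu.hasDerivAt hg s).differentiableAt.differentiableWithinAt
    · intro s hs
      rw [interior_Icc] at hs
      rw [(hu.hasDerivAt hg s).deriv]
      have hs0 : 0 ≤ s := hr.trans hs.1.le
      have hs1 : s ≤ 1 := by linarith [hs.2, hr₂.2]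
      have hq : radAvg d (g ∘ u) s ≤ M := radAvg_le d (hg.comp hu.cont) hs0 hM0
        (fun t ht => hM _ (hle t ⟨ht.1, ht.2.trans hs.2.le⟩))
      calc s * radAvg d (g ∘ u) s ≤ s * M := mul_le_mul_of_nonneg_left hq hs0
        _ ≤ 1 * M := mul_le_mul_of_nonneg_right hs1 hM0
        _ = M := one_mul M
    · exact ⟨le_rfl, hr₂.1⟩
    · exact ⟨hr₂.1, le_rfl⟩
    · exact hr₂.1
  have : M * (r₂ - r) ≤ M * (r' - r) := mul_le_mul_of_nonneg_left (by linarith [hr₂.2]) hM0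
  linarith

end IsRadialSol

theorem second_deriv_nonneg_of_isLocalMin {ψ ψ' : ℝ → ℝ} {D : ℝ} {x : ℝ}
    (h1 : ∀ᶠ t in nhds x, HasDerivAt ψ (ψ' t) t) (h2 : HasDerivAt ψ' D x)
    (hmin : IsLocalMin ψ x) : 0 ≤ D := by
  by_contra hneg
  push Not at hneg
  have hc : ∀ t, HasDerivAt (fun t : ℝ => (D / 4) * (t - x) ^ 2) ((D / 2) * (t - x)) t := fun t => by
    have := (((hasDerivAt_id t).sub_const x).pow 2).const_mul (D / 4)
    refine this.congr_deriv ?_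
    simp; ring
  have hψ : ∀ᶠ t : ℝ in nhds x, HasDerivAt (fun t : ℝ => ψ t - (D / 4) * (t - x) ^ 2)
      (ψ' t - (D / 2) * (t - x)) t := h1.mono fun t ht => ht.sub (hc t)
  have hderiv : deriv (fun t : ℝ => ψ t - (D / 4) * (t - x) ^ 2) =ᶠ[nhds x]
      fun t => ψ' t - (D / 2) * (t - x) := hψ.mono fun t ht => ht.deriv
  have hdd : HasDerivAt (fun t : ℝ => ψ' t - (D / 2) * (t - x)) (D / 2) x := by
    have := h2.sub (((hasDerivAt_id x).sub_const x).const_mul (D / 2))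
    refine this.congr_deriv ?_
    ring
  have hgrad : ψ' x = 0 := hmin.hasDerivAt_eq_zero h1.self_of_nhds
  have hmax : IsLocalMax (fun t : ℝ => ψ t - (D / 4) * (t - x) ^ 2) x := by
    apply isLocalMax_of_deriv_deriv_neg
    · rw [hderiv.deriv_eq, hdd.deriv]; linarith
    · rw [hderiv.self_of_nhds]; simp [hgrad]
    · exact hψ.self_of_nhds.continuousAt
  have hev : ∀ᶠ t : ℝ in nhds x, t = x := by
    filter_upwards [hmax, hmin] with t h1 h2
    by_contra ht
    have : 0 < (t - x) ^ 2 := by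
      have := sub_ne_zero.2 ht
      positivity
    simp only [sub_self] at h1
    nlinarith
  have h3 : ∀ᶠ t : ℝ in nhdsWithin x {x}ᶜ, False := by
    filter_upwards [nhdsWithin_le_nhds hev, self_mem_nhdsWithin] with t h h'
    exact h' h
  exact (inferInstance : (nhdsWithin x {x}ᶜ).NeBot).ne (Filter.eventually_false_iff_eq_bot.1 h3)

/-- The second-derivative test: the Laplacian is nonnegative at an interior minimum. -/
theorem lapl_nonneg_of_isLocalMin {N : ℕ} {φ : EuclideanSpace ℝ (Fin N) → ℝ}
    {x : EuclideanSpace ℝ (Fin N)} (hφ : ContDiffAt ℝ 2 φ x) (hmin : IsLocalMin φ x) :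
    0 ≤ lapl φ x := by
  apply Finset.sum_nonneg
  intro i _
  generalize EuclideanSpace.single i (1 : ℝ) = e
  rw [iteratedFDeriv_two_apply]
  simp only [Matrix.cons_val_zero, Matrix.cons_val_one]
  have hline : ∀ t : ℝ, HasDerivAt (fun t : ℝ => x + t • e) e t := fun t => by
    simpa using ((hasDerivAt_id t).smul_const e).const_add x
  have hline0 : Tendsto (fun t : ℝ => x + t • e) (nhds 0) (nhds x) := by
    have := (hline 0).continuousAt.tendsto
    rwa [zero_smul, add_zero] at this
  have hdiff : ∀ᶠ t : ℝ in nhds 0, DifferentiableAt ℝ φ (x + t • e) := by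
    have h1 : ∀ᶠ y in nhds x, ContDiffAt ℝ 2 φ y := hφ.eventually (by simp)
    exact (hline0.eventually h1).mono fun t ht => ht.differentiableAt (by norm_num)
  have hfd : HasFDerivAt (fderiv ℝ φ) (fderiv ℝ (fderiv ℝ φ) x) x :=
    ((hφ.fderiv_right (m := 1) (by norm_num)).differentiableAt (by norm_num)).hasFDerivAt
  refine second_deriv_nonneg_of_isLocalMin (ψ := fun t : ℝ => φ (x + t • e))
    (ψ' := fun t => fderiv ℝ φ (x + t • e) e) (x := 0) ?_ ?_ ?_
  · filter_upwards [hdiff] with t ht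
    exact ht.hasFDerivAt.comp_hasDerivAt t (hline t)
  · have h1 : HasDerivAt (fun t : ℝ => fderiv ℝ φ (x + t • e)) (fderiv ℝ (fderiv ℝ φ) x e) 0 :=
      hfd.comp_hasDerivAt_of_eq 0 (hline 0) (by rw [zero_smul, add_zero])
    simpa using h1.clm_apply (hasDerivAt_const (0 : ℝ) e)
  · have := hline0.eventually hmin
    simpa only [IsLocalMin, IsMinFilter, zero_smul, add_zero] using this

theorem lapl_add {N : ℕ} {φ ψ : EuclideanSpace ℝ (Fin N) → ℝ} {x : EuclideanSpace ℝ (Fin N)}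
    (hφ : ContDiffAt ℝ 2 φ x) (hψ : ContDiffAt ℝ 2 ψ x) :
    lapl (φ + ψ) x = lapl φ x + lapl ψ x := by
  unfold lapl
  rw [← Finset.sum_add_distrib]
  refine Finset.sum_congr rfl fun i _ => ?_
  rw [iteratedFDeriv_add_apply (by exact_mod_cast hφ) (by exact_mod_cast hψ)]
  rfl

theorem lapl_sub {N : ℕ} {φ ψ : EuclideanSpace ℝ (Fin N) → ℝ} {x : EuclideanSpace ℝ (Fin N)}
    (hφ : ContDiffAt ℝ 2 φ x) (hψ : ContDiffAt ℝ 2 ψ x) :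
    lapl (φ - ψ) x = lapl φ x - lapl ψ x := by
  unfold lapl
  rw [← Finset.sum_sub_distrib]
  refine Finset.sum_congr rfl fun i _ => ?_
  rw [iteratedFDeriv_sub_apply (by exact_mod_cast hφ) (by exact_mod_cast hψ)]
  rfl

theorem lapl_eq_of_hasFDerivAt {N : ℕ} {φ : EuclideanSpace ℝ (Fin N) → ℝ}
    {φ' : EuclideanSpace ℝ (Fin N) → EuclideanSpace ℝ (Fin N) →L[ℝ] ℝ}
    {x : EuclideanSpace ℝ (Fin N)}
    {φ'' : EuclideanSpace ℝ (Fin N) →L[ℝ] EuclideanSpace ℝ (Fin N) →L[ℝ] ℝ}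
    (h1 : ∀ y, HasFDerivAt φ (φ' y) y) (h2 : HasFDerivAt φ' φ'' x) :
    lapl φ x = ∑ i : Fin N, φ'' (EuclideanSpace.single i 1) (EuclideanSpace.single i 1) := by
  unfold lapl
  have : fderiv ℝ φ = φ' := funext fun y => (h1 y).fderiv
  simp only [iteratedFDeriv_two_apply, this, h2.fderiv, Matrix.cons_val_zero, Matrix.cons_val_one]

theorem lapl_exp_inner {N : ℕ} (i₀ : Fin N) (ε μ : ℝ) :
    ContDiff ℝ 2 (fun x : EuclideanSpace ℝ (Fin N) => ε * Real.exp (μ * x i₀)) ∧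
    ∀ x : EuclideanSpace ℝ (Fin N), lapl (fun x : EuclideanSpace ℝ (Fin N) =>
      ε * Real.exp (μ * x i₀)) x = μ ^ 2 * (ε * Real.exp (μ * x i₀)) := by
  refine ⟨by fun_prop, fun x => ?_⟩
  set ℓ : EuclideanSpace ℝ (Fin N) →L[ℝ] ℝ := EuclideanSpace.proj i₀
  have h0 : ∀ y : EuclideanSpace ℝ (Fin N), HasFDerivAt
      (fun x : EuclideanSpace ℝ (Fin N) => ε * Real.exp (μ * x i₀))
      ((ε * Real.exp (μ * y i₀)) • (μ • ℓ)) y := fun y => by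
    have := ((ℓ.hasFDerivAt (x := y)).const_mul μ).exp.const_mul ε
    rw [smul_smul] at this
    exact this
  rw [lapl_eq_of_hasFDerivAt h0 ((h0 x).smul_const (μ • ℓ)),
    Finset.sum_eq_single i₀]
  · simp [ℓ]; ring
  · intro j _ hj
    simp [ℓ, hj.symm]
  · simp

section Radial

variable {E : Type*} [NormedAddCommGroup E] [InnerProductSpace ℝ E]

/-- The real inner product as a bilinear form. -/
noncomputable def innerCLM : E →L[ℝ] E →L[ℝ] ℝ := innerSL ℝ

@[simp] theorem innerCLM_apply (x y : E) : innerCLM x y = inner ℝ x y := rfl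

theorem norm_innerCLM (x : E) : ‖innerCLM x‖ = ‖x‖ := innerSL_apply_norm ℝ x

theorem integral_mul_radAvg_eq (d : ℕ) {h : ℝ → ℝ} (hh : Continuous h) {r : ℝ} (hr : 0 ≤ r) :
    ∫ s in (0 : ℝ)..r, s * radAvg d h s =
      (1 / 2) * ∫ y in (0 : ℝ)..r ^ 2, radAvg d h (Real.sqrt y) := by
  have hc : Continuous fun y => radAvg d h (Real.sqrt y) :=
    (continuous_radAvg d hh).comp Real.continuous_sqrt
  have := intervalIntegral.integral_comp_mul_deriv (a := 0) (b := r) (f := fun s => s ^ 2)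
    (f' := fun s => 2 * s) (g := fun y => radAvg d h (Real.sqrt y))
    (fun x _ => by simpa using hasDerivAt_pow 2 x) (by fun_prop) hc
  rw [show (0 : ℝ) ^ 2 = 0 by norm_num] at this
  rw [← this, ← intervalIntegral.integral_const_mul]
  apply intervalIntegral.integral_congr
  intro s hs
  rw [uIcc_of_le hr] at hs
  simp only [Function.comp, Real.sqrt_sq hs.1]
  ring

theorem hasFDerivAt_radial (d : ℕ) {h : ℝ → ℝ} (hh : Continuous h) (β : ℝ) (x : E) :
    HasFDerivAt (fun x : E => β + ∫ s in (0 : ℝ)..‖x‖, s * radAvg d h s)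
      (radAvg d h ‖x‖ • innerCLM x) x := by
  have hc : Continuous fun y => radAvg d h (Real.sqrt y) :=
    (continuous_radAvg d hh).comp Real.continuous_sqrt
  have h1 := (hc.integral_hasStrictDerivAt 0 (‖x‖ ^ 2)).hasDerivAt.const_mul (1 / 2)
  have h2 := (h1.comp_hasFDerivAt x (hasStrictFDerivAt_norm_sq x).hasFDerivAt).const_add β
  simp only [integral_mul_radAvg_eq d hh (norm_nonneg _)]
  refine h2.congr_fderiv ?_
  rw [Real.sqrt_sq (norm_nonneg _)]
  ext y
  simp
  ring

/-- The Hessian of a radial function, as a bilinear form. -/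
noncomputable def radHess (d : ℕ) (h : ℝ → ℝ) (x : E) : E →L[ℝ] E →L[ℝ] ℝ :=
  radAvg d h ‖x‖ • innerCLM +
    ((h ‖x‖ - (d + 1) * radAvg d h ‖x‖) / ‖x‖ ^ 2) • (innerCLM x).smulRight (innerCLM x)

theorem hasDerivAt_radAvg (d : ℕ) {h : ℝ → ℝ} (hh : Continuous h) {r : ℝ} (hr : 0 < r) :
    HasDerivAt (radAvg d h) ((h r - (d + 1) * radAvg d h r) / r) r := by
  have h1 := (hasDerivAt_pow_mul_radAvg d hh r).div (hasDerivAt_pow (d + 1) r)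
    (pow_pos hr _).ne'
  refine (h1.congr_of_eventuallyEq ?_).congr_deriv ?_
  · filter_upwards [lt_mem_nhds hr] with s hs
    exact (mul_div_cancel_left₀ _ (pow_pos hs _).ne').symm
  · simp only [Nat.add_sub_cancel]
    push_cast
    field_simp
    ring

theorem hasFDerivAt_radial_grad (d : ℕ) {h : ℝ → ℝ} (hh : Continuous h) (x : E) :
    HasFDerivAt (fun x : E => radAvg d h ‖x‖ • innerCLM x) (radHess d h x) x := by
  by_cases hx : x = 0
  · subst hx
    have hc : ContinuousAt (fun x : E => radAvg d h ‖x‖) 0 :=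
      ((continuous_radAvg d hh).comp continuous_norm).continuousAt
    simp only [radHess, hasFDerivAt_iff_isLittleO_nhds_zero]
    simp only [zero_add, norm_zero, map_zero, smul_zero, sub_zero]
    have h1 : (fun y : E => radAvg d h ‖y‖ - radAvg d h 0) =o[nhds 0] fun _ => (1 : ℝ) := by
      rw [Asymptotics.isLittleO_one_iff]
      have h0 := hc.tendsto.sub_const (radAvg d h 0)
      rwa [norm_zero, sub_self] at h0
    have h2 : (fun y : E => innerCLM y) =O[nhds 0] fun y : E => y :=
      innerCLM.isBigO_id _
    have h3 := (h1.smul_isBigO h2).norm_right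
    have h4 : (fun y : E => ‖(1 : ℝ) • y‖) = fun y : E => ‖y‖ := by simp
    rw [h4] at h3
    refine (h3.of_norm_right).congr_left fun y => ?_
    ext z
    simp [sub_mul]
  · have hn : 0 < ‖x‖ := norm_pos_iff.2 hx
    have h1 : HasFDerivAt (fun x : E => ‖x‖) (‖x‖⁻¹ • innerCLM x) x := by
      have := ((hasStrictFDerivAt_norm_sq x).hasFDerivAt).sqrt (pow_pos hn 2).ne'
      simp only [Real.sqrt_sq (norm_nonneg _)] at this
      refine this.congr_fderiv ?_
      ext y
      simp
      field_simp
    have h2 := (hasDerivAt_radAvg d hh hn).comp_hasFDerivAt x h1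
    have h3 := h2.smul (innerCLM.hasFDerivAt (x := x))
    refine h3.congr_fderiv ?_
    ext y z
    simp [radHess]
    field_simp

set_option maxSynthPendingDepth 3 in
theorem continuous_radHess (d : ℕ) {h : ℝ → ℝ} (hh : Continuous h) :
    Continuous (radHess d h : E → E →L[ℝ] E →L[ℝ] ℝ) := by
  have hq : Continuous fun x : E => radAvg d h ‖x‖ := (continuous_radAvg d hh).comp continuous_norm
  have hq' : Continuous fun x : E => radAvg d h ‖x‖ • (innerCLM : E →L[ℝ] E →L[ℝ] ℝ) :=
    hq.smul continuous_const
  refine hq'.add ?_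
  have hsr : Continuous fun x : E => (innerCLM x).smulRight (innerCLM x) :=
    ((ContinuousLinearMap.smulRightL ℝ E (E →L[ℝ] ℝ)).continuous₂).comp
      ((innerCLM (E := E)).continuous.prodMk (innerCLM (E := E)).continuous)
  have hh' : Continuous fun x : E => h ‖x‖ - (d + 1) * radAvg d h ‖x‖ := by fun_prop
  rw [continuous_iff_continuousAt]
  intro x
  by_cases hx : x = 0
  · subst hx
    have h0 : h 0 - (d + 1) * radAvg d h 0 = 0 := by
      have : radAvg d h 0 = h 0 / (d + 1) := by
        rw [← radAvg_const d (h 0) 0]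
        simp [radAvg]
      rw [this]; field_simp; ring
    unfold ContinuousAt
    simp only [norm_zero, h0, zero_div, zero_smul]
    rw [tendsto_zero_iff_norm_tendsto_zero]
    have ht : Tendsto (fun x : E => |h ‖x‖ - (d + 1) * radAvg d h ‖x‖|) (nhds 0) (nhds 0) := by
      have := hh'.abs.tendsto (0 : E)
      simpa [h0] using this
    refine squeeze_zero (fun _ => norm_nonneg _) (fun y => ?_) ht
    rw [norm_smul, norm_div, ContinuousLinearMap.norm_smulRight_apply, norm_innerCLM]
    by_cases hy : y = 0
    · subst hy; simp
    · have : 0 < ‖y‖ := norm_pos_iff.2 hy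
      simp only [norm_pow, Real.norm_eq_abs, sq_abs]
      apply le_of_eq
      field_simp
  · exact (hh'.continuousAt.div (by fun_prop) (pow_pos (norm_pos_iff.2 hx) 2).ne').smul
      hsr.continuousAt

theorem contDiff_radial (d : ℕ) {h : ℝ → ℝ} (hh : Continuous h) (β : ℝ) :
    ContDiff ℝ 2 (fun x : E => β + ∫ s in (0 : ℝ)..‖x‖, s * radAvg d h s) := by
  have hf : fderiv ℝ (fun x : E => β + ∫ s in (0 : ℝ)..‖x‖, s * radAvg d h s) =
      fun x : E => radAvg d h ‖x‖ • innerCLM x :=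
    funext fun x => (hasFDerivAt_radial d hh β x).fderiv
  have hf2 : fderiv ℝ (fun x : E => radAvg d h ‖x‖ • innerCLM x) = radHess d h :=
    funext fun x => (hasFDerivAt_radial_grad d hh x).fderiv
  rw [show (2 : WithTop ℕ∞) = 1 + 1 by norm_num, contDiff_succ_iff_fderiv]
  refine ⟨fun x => (hasFDerivAt_radial d hh β x).differentiableAt, by simp, ?_⟩
  rw [hf, contDiff_one_iff_fderiv, hf2]
  exact ⟨fun x => (hasFDerivAt_radial_grad d hh x).differentiableAt, continuous_radHess d hh⟩

end Radial

theorem lapl_radial (d : ℕ) {h : ℝ → ℝ} (hh : Continuous h) (β : ℝ)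
    (x : EuclideanSpace ℝ (Fin (d + 1))) :
    lapl (fun x : EuclideanSpace ℝ (Fin (d + 1)) =>
      β + ∫ s in (0 : ℝ)..‖x‖, s * radAvg d h s) x = h ‖x‖ := by
  rw [lapl_eq_of_hasFDerivAt (hasFDerivAt_radial d hh β) (hasFDerivAt_radial_grad d hh x)]
  have hsum : ∑ i, x i * x i = ‖x‖ ^ 2 := by
    rw [EuclideanSpace.real_norm_sq_eq]
    exact Finset.sum_congr rfl fun i _ => (sq _).symm
  simp only [radHess, add_apply, smul_apply,
    ContinuousLinearMap.smulRight_apply, innerCLM_apply, smul_eq_mul,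
    EuclideanSpace.inner_single_right]
  simp only [Finset.sum_add_distrib, ← Finset.mul_sum]
  simp [hsum]
  by_cases hx : x = 0
  · subst hx
    have : radAvg d h 0 = h 0 / (d + 1) := by
      rw [← radAvg_const d (h 0) 0]
      simp [radAvg]
    simp [this]; field_simp
  · have : 0 < ‖x‖ := norm_pos_iff.2 hx
    field_simp
    ring

open scoped BoundedContinuousFunction

theorem abs_integral_mul_le_exp {φ : ℝ → ℝ} (hφ : Continuous φ) {C l : ℝ} (hl : 0 < l)
    (hle : ∀ s, |φ s| ≤ C * Real.exp (l * s ^ 2)) (r : ℝ) :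
    |∫ s in (0 : ℝ)..r, s * φ s| ≤ C / (2 * l) * Real.exp (l * r ^ 2) := by
  have hC : 0 ≤ C := by simpa using (abs_nonneg _).trans (hle 0)
  have key : ∀ {φ : ℝ → ℝ}, Continuous φ → (∀ s, |φ s| ≤ C * Real.exp (l * s ^ 2)) →
      ∀ r, 0 ≤ r → |∫ s in (0 : ℝ)..r, s * φ s| ≤ C / (2 * l) * Real.exp (l * r ^ 2) := by
    intro φ hφ hle r hr
    have h1 := intervalIntegral.norm_integral_le_of_norm_le (f := fun s => s * φ s)
      (g := fun s => s * (C * Real.exp (l * s ^ 2))) (μ := volume) hr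
      (Eventually.of_forall fun t ht => by
        rw [norm_mul, Real.norm_eq_abs, Real.norm_eq_abs, abs_of_pos ht.1]
        exact mul_le_mul_of_nonneg_left (hle t) ht.1.le)
      (Continuous.intervalIntegrable (by fun_prop) _ _)
    have hd : ∀ t ∈ uIcc 0 r, HasDerivAt (fun s => C / (2 * l) * Real.exp (l * s ^ 2))
        (t * (C * Real.exp (l * t ^ 2))) t := by
      intro t _
      have := ((((hasDerivAt_id t).pow 2).const_mul l).exp).const_mul (C / (2 * l))
      refine this.congr_deriv ?_
      simp
      field_simp
    rw [intervalIntegral.integral_eq_sub_of_hasDerivAt hd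
      (Continuous.intervalIntegrable (by fun_prop) _ _)] at h1
    rw [Real.norm_eq_abs] at h1
    have : 0 ≤ C / (2 * l) * Real.exp (l * 0 ^ 2) := by positivity
    linarith
  rcases le_total 0 r with hr | hr
  · exact key hφ hle r hr
  · have h2 := key (φ := fun s => φ (-s)) (by fun_prop) (fun s => by simpa using hle (-s)) (-r)
      (by linarith)
    have h3 := intervalIntegral.integral_comp_neg (a := 0) (b := -r) fun s => (-s) * φ s
    simp only [neg_neg, neg_zero] at h3
    rw [h3, intervalIntegral.integral_symm, abs_neg] at h2
    simp only [neg_mul, intervalIntegral.integral_neg, abs_neg] at h2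
    simpa using h2

/-- Radial solutions exist globally and depend continuously on the value at the origin. -/
theorem exists_isRadialSol (d : ℕ) {g : ℝ → ℝ} {K : NNReal} (hg : LipschitzWith K g) {M : ℝ}
    (hM : ∀ t, |g t| ≤ M) :
    ∃ U : ℝ → ℝ → ℝ, Continuous (Function.uncurry U) ∧
      ∀ β, IsRadialSol d g (U β) ∧ U β 0 = β := by
  set l : ℝ := K + 1 with hl_def
  have hl : 0 < l := by positivity
  have hM0 : 0 ≤ M := (abs_nonneg _).trans (hM 0)
  let e : ℝ → ℝ := fun r => Real.exp (l * r ^ 2)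
  have he : Continuous e := by fun_prop
  have he0 : ∀ r, 0 < e r := fun r => Real.exp_pos _
  have he1 : ∀ r, 1 ≤ e r := fun r => Real.one_le_exp (by positivity)
  have hQ : ∀ w : ℝ →ᵇ ℝ, Continuous (radAvg d (g ∘ fun r => e r * w r)) := fun w =>
    continuous_radAvg d (hg.continuous.comp (he.mul w.continuous))
  have hI : ∀ w : ℝ →ᵇ ℝ,
      Continuous fun r => ∫ s in (0 : ℝ)..r, s * radAvg d (g ∘ fun r => e r * w r) s := fun w =>
    intervalIntegral.continuous_primitive
      (fun _ _ => (continuous_id.mul (hQ w)).intervalIntegrable _ _) 0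
  have hIb : ∀ (w : ℝ →ᵇ ℝ) r,
      |∫ s in (0 : ℝ)..r, s * radAvg d (g ∘ fun r => e r * w r) s| ≤ M / (2 * l) * e r := fun w r =>
    abs_integral_mul_le_exp (hQ w) hl (fun s => (abs_radAvg_le d
      (hg.continuous.comp (he.mul w.continuous)) fun _ _ => hM _).trans
        (le_mul_of_one_le_right hM0 (he1 s))) r
  let T : ℝ → (ℝ →ᵇ ℝ) → (ℝ →ᵇ ℝ) := fun β w =>
    BoundedContinuousFunction.ofNormedAddCommGroup
      (fun r => (e r)⁻¹ * (β + ∫ s in (0 : ℝ)..r, s * radAvg d (g ∘ fun r => e r * w r) s))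
      ((he.inv₀ fun r => (he0 r).ne').mul (continuous_const.add (hI w)))
      (|β| + M / (2 * l))
      (fun r => by
        rw [norm_mul, norm_inv, Real.norm_eq_abs, Real.norm_eq_abs, abs_of_pos (he0 r),
          inv_mul_le_iff₀ (he0 r)]
        have h1 := hIb w r
        have h2 : |β| ≤ e r * |β| := le_mul_of_one_le_left (abs_nonneg _) (he1 r)
        have := abs_add_le β (∫ s in (0 : ℝ)..r, s * radAvg d (g ∘ fun r => e r * w r) s)
        linarith)
  have hT : ∀ β, ContractingWith (1 / 2) (T β) := by
    intro β
    refine ⟨by rw [← NNReal.coe_lt_coe]; norm_num, LipschitzWith.of_dist_le_mul fun w w' => ?_⟩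
    rw [BoundedContinuousFunction.dist_le (by positivity)]
    intro r
    have hd : ∀ s, |radAvg d (g ∘ fun r => e r * w r) s - radAvg d (g ∘ fun r => e r * w' r) s|
        ≤ K * dist w w' * Real.exp (l * s ^ 2) := by
      intro s
      apply abs_radAvg_sub_le d (hg.continuous.comp (he.mul w.continuous))
        (hg.continuous.comp (he.mul w'.continuous))
      intro τ hτ
      have h1 := hg.dist_le_mul (e (s * τ) * w (s * τ)) (e (s * τ) * w' (s * τ))
      rw [Real.dist_eq, Real.dist_eq, ← mul_sub, abs_mul, abs_of_pos (he0 _)] at h1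
      have h2 := BoundedContinuousFunction.dist_coe_le_dist (f := w) (g := w') (s * τ)
      rw [Real.dist_eq] at h2
      have h3 : e (s * τ) ≤ e s := by
        apply Real.exp_le_exp.2
        have : τ ^ 2 ≤ 1 := pow_le_one₀ hτ.1 hτ.2
        have : l * s ^ 2 * τ ^ 2 ≤ l * s ^ 2 * 1 := mul_le_mul_of_nonneg_left this (by positivity)
        linarith
      calc _ ≤ _ := h1
        _ ≤ K * (e s * dist w w') := by gcongr
        _ = K * dist w w' * Real.exp (l * s ^ 2) := by simp only [e]; ring
    have h4 := abs_integral_mul_le_exp ((hQ w).sub (hQ w')) hl hd r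
    simp only [Pi.sub_apply, mul_sub] at h4
    have hi : ∀ w : ℝ →ᵇ ℝ, IntervalIntegrable
        (fun s => s * radAvg d (g ∘ fun r => e r * w r) s) volume 0 r := fun w =>
      (continuous_id.mul (hQ w)).intervalIntegrable _ _
    rw [intervalIntegral.integral_sub (hi w) (hi w')] at h4
    change dist ((e r)⁻¹ * _) ((e r)⁻¹ * _) ≤ _
    rw [Real.dist_eq, ← mul_sub, abs_mul, abs_inv, abs_of_pos (he0 r), inv_mul_le_iff₀ (he0 r),
      add_sub_add_left_eq_sub]
    refine h4.trans ?_
    have h5 : K * dist w w' / (2 * l) ≤ (1 / 2) * dist w w' := by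
      rw [div_le_iff₀ (by positivity), hl_def]
      have := dist_nonneg (x := w) (y := w')
      nlinarith
    rw [mul_comm]
    push_cast
    exact mul_le_mul_of_nonneg_left h5 (he0 r).le
  let W : ℝ → (ℝ →ᵇ ℝ) := fun β => ContractingWith.fixedPoint (T β) (hT β)
  have hW : ∀ β, T β (W β) = W β := fun β => ContractingWith.fixedPoint_isFixedPt (hT β)
  have hWc : Continuous W := by
    refine (LipschitzWith.of_dist_le_mul (K := 2) fun β γ => ?_).continuous
    refine ((hT β).fixedPoint_lipschitz_in_map (hT γ) (C := dist β γ) fun w => ?_).trans ?_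
    · rw [BoundedContinuousFunction.dist_le dist_nonneg]
      intro r
      change dist ((e r)⁻¹ * _) ((e r)⁻¹ * _) ≤ _
      rw [Real.dist_eq, ← mul_sub, abs_mul, abs_inv, abs_of_pos (he0 r), inv_mul_le_iff₀ (he0 r),
        add_sub_add_right_eq_sub, Real.dist_eq]
      exact le_mul_of_one_le_left (abs_nonneg _) (he1 r)
    · push_cast
      apply le_of_eq
      ring
  have hUeq : ∀ β r, e r * W β r =
      β + ∫ s in (0 : ℝ)..r, s * radAvg d (g ∘ fun r => e r * W β r) s := by
    intro β r
    conv_lhs => rw [← hW β]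
    change e r * ((e r)⁻¹ * _) = _
    rw [mul_inv_cancel_left₀ (he0 r).ne']
  refine ⟨fun β r => e r * W β r, ?_, fun β => ⟨⟨he.mul (W β).continuous, fun r => ?_⟩, ?_⟩⟩
  · exact (he.comp continuous_snd).mul
      (continuous_eval.comp
        ((hWc.comp continuous_fst).prodMk continuous_snd))
  · have h0 := hUeq β 0
    simp only [intervalIntegral.integral_same, add_zero] at h0
    change e r * W β r = e 0 * W β 0 + _
    rw [h0]
    exact hUeq β r
  · have h0 := hUeq β 0
    simpa only [intervalIntegral.integral_same, add_zero] using h0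

/-- One-sided uniform approximation of `f` on a compact interval by a globally Lipschitz function
which keeps the sign of `f` beyond `a`. -/
theorem exists_lipschitz_approx {f : ℝ → ℝ} (hf : Continuous f) {a m k η : ℝ} (ha : 0 < f a)
    (hpos : ∀ t, a < t → 0 ≤ f t) (hma : m ≤ a) (hak : a ≤ k) (hη : 0 < η) :
    ∃ (g : ℝ → ℝ) (K : NNReal) (M : ℝ), LipschitzWith K g ∧ (∀ t, |g t| ≤ M) ∧
      (∀ t, a ≤ t → 0 ≤ g t) ∧ (∀ t ∈ Icc m k, f t - η ≤ g t ∧ g t ≤ f t) ∧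
      ∀ t ≤ m, g t = g m := by
  have hmk := hma.trans hak
  obtain ⟨p, hp⟩ := exists_polynomial_near_of_continuousOn m k f hf.continuousOn (η / 2) (by linarith)
  obtain ⟨δ, hδ, hδf⟩ : ∃ δ > 0, ∀ t ∈ Ioc (a - δ) a, 0 < f t := by
    obtain ⟨δ, hδ, h⟩ := Metric.eventually_nhds_iff.1 (hf.continuousAt.eventually (lt_mem_nhds ha))
    refine ⟨δ, hδ, fun t ht => h ?_⟩
    rw [Real.dist_eq, abs_lt]
    constructor <;> linarith [ht.1, ht.2]
  obtain ⟨b, hb⟩ : ∃ b, ∀ t ∈ Icc m k, b ≤ f t := by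
    obtain ⟨b, hb⟩ := (isCompact_Icc.image hf).bddBelow
    exact ⟨b, fun t ht => hb (mem_image_of_mem f ht)⟩
  set C : ℝ := |b| / δ
  have hC : 0 ≤ C := by positivity
  let ℓ : ℝ → ℝ := fun t => min 0 (C * (t - a))
  have hℓ : ∀ t ∈ Icc m k, ℓ t ≤ f t := by
    intro t ht
    rcases lt_or_ge a t with h | h
    · exact (min_le_left _ _).trans (hpos t h)
    · rcases lt_or_ge (a - δ) t with h' | h'
      · exact (min_le_left _ _).trans (hδf t ⟨h', h⟩).le
      · refine (min_le_right _ _).trans (le_trans ?_ (hb t ht))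
        have h1 : C * (t - a) ≤ C * (-δ) := mul_le_mul_of_nonneg_left (by linarith) hC
        have h2 : C * (-δ) = -|b| := by simp only [C]; field_simp
        linarith [neg_abs_le b]
  let G : ℝ → ℝ := fun t => max (p.eval t - η / 2) (ℓ t)
  obtain ⟨K, hK⟩ : ∃ K, LipschitzOnWith K G (Icc m k) := by
    have hG : LocallyLipschitz G := by
      refine LocallyLipschitz.max ?_ (LocallyLipschitz.const_min ?_ 0)
      · have hp : ContDiff ℝ 1 fun t => p.eval t := by
          simpa [Polynomial.coe_aeval_eq_eval] using p.contDiff_aeval (𝕜 := ℝ) 1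
        exact (hp.sub contDiff_const).locallyLipschitz
      · exact ContDiff.locallyLipschitz (𝕂 := ℝ) (by fun_prop)
    exact hG.locallyLipschitzOn.exists_lipschitzOnWith_of_compact isCompact_Icc
  let c : ℝ → ℝ := fun t => max m (min k t)
  have hc : LipschitzWith 1 c := (LipschitzWith.id.const_min k).const_max m
  have hcm : ∀ t, c t ∈ Icc m k := fun t => ⟨le_max_left _ _, max_le hmk (min_le_left _ _)⟩
  have hc_eq : ∀ t ∈ Icc m k, c t = t := fun t ht => by simp [c, ht.1, ht.2]
  have hL : LipschitzWith K (G ∘ c) := by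
    have := hK.comp hc.lipschitzOnWith (s := univ) (fun t _ => hcm t)
    rwa [mul_one, lipschitzOnWith_univ] at this
  obtain ⟨M, hM⟩ : ∃ M, ∀ t ∈ Icc m k, |G t| ≤ M :=
    isCompact_Icc.exists_bound_of_continuousOn hK.continuousOn
  refine ⟨G ∘ c, K, M, hL, fun t => hM _ (hcm t), fun t ht => ?_, fun t ht => ?_, fun t ht => ?_⟩
  · refine le_max_of_le_right (le_min le_rfl (mul_nonneg hC ?_))
    have : a ≤ c t := le_max_of_le_right (le_min hak ht)
    linarith
  · have := abs_lt.1 (hp t ht)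
    simp only [Function.comp, hc_eq t ht]
    exact ⟨le_max_of_le_left (by linarith), max_le (by linarith) (hℓ t ht)⟩
  · have : c t = c m := by simp [c, ht, hmk, ht.trans hmk]
    simp [this]

section KellerOsserman

variable {f F : ℝ → ℝ} {a : ℝ}

theorem hasDerivAt_of_primitive (hf : Continuous f) (hF : ∀ t, F t = ∫ s in a..t, f s) (t : ℝ) :
    HasDerivAt F (f t) t := by
  rw [funext hF]
  exact (hf.integral_hasStrictDerivAt a t).hasDerivAt

theorem monotoneOn_primitive (hf : Continuous f) (hpos : ∀ t, a < t → 0 ≤ f t)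
    (hF : ∀ t, F t = ∫ s in a..t, f s) : MonotoneOn F (Ici a) := by
  have hd := hasDerivAt_of_primitive hf hF
  apply monotoneOn_of_deriv_nonneg (convex_Ici a)
  · exact fun s _ => (hd s).continuousAt.continuousWithinAt
  · exact fun s _ => (hd s).differentiableAt.differentiableWithinAt
  · intro s hs
    rw [interior_Ici] at hs
    rw [(hd s).deriv]
    exact hpos s hs

theorem primitive_pos (hf : Continuous f) (ha : 0 < f a) (hpos : ∀ t, a < t → 0 ≤ f t)
    (hF : ∀ t, F t = ∫ s in a..t, f s) {t : ℝ} (ht : a < t) : 0 < F t := by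
  rw [hF]
  refine intervalIntegral.integral_pos ht hf.continuousOn (fun s hs => hpos s hs.1)
    ⟨a, ⟨le_rfl, ht.le⟩, ha⟩

theorem exists_levels_of_kellerOsserman (hf : Continuous f) (ha : 0 < f a)
    (hpos : ∀ t, a < t → 0 ≤ f t) (hF : ∀ t, F t = ∫ s in a..t, f s)
    (hKO : ∃ M, a < M ∧ IntegrableOn (fun t => 1 / Real.sqrt (F t)) (Ici M))
    (A : ℝ) {η : ℝ} (hη : 0 < η) :
    ∃ p q, A ≤ p ∧ a < p ∧ p < q ∧ 2 ≤ F p ∧ F q = 4 * F p ∧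
      ∀ t, p ≤ t → ∫ s in p..t, 1 / Real.sqrt (F s) ≤ η := by
  obtain ⟨M, haM, hint⟩ := hKO
  have hFc : Continuous F := continuous_iff_continuousAt.2 fun t =>
    (hasDerivAt_of_primitive hf hF t).continuousAt
  have hFm := monotoneOn_primitive hf hpos hF
  have hFp : ∀ t, a < t → 0 < F t := fun t => primitive_pos hf ha hpos hF
  have hii : ∀ s t, M ≤ s → M ≤ t →
      IntervalIntegrable (fun t => 1 / Real.sqrt (F t)) volume s t := fun s t hs ht =>
    (hint.mono_set (fun x hx => (le_min hs ht).trans hx.1)).intervalIntegrable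
  have hlim := intervalIntegral_tendsto_integral_Ioi M (hint.mono_set Ioi_subset_Ici_self)
    tendsto_id
  simp only [id] at hlim
  set I := ∫ t in Ioi M, 1 / Real.sqrt (F t)
  have hle : ∀ t, M ≤ t → ∫ s in M..t, 1 / Real.sqrt (F s) ≤ I := by
    intro t ht
    rw [intervalIntegral.integral_of_le ht]
    exact setIntegral_mono_set (hint.mono_set Ioi_subset_Ici_self)
      (Eventually.of_forall fun _ => by positivity) (Ioc_subset_Ioi_self.eventuallyLE)
  have hgrow : ∀ t, M ≤ t → (t - M) ≤ I * Real.sqrt (F t) := by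
    intro t ht
    have hs := Real.sqrt_pos.2 (hFp t (haM.trans_le ht))
    have h1 : ∫ _ in M..t, 1 / Real.sqrt (F t) ≤ ∫ s in M..t, 1 / Real.sqrt (F s) := by
      refine intervalIntegral.integral_mono_on ht (by simp) (hii M t le_rfl ht) fun s hs => ?_
      have has := haM.trans_le hs.1
      exact one_div_le_one_div_of_le (Real.sqrt_pos.2 (hFp s has))
        (Real.sqrt_le_sqrt (hFm has.le (haM.trans_le ht).le hs.2))
    rw [intervalIntegral.integral_const, smul_eq_mul, mul_one_div] at h1
    exact (div_le_iff₀ hs).1 (h1.trans (hle t ht))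
  have hFtop : ∀ C, ∃ t, M ≤ t ∧ C ≤ F t := by
    intro C
    have hI : 0 ≤ I := by simpa using hle M le_rfl
    refine ⟨M + (I + 1) * (|C| + 1), by nlinarith [abs_nonneg C], ?_⟩
    have h1 := hgrow (M + (I + 1) * (|C| + 1)) (by nlinarith [abs_nonneg C])
    set s := Real.sqrt (F (M + (I + 1) * (|C| + 1)))
    have hs0 : 0 ≤ s := Real.sqrt_nonneg _
    have h2 : |C| + 1 ≤ s := by
      by_contra h
      push Not at h
      have : I * s ≤ I * (|C| + 1) := mul_le_mul_of_nonneg_left h.le hI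
      nlinarith [abs_nonneg C]
    have h3 : s ^ 2 = F (M + (I + 1) * (|C| + 1)) :=
      Real.sq_sqrt (hFp _ (by nlinarith [abs_nonneg C])).le
    rw [← h3]
    nlinarith [le_abs_self C, abs_nonneg C]
  obtain ⟨T, hT⟩ := (hlim.eventually (lt_mem_nhds (show I - η < I by linarith))).exists_forall_of_atTop
  obtain ⟨t₀, hMt₀, ht₀⟩ := hFtop 2
  set p := max (max A T) t₀
  have hAp : A ≤ p := (le_max_left _ _).trans (le_max_left _ _)
  have hTp : T ≤ p := (le_max_right _ _).trans (le_max_left _ _)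
  have htp : t₀ ≤ p := le_max_right _ _
  have hMp : M ≤ p := hMt₀.trans htp
  have hFp2 : 2 ≤ F p := ht₀.trans (hFm (haM.le.trans hMt₀) (haM.le.trans hMp) htp)
  obtain ⟨t₁, hMt₁, ht₁⟩ := hFtop (4 * F p)
  have hpt₁ : p ≤ t₁ := by
    by_contra h
    have := hFm (haM.le.trans hMt₁) (haM.le.trans hMp) (not_le.1 h).le
    linarith
  obtain ⟨q, hq, hFq⟩ := intermediate_value_Icc hpt₁ hFc.continuousOn
    (show 4 * F p ∈ Icc (F p) (F t₁) from ⟨by linarith, ht₁⟩)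
  refine ⟨p, q, hAp, haM.trans_le hMp, lt_of_le_of_ne hq.1 ?_, hFp2, hFq, fun t ht => ?_⟩
  · intro h
    rw [← h] at hFq
    linarith
  · have h1 := hle t (hMp.trans ht)
    rw [← intervalIntegral.integral_add_adjacent_intervals (hii M p le_rfl hMp)
      (hii p t hMp (hMp.trans ht))] at h1
    have := hT p hTp
    linarith

end KellerOsserman

/-- A level `α` from which the secant slopes of `G` are bounded below. -/
theorem exists_level_linear_growth {g G : ℝ → ℝ} {p q : ℝ}
    (hG : ∀ t, HasDerivAt G (g t) t) (hpq : p < q) (hD : G p < G q) :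
    ∃ α ∈ Ico p q, 0 < g α ∧ (G q - G p) / 2 ≤ G q - G α ∧
      ∀ s ∈ Icc α q, (G q - G p) / (2 * (q - p)) * (s - α) ≤ G s - G α := by
  set σ := (G q - G p) / (2 * (q - p)) with hσ
  have hqp : 0 < q - p := sub_pos.2 hpq
  have hσ0 : 0 < σ := div_pos (by linarith) (by linarith)
  have hσD : σ * (q - p) = (G q - G p) / 2 := by rw [hσ]; field_simp
  have hGc : Continuous G := continuous_iff_continuousAt.2 fun t => (hG t).continuousAt
  obtain ⟨α, hα, hmin⟩ := isCompact_Icc.exists_isMinOn (nonempty_Icc.2 hpq.le)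
    (show ContinuousOn (fun s => G s - σ * s) (Icc p q) by fun_prop)
  have hmin' : ∀ s ∈ Icc p q, G α - σ * α ≤ G s - σ * s := fun s hs => hmin hs
  have hp := hmin' p ⟨le_rfl, hpq.le⟩
  have h1 : σ * (α - p) ≤ σ * (q - p) := mul_le_mul_of_nonneg_left (by linarith [hα.2]) hσ0.le
  have hαq : α < q := lt_of_le_of_ne hα.2 (by rintro rfl; nlinarith)
  have hlin : ∀ s ∈ Icc α q, σ * (s - α) ≤ G s - G α := fun s hs => by
    have := hmin' s ⟨hα.1.trans hs.1, hs.2⟩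
    linarith
  refine ⟨α, ⟨hα.1, hαq⟩, ?_, by linarith, hlin⟩
  refine hσ0.trans_le (ge_of_tendsto ((hasDerivWithinAt_iff_tendsto_slope' (by simp)).1
    ((hG α).hasDerivWithinAt (s := Ioi α))) ?_)
  filter_upwards [Ioc_mem_nhdsGT hαq] with s hs
  rw [slope_def_field, le_div_iff₀ (by linarith [hs.1])]
  exact hlin s ⟨hs.1.le, hs.2⟩

namespace IsRadialSol

variable {d : ℕ} {g u : ℝ → ℝ}

/-- Energy estimate for a radial solution starting at level `α` at radius `r₀`. -/
theorem energy_le (hu : IsRadialSol d g u) (hg : Continuous g) {a α r₀ : ℝ}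
    (hpos : ∀ t, a ≤ t → 0 ≤ g t) {G : ℝ → ℝ} (hG : ∀ t, HasDerivAt G (g t) t) (haα : a < α)
    (hr₀ : 0 < r₀) (hur₀ : u r₀ = α) {r : ℝ} (hr : r ∈ Icc r₀ 1) :
    r₀ ^ d * Real.sqrt (2 * (G (u r) - G α)) ≤ r * radAvg d (g ∘ u) r := by
  obtain ⟨hmono, hP⟩ := hu.monotone_after hg hpos hr₀.le (by rwa [hur₀])
  have hgu := hg.comp hu.cont
  set P : ℝ → ℝ := fun r => r ^ (d + 1) * radAvg d (g ∘ u) r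
  have hPd : ∀ s, HasDerivAt P (s ^ d * g (u s)) s := fun s => hasDerivAt_pow_mul_radAvg d hgu s
  let E : ℝ → ℝ := fun s => P s ^ 2 / 2 - r₀ ^ (2 * d) * G (u s)
  have hE : ∀ s, HasDerivAt E
      (P s * (s ^ d * g (u s)) - r₀ ^ (2 * d) * (g (u s) * (s * radAvg d (g ∘ u) s))) s := by
    intro s
    have h1 := ((hPd s).pow 2).div_const 2
    have h2 := ((hG (u s)).comp s (hu.hasDerivAt hg s)).const_mul (r₀ ^ (2 * d))
    refine (h1.sub h2).congr_deriv ?_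
    simp
    ring
  have hEm : MonotoneOn E (Icc r₀ 1) := by
    apply monotoneOn_of_deriv_nonneg (convex_Icc _ _)
    · exact fun s _ => (hE s).continuousAt.continuousWithinAt
    · exact fun s _ => (hE s).differentiableAt.differentiableWithinAt
    · intro s hs
      rw [interior_Icc] at hs
      rw [(hE s).deriv]
      have hs0 : 0 < s := hr₀.trans hs.1
      have hus : 0 ≤ g (u s) := hpos _ (haα.le.trans (hur₀ ▸ hmono self_mem_Ici hs.1.le hs.1.le))
      have hQ : 0 ≤ radAvg d (g ∘ u) s :=
        nonneg_of_mul_nonneg_right (hP s hs.1.le) (pow_pos hs0 _)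
      have hle : r₀ ^ (2 * d) ≤ s ^ (2 * d) := pow_le_pow_left₀ hr₀.le hs.1.le _
      have : P s * (s ^ d * g (u s)) - r₀ ^ (2 * d) * (g (u s) * (s * radAvg d (g ∘ u) s)) =
          (s ^ (2 * d) - r₀ ^ (2 * d)) * (g (u s) * (s * radAvg d (g ∘ u) s)) := by
        simp only [P]; ring
      rw [this]
      exact mul_nonneg (by linarith) (by positivity)
  have hr0 : 0 < r := hr₀.trans_le hr.1
  have h1 := hEm ⟨le_rfl, hr.1.trans hr.2⟩ hr hr.1
  change P r₀ ^ 2 / 2 - r₀ ^ (2 * d) * G (u r₀) ≤ P r ^ 2 / 2 - r₀ ^ (2 * d) * G (u r) at h1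
  rw [hur₀] at h1
  have hPr := hP r hr.1
  have hQ : 0 ≤ radAvg d (g ∘ u) r := nonneg_of_mul_nonneg_right hPr (pow_pos hr0 _)
  have h2 : r₀ ^ (2 * d) * (2 * (G (u r) - G α)) ≤ P r ^ 2 := by nlinarith [sq_nonneg (P r₀)]
  have h3 := Real.sqrt_le_sqrt h2
  rw [Real.sqrt_sq hPr, Real.sqrt_mul (by positivity), mul_comm 2 d, pow_mul,
    Real.sqrt_sq (by positivity)] at h3
  refine h3.trans ?_
  change r ^ (d + 1) * radAvg d (g ∘ u) r ≤ _
  rw [pow_succ, mul_assoc]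
  exact mul_le_of_le_one_left (by positivity) (pow_le_one₀ hr0.le hr.2)

theorem lt_after (hu : IsRadialSol d g u) (hg : Continuous g) {a α r₀ : ℝ}
    (hpos : ∀ t, a ≤ t → 0 ≤ g t) (haα : a < α) (hgα : 0 < g α)
    (hr₀ : 0 < r₀) (hur₀ : u r₀ = α) {r : ℝ} (hr : r₀ < r) : α < u r := by
  have hmono := (hu.monotone_after hg hpos hr₀.le (by rwa [hur₀])).1
  have hge : α ≤ u r := hur₀ ▸ hmono self_mem_Ici hr.le hr.le
  refine lt_of_le_of_ne hge fun heq => ?_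
  have hconst : ∀ s ∈ Ioo r₀ r, u s = α := fun s hs => le_antisymm
    (heq ▸ hmono hs.1.le hr.le hs.2.le) (hur₀ ▸ hmono self_mem_Ici hs.1.le hs.1.le)
  have hQ : ∀ s ∈ Ioo r₀ r, s ^ (d + 1) * radAvg d (g ∘ u) s = 0 := by
    intro s hs
    have h1 : HasDerivAt u 0 s := (hasDerivAt_const s α).congr_of_eventuallyEq
      (by filter_upwards [Ioo_mem_nhds hs.1 hs.2] with t ht using hconst t ht)
    have h2 := (hu.hasDerivAt hg s).unique h1
    rw [pow_succ, mul_assoc, h2, mul_zero]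
  have hmid : (r₀ + r) / 2 ∈ Ioo r₀ r := ⟨by linarith, by linarith⟩
  have h1 : HasDerivAt (fun s => s ^ (d + 1) * radAvg d (g ∘ u) s) 0 ((r₀ + r) / 2) :=
    (hasDerivAt_const _ 0).congr_of_eventuallyEq
      (by filter_upwards [Ioo_mem_nhds hmid.1 hmid.2] with t ht using hQ t ht)
  have h2 := (hasDerivAt_pow_mul_radAvg d (hg.comp hu.cont) _).unique h1
  rw [Function.comp, hconst _ hmid] at h2
  have : 0 < ((r₀ + r) / 2) ^ d := pow_pos (by linarith) d
  exact (mul_pos this hgα).ne' h2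

theorem time_le_of_linear_growth (hu : IsRadialSol d g u) (hg : Continuous g) {a α r₀ : ℝ}
    (hpos : ∀ t, a ≤ t → 0 ≤ g t) {G : ℝ → ℝ} (hG : ∀ t, HasDerivAt G (g t) t) (haα : a < α)
    (hgα : 0 < g α) (hr₀ : 0 < r₀) (hur₀ : u r₀ = α) {q σ r : ℝ} (hσ : 0 ≤ σ)
    (hlin : ∀ s ∈ Icc α q, σ * (s - α) ≤ G s - G α) (hr : r ∈ Icc r₀ 1) (hur : u r ≤ q) :
    r₀ ^ d * Real.sqrt (2 * σ) / 2 * (r - r₀) ≤ Real.sqrt (q - α) := by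
  have hmono := (hu.monotone_after hg hpos hr₀.le (by rwa [hur₀])).1
  have hlt : ∀ s, r₀ < s → α < u s := fun s hs => hu.lt_after hg hpos haα hgα hr₀ hur₀ hs
  have hd : ∀ s ∈ Ioo r₀ r, HasDerivAt (fun s => Real.sqrt (u s - α))
      (s * radAvg d (g ∘ u) s / (2 * Real.sqrt (u s - α))) s := fun s hs =>
    ((hu.hasDerivAt hg s).sub_const α).sqrt (by linarith [hlt s hs.1])
  have h1 := (convex_Icc r₀ r).mul_sub_le_image_sub_of_le_deriv
    (f := fun s => Real.sqrt (u s - α)) (C := r₀ ^ d * Real.sqrt (2 * σ) / 2)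
    (by have := hu.cont; fun_prop)
    (by rw [interior_Icc]; exact fun s hs => (hd s hs).differentiableAt.differentiableWithinAt)
    (by
      rw [interior_Icc]
      intro s hs
      rw [(hd s hs).deriv]
      have hpos' : 0 < u s - α := by linarith [hlt s hs.1]
      have hsq := Real.sqrt_pos.2 hpos'
      have hsq' : u s ≤ q := (hmono hs.1.le hr.1 hs.2.le).trans hur
      have he := hu.energy_le hg hpos hG haα hr₀ hur₀ (r := s) ⟨hs.1.le, hs.2.le.trans hr.2⟩
      have h2 : Real.sqrt (2 * σ) * Real.sqrt (u s - α) ≤ Real.sqrt (2 * (G (u s) - G α)) := by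
        rw [← Real.sqrt_mul (by positivity)]
        apply Real.sqrt_le_sqrt
        have := hlin (u s) ⟨(hlt s hs.1).le, hsq'⟩
        linarith
      have h3 := mul_le_mul_of_nonneg_left h2 (pow_nonneg hr₀.le d)
      rw [div_le_div_iff₀ two_pos (by positivity)]
      nlinarith)
    r₀ ⟨le_rfl, hr.1⟩ r ⟨hr.1, le_rfl⟩ hr.1
  simp only [hur₀, sub_self, Real.sqrt_zero, sub_zero] at h1
  exact h1.trans (Real.sqrt_le_sqrt (by linarith))

theorem time_le_integral (hu : IsRadialSol d g u) (hg : Continuous g) {a α r₀ : ℝ}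
    (hpos : ∀ t, a ≤ t → 0 ≤ g t) {G F : ℝ → ℝ} (hG : ∀ t, HasDerivAt G (g t) t) (haα : a < α)
    (hr₀ : 0 < r₀) (hur₀ : u r₀ = α) {q k r : ℝ} (hF : Continuous F)
    (hFpos : ∀ s, q ≤ s → 0 < F s) (hGF : ∀ s ∈ Icc q k, F s / 4 ≤ G s - G α)
    (hr : r ∈ Icc r₀ 1) (hur : q ≤ u r) (huk : u 1 ≤ k) :
    r₀ ^ d / 2 * (1 - r) ≤ ∫ s in q..k, 1 / Real.sqrt (F s) := by
  have hmono := (hu.monotone_after hg hpos hr₀.le (by rwa [hur₀])).1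
  have hur1 : u r ≤ u 1 := hmono hr.1 (hr.1.trans hr.2) hr.2
  let w : ℝ → ℝ := fun s => 1 / Real.sqrt (F (max q s))
  have hw0 : ∀ s, 0 < Real.sqrt (F (max q s)) := fun s =>
    Real.sqrt_pos.2 (hFpos _ (le_max_left _ _))
  have hw : Continuous w := continuous_const.div (by fun_prop) fun s => (hw0 s).ne'
  have hd : ∀ s, HasDerivAt (fun s => ∫ t in q..u s, w t) (w (u s) * (s * radAvg d (g ∘ u) s)) s :=
    fun s => ((hw.integral_hasStrictDerivAt q (u s)).hasDerivAt).comp s (hu.hasDerivAt hg s)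
  have h1 := (convex_Icc r 1).mul_sub_le_image_sub_of_le_deriv
    (f := fun s => ∫ t in q..u s, w t) (C := r₀ ^ d / 2)
    (fun s _ => (hd s).continuousAt.continuousWithinAt)
    (fun s _ => (hd s).differentiableAt.differentiableWithinAt)
    (by
      rw [interior_Icc]
      intro s hs
      rw [(hd s).deriv]
      have hr₀s : r₀ ≤ s := hr.1.trans hs.1.le
      have hqs : q ≤ u s := hur.trans (hmono hr.1 hr₀s hs.1.le)
      have hsk : u s ≤ k := (hmono hr₀s (hr.1.trans hr.2) hs.2.le).trans huk
      have he := hu.energy_le hg hpos hG haα hr₀ hur₀ (r := s) ⟨hr₀s, hs.2.le⟩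
      have hsF := hw0 (u s)
      simp only [w, max_eq_right hqs] at hsF ⊢
      have h2 : Real.sqrt (F (u s)) / 2 ≤ Real.sqrt (2 * (G (u s) - G α)) := by
        apply Real.le_sqrt_of_sq_le
        rw [div_pow, Real.sq_sqrt (hFpos _ hqs).le]
        have := hGF (u s) ⟨hqs, hsk⟩
        have := hFpos _ hqs
        linarith
      have h3 := mul_le_mul_of_nonneg_left h2 (pow_nonneg hr₀.le d)
      rw [one_div, ← div_eq_inv_mul, le_div_iff₀ hsF]
      linarith)
    r ⟨le_rfl, hr.2⟩ 1 ⟨hr.2, le_rfl⟩ hr.2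
  have hwi : ∀ x y, IntervalIntegrable w volume x y := fun x y => hw.intervalIntegrable x y
  rw [intervalIntegral.integral_interval_sub_left (hwi _ _) (hwi _ _)] at h1
  have hqk : q ≤ k := hur.trans (hur1.trans huk)
  have h2 : ∫ s in q..k, 1 / Real.sqrt (F s) = ∫ s in q..k, w s :=
    intervalIntegral.integral_congr fun s hs => by
      rw [uIcc_of_le hqk] at hs
      simp only [w, max_eq_right hs.1]
  rw [h2]
  refine h1.trans (intervalIntegral.integral_mono_interval hur hur1 huk
    (Eventually.of_forall fun s => (one_div_pos.2 (hw0 s)).le) (hwi _ _))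

end IsRadialSol

/-- Once a radial solution exceeds a suitable level `α`, the Keller–Osserman integral bounds the
radius up to which it stays below `k`. -/
theorem exists_level_time_le {f F g : ℝ → ℝ} (hf : Continuous f) (hg : Continuous g)
    {a m k p q η ε : ℝ} (ha : 0 < f a) (hfpos : ∀ t, a < t → 0 ≤ f t)
    (hF : ∀ t, F t = ∫ s in a..t, f s) (hpos : ∀ t, a ≤ t → 0 ≤ g t)
    (hgf : ∀ t ∈ Icc m k, f t - η ≤ g t) (hη : 0 ≤ η) (hηk : η * (k - m) ≤ 1)
    (hma : m ≤ a) (hap : a < p) (hpq : p < q) (hqk : q ≤ k) (hFp : 2 ≤ F p) (hFq : F q = 4 * F p)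
    (hε : ∀ t, p ≤ t → ∫ s in p..t, 1 / Real.sqrt (F s) ≤ ε) :
    ∃ α ∈ Ico p q, ∀ (d : ℕ) (u : ℝ → ℝ), IsRadialSol d g u → ∀ c r, 0 < c → c ≤ r → r ≤ 1 →
      u c ≤ α → α ≤ u r → u 1 ≤ k → c ^ d * (1 - r) ≤ 4 * ε := by
  have hFd := hasDerivAt_of_primitive hf hF
  have hFc : Continuous F := continuous_iff_continuousAt.2 fun t => (hFd t).continuousAt
  have hFm := monotoneOn_primitive hf hfpos hF
  have hFpos : ∀ s, p ≤ s → 0 < F s := fun s hs => primitive_pos hf ha hfpos hF (hap.trans_le hs)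
  let G : ℝ → ℝ := fun t => ∫ s in a..t, g s
  have hG : ∀ t, HasDerivAt G (g t) t := fun t => (hg.integral_hasStrictDerivAt a t).hasDerivAt
  have hGF : ∀ s t, m ≤ s → s ≤ t → t ≤ k → F t - F s - η * (t - s) ≤ G t - G s := by
    intro s t hms hst htk
    have : MonotoneOn (fun x => G x - F x + η * x) (Icc m k) := by
      have hd : ∀ x, HasDerivAt (fun x => G x - F x + η * x) (g x - f x + η) x := fun x =>
        ((((hG x).sub (hFd x)).add ((hasDerivAt_id x).const_mul η)).congr_deriv (by simp))
      apply monotoneOn_of_deriv_nonneg (convex_Icc _ _)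
      · exact fun x _ => (hd x).continuousAt.continuousWithinAt
      · exact fun x _ => (hd x).differentiableAt.differentiableWithinAt
      · intro x hx
        rw [(hd x).deriv]
        linarith [hgf x (interior_subset hx)]
    have := this ⟨hms, hst.trans htk⟩ ⟨hms.trans hst, htk⟩ hst
    simp only at this
    linarith
  have hηmul : ∀ x, x ≤ k - m → η * x ≤ 1 := fun x hx =>
    (mul_le_mul_of_nonneg_left hx hη).trans hηk
  have hD : 2 * F p ≤ G q - G p := by
    have := hGF p q (by linarith) hpq.le hqk
    have := hηmul (q - p) (by linarith)
    linarith
  obtain ⟨α, hα, hgα, hαD, hlin⟩ := exists_level_linear_growth hG hpq (by linarith)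
  have haα : a < α := hap.trans_le hα.1
  refine ⟨α, hα, fun d u hu c r hc hcr hr1 huc hur huk => ?_⟩
  obtain ⟨r₀, hr₀, hur₀⟩ := intermediate_value_Icc hcr hu.cont.continuousOn
    (show α ∈ Icc (u c) (u r) from ⟨huc, hur⟩)
  have hr₀0 : 0 < r₀ := hc.trans_le hr₀.1
  have hr₀1 : r₀ ≤ 1 := hr₀.2.trans hr1
  have hGF' : ∀ s ∈ Icc q k, F s / 4 ≤ G s - G α := by
    intro s hs
    have h1 := hGF q s (by linarith) hs.1 hs.2
    have h2 := hGF p q (by linarith) hpq.le hqk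
    have h3 : F q ≤ F s := hFm (mem_Ici.2 (by linarith)) (mem_Ici.2 (by linarith [hs.1])) hs.1
    have h4 := hηmul (s - p) (by linarith [hs.2])
    have h5 : 0 ≤ η * (q - p) := mul_nonneg hη (by linarith)
    linarith
  have hmono := (hu.monotone_after hg hpos hr₀0.le (by rwa [hur₀])).1
  obtain ⟨r₂, hr₂, hur₂, hr₂'⟩ : ∃ r₂ ∈ Icc r₀ 1, u r₂ ≤ q ∧ (r₂ = 1 ∨ q ≤ u r₂) := by
    rcases le_total (u 1) q with h | h
    · exact ⟨1, ⟨hr₀1, le_rfl⟩, h, Or.inl rfl⟩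
    · obtain ⟨r₂, hr₂, h₂⟩ := intermediate_value_Icc hr₀1 hu.cont.continuousOn
        (show q ∈ Icc (u r₀) (u 1) from ⟨hur₀ ▸ hα.2.le, h⟩)
      exact ⟨r₂, hr₂, h₂.le, Or.inr h₂.ge⟩
  have hii : ∀ s t, p ≤ s → p ≤ t →
      IntervalIntegrable (fun s => 1 / Real.sqrt (F s)) volume s t := fun s t hs ht =>
    (ContinuousOn.div continuousOn_const (by fun_prop) fun x hx =>
      (Real.sqrt_pos.2 (hFpos x ((le_min hs ht).trans hx.1))).ne').intervalIntegrable
  have hsp := Real.sqrt_pos.2 (hFpos p le_rfl)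
  set σ := (G q - G p) / (2 * (q - p)) with hσ
  have hqp : 0 < q - p := sub_pos.2 hpq
  have h1 : r₀ ^ d * (r₂ - r₀) ≤ 4 * ∫ s in p..q, 1 / Real.sqrt (F s) := by
    have hσ0 : 0 ≤ σ := div_nonneg (by linarith) (by linarith)
    have h1 := hu.time_le_of_linear_growth hg hpos hG haα hgα hr₀0 hur₀ hσ0 hlin hr₂ hur₂
    have h2 : Real.sqrt (q - α) ≤ Real.sqrt (q - p) := Real.sqrt_le_sqrt (by linarith [hα.1])
    have h3 : Real.sqrt (F p) ≤ Real.sqrt (2 * σ) * Real.sqrt (q - p) := by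
      rw [← Real.sqrt_mul (by positivity)]
      apply Real.sqrt_le_sqrt
      have : 2 * σ * (q - p) = G q - G p := by rw [hσ]; field_simp
      linarith
    have h4 : (q - p) * (1 / (2 * Real.sqrt (F p))) ≤ ∫ s in p..q, 1 / Real.sqrt (F s) := by
      rw [← smul_eq_mul, ← intervalIntegral.integral_const]
      refine intervalIntegral.integral_mono_on hpq.le (by simp) (hii p q le_rfl hpq.le)
        fun s hs => ?_
      refine one_div_le_one_div_of_le (Real.sqrt_pos.2 (hFpos s hs.1)) ?_
      apply Real.sqrt_le_iff.2 ⟨by positivity, ?_⟩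
      rw [mul_pow, Real.sq_sqrt (hFpos p le_rfl).le]
      have := hFm (mem_Ici.2 (by linarith [hs.1])) (mem_Ici.2 (by linarith)) hs.2
      linarith
    have hsq : Real.sqrt (q - p) * Real.sqrt (q - p) = q - p := Real.mul_self_sqrt hqp.le
    have h5 : r₀ ^ d * (r₂ - r₀) * Real.sqrt (F p) ≤ 2 * (q - p) := by
      have h0 : 0 ≤ r₀ ^ d * (r₂ - r₀) := mul_nonneg (by positivity) (by linarith [hr₂.1])
      calc _ ≤ r₀ ^ d * (r₂ - r₀) * (Real.sqrt (2 * σ) * Real.sqrt (q - p)) :=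
            mul_le_mul_of_nonneg_left h3 h0
        _ = 2 * (r₀ ^ d * Real.sqrt (2 * σ) / 2 * (r₂ - r₀)) * Real.sqrt (q - p) := by ring
        _ ≤ 2 * Real.sqrt (q - p) * Real.sqrt (q - p) := by gcongr; exact h1.trans h2
        _ = 2 * (q - p) := by rw [mul_assoc, hsq]
    have h6 : r₀ ^ d * (r₂ - r₀) ≤ 4 * ((q - p) * (1 / (2 * Real.sqrt (F p)))) := by
      rw [← le_div_iff₀ hsp] at h5
      refine h5.trans (le_of_eq ?_)
      field_simp
      norm_num
    linarith
  have h2 : r₀ ^ d * (1 - r₂) ≤ 4 * ∫ s in q..k, 1 / Real.sqrt (F s) := by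
    have hI : 0 ≤ ∫ s in q..k, 1 / Real.sqrt (F s) :=
      intervalIntegral.integral_nonneg hqk fun _ _ => by positivity
    rcases hr₂' with h | h
    · rw [h]; simpa using hI
    · have := hu.time_le_integral hg hpos hG haα hr₀0 hur₀ hFc
        (fun s hs => hFpos s (hpq.le.trans hs)) hGF' hr₂ h huk
      linarith
  have h3 := intervalIntegral.integral_add_adjacent_intervals (hii p q le_rfl hpq.le)
    (hii q k hpq.le (hpq.le.trans hqk))
  have h4 := hε k (hpq.le.trans hqk)
  calc c ^ d * (1 - r) ≤ r₀ ^ d * (1 - r₀) :=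
        mul_le_mul (pow_le_pow_left₀ hc.le hr₀.1 d) (by linarith [hr₀.2]) (by linarith)
          (by positivity)
    _ = r₀ ^ d * (r₂ - r₀) + r₀ ^ d * (1 - r₂) := by ring
    _ ≤ 4 * ε := by linarith

theorem IsRadialSol.contDiff_comp_norm {d : ℕ} {g u : ℝ → ℝ} (hu : IsRadialSol d g u)
    (hg : Continuous g) :
    ContDiff ℝ 2 (fun x : EuclideanSpace ℝ (Fin (d + 1)) => u ‖x‖) := by
  simp_rw [fun x : EuclideanSpace ℝ (Fin (d + 1)) => hu.eq ‖x‖]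
  exact contDiff_radial d (hg.comp hu.cont) _

theorem IsRadialSol.lapl_comp_norm {d : ℕ} {g u : ℝ → ℝ} (hu : IsRadialSol d g u)
    (hg : Continuous g) (x : EuclideanSpace ℝ (Fin (d + 1))) :
    lapl (fun x : EuclideanSpace ℝ (Fin (d + 1)) => u ‖x‖) x = g (u ‖x‖) := by
  conv_lhs => enter [1, x]; rw [hu.eq ‖x‖]
  exact lapl_radial d (hg.comp hu.cont) _ x

theorem exists_isRadialSol_above {d : ℕ} {g : ℝ → ℝ} {K : NNReal} (hg : LipschitzWith K g)
    {a : ℝ} (hpos : ∀ t, a ≤ t → 0 ≤ g t)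
    {U : ℝ → ℝ → ℝ} (hUc : Continuous (Function.uncurry U))
    (hU : ∀ β, IsRadialSol d g (U β) ∧ U β 0 = β)
    {v : EuclideanSpace ℝ (Fin (d + 1)) → ℝ} (hvcont : ContinuousOn v (closedBall 0 1))
    (hvC2 : ContDiffOn ℝ 2 v (ball 0 1)) (hvsub : ∀ x ∈ ball 0 1, g (v x) ≤ lapl v x)
    {γ k : ℝ} (haγ : a < γ) (hγk : k < U γ 1)
    (hvγ : ∀ x ∈ closedBall 0 1, v x < γ) (hvk : ∀ x ∈ closedBall 0 1, v x < k) :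
    ∃ β ≤ γ, U β 1 = k ∧ ∀ x ∈ closedBall 0 1, v x ≤ U β ‖x‖ := by
  obtain ⟨x₀, hx₀, hmax⟩ := (isCompact_closedBall (0 : EuclideanSpace ℝ (Fin (d + 1))) 1).exists_isMaxOn
    ⟨0, by simp⟩ hvcont
  set V₀ := v x₀
  have hV₀ : ∀ x ∈ closedBall 0 1, v x ≤ V₀ := fun x hx => hmax hx
  set δ := min γ k - V₀
  have hδ : 0 < δ := sub_pos.2 (lt_min (hvγ _ hx₀) (hvk _ hx₀))
  set μ : ℝ := K + 1
  have hμ : 1 ≤ μ := by simp [μ]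
  set ε := δ / 2 * Real.exp (-μ)
  have hε : 0 < ε := by positivity
  let e : EuclideanSpace ℝ (Fin (d + 1)) → ℝ := fun x => ε * Real.exp (μ * x 0)
  obtain ⟨heC, heL⟩ : ContDiff ℝ 2 e ∧ ∀ x, lapl e x = μ ^ 2 * e x := lapl_exp_inner 0 ε μ
  have he0 : ∀ x, 0 < e x := fun x => by positivity
  let w := v + e
  have hwlt : ∀ x ∈ closedBall 0 1, w x < min γ k := by
    intro x hx
    have h1 : x 0 ≤ 1 := by
      have := (PiLp.norm_apply_le x 0)
      rw [mem_closedBall_zero_iff] at hx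
      exact (le_abs_self _).trans (this.trans hx)
    have h2 : e x ≤ δ / 2 := by
      simp only [e, ε]
      rw [mul_assoc, ← Real.exp_add]
      apply mul_le_of_le_one_right (by positivity)
      apply Real.exp_le_one_iff.2
      nlinarith
    have := hV₀ x hx
    simp only [w, Pi.add_apply]
    linarith
  have hwc : ContinuousOn w (closedBall 0 1) := hvcont.add heC.continuous.continuousOn
  have hwL : ∀ x ∈ ball 0 1, ContDiffAt ℝ 2 w x ∧ g (w x) < lapl w x := by
    intro x hx
    have hvx : ContDiffAt ℝ 2 v x := hvC2.contDiffAt (isOpen_ball.mem_nhds hx)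
    refine ⟨hvx.add heC.contDiffAt, ?_⟩
    rw [lapl_add hvx heC.contDiffAt, heL]
    have h1 := hg.dist_le_mul (w x) (v x)
    rw [Real.dist_eq, Real.dist_eq] at h1
    have h2 : w x - v x = e x := by simp [w]
    rw [h2, abs_of_pos (he0 x)] at h1
    have h3 := le_abs_self (g (w x) - g (v x))
    have h4 : K * e x < μ ^ 2 * e x := by
      apply mul_lt_mul_of_pos_right _ (he0 x)
      have : (0 : ℝ) ≤ K := K.2
      simp only [μ]; nlinarith
    linarith [hvsub x hx]
  set b := min γ (v 0)
  let S : Set (ℝ × EuclideanSpace ℝ (Fin (d + 1))) := Icc b γ ×ˢ closedBall 0 1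
  have hS : IsCompact S := isCompact_Icc.prod (isCompact_closedBall _ _)
  have hUn : Continuous fun z : ℝ × EuclideanSpace ℝ (Fin (d + 1)) => U z.1 ‖z.2‖ :=
    hUc.comp (continuous_fst.prodMk continuous_snd.norm)
  have hS' : IsCompact (S ∩ {z | U z.1 ‖z.2‖ ≤ w z.2}) := by
    have h1 : ContinuousOn (fun z : ℝ × EuclideanSpace ℝ (Fin (d + 1)) => w z.2 - U z.1 ‖z.2‖) S :=
      (hwc.comp continuousOn_snd fun z hz => hz.2).sub hUn.continuousOn
    have h2 := h1.preimage_isClosed_of_isClosed hS.isClosed (isClosed_Ici (a := (0 : ℝ)))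
    refine hS.of_isClosed_subset ?_ inter_subset_left
    convert h2 using 2
    ext z
    simp
  have hU1 : Continuous fun β => U β 1 := hUc.comp (continuous_id.prodMk continuous_const)
  let Z : Set ℝ := (Icc b γ ∩ {β | U β 1 ≤ k}) ∪ Prod.fst '' (S ∩ {z | U z.1 ‖z.2‖ ≤ w z.2})
  have hZ : IsCompact Z := (isCompact_Icc.inter_right (isClosed_le hU1 continuous_const)).union
    (hS'.image continuous_fst)
  have hZne : Z.Nonempty := by
    refine ⟨b, Or.inr ⟨(b, 0), ⟨⟨⟨le_rfl, min_le_left _ _⟩, by simp⟩, ?_⟩, rfl⟩⟩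
    change U b ‖(0 : EuclideanSpace ℝ (Fin (d + 1)))‖ ≤ v 0 + e 0
    rw [norm_zero, (hU b).2]
    linarith [he0 0, min_le_right γ (v 0)]
  obtain ⟨β₀, hβ₀Z, hβ₀max⟩ := hZ.exists_isGreatest hZne
  have hβ₀ : β₀ ∈ Icc b γ := by
    rcases hβ₀Z with h | ⟨z, hz, rfl⟩
    · exact h.1
    · exact hz.1.1
  have hγ : ∀ r, 0 ≤ r → γ ≤ U γ r := by
    intro r hr
    have := ((hU γ).1.monotone_after hg.continuous hpos le_rfl (by rwa [(hU γ).2])).1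
      self_mem_Ici hr hr
    rwa [(hU γ).2] at this
  have hγZ : γ ∉ Z := by
    rintro (⟨-, h⟩ | ⟨⟨β, x⟩, ⟨⟨-, hx⟩, h⟩, hβ⟩)
    · exact absurd hγk (not_lt.2 h)
    · change β = γ at hβ
      subst hβ
      have h1 : U β ‖x‖ ≤ w x := h
      have := (hwlt x hx).trans_le (min_le_left _ _)
      linarith [hγ ‖x‖ (norm_nonneg _)]
  have hβ₀γ : β₀ < γ := lt_of_le_of_ne hβ₀.2 (by rintro rfl; exact hγZ hβ₀Z)
  have hgt : ∀ β ∈ Ioc β₀ γ, k ≤ U β 1 ∧ ∀ x ∈ closedBall 0 1, w x ≤ U β ‖x‖ := by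
    intro β hβ
    have hnot : β ∉ Z := fun h => absurd (hβ₀max h) (not_le.2 hβ.1)
    have hβI : β ∈ Icc b γ := ⟨hβ₀.1.trans hβ.1.le, hβ.2⟩
    constructor
    · by_contra h
      exact hnot (Or.inl ⟨hβI, (not_le.1 h).le⟩)
    · intro x hx
      by_contra h
      exact hnot (Or.inr ⟨(β, x), ⟨⟨hβI, hx⟩, (not_le.1 h).le⟩, rfl⟩)
  have hev := Ioc_mem_nhdsGT hβ₀γ
  have hk : k ≤ U β₀ 1 := ge_of_tendsto ((hU1.tendsto β₀).mono_left nhdsWithin_le_nhds)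
    (by filter_upwards [hev] with β hβ using (hgt β hβ).1)
  have hw : ∀ x ∈ closedBall 0 1, w x ≤ U β₀ ‖x‖ := by
    intro x hx
    have hc : Continuous fun β => U β ‖x‖ := hUc.comp (continuous_id.prodMk continuous_const)
    exact ge_of_tendsto ((hc.tendsto β₀).mono_left nhdsWithin_le_nhds)
      (by filter_upwards [hev] with β hβ using (hgt β hβ).2 x hx)
  refine ⟨β₀, hβ₀.2, ?_, fun x hx => le_trans ?_ (hw x hx)⟩
  · rcases hβ₀Z with h | ⟨⟨β, x⟩, ⟨⟨-, hx⟩, h⟩, rfl⟩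
    · exact le_antisymm h.2 hk
    · by_contra hne
      have heq : U β ‖x‖ = w x := le_antisymm h (hw x hx)
      simp only at hx hne hk hw
      have hx1 : x ∈ ball (0 : EuclideanSpace ℝ (Fin (d + 1))) 1 := by
        rw [mem_ball_zero_iff]
        refine lt_of_le_of_ne (mem_closedBall_zero_iff.1 hx) fun h1 => ?_
        rw [h1] at heq
        have := (hwlt x hx).trans_le (min_le_right _ _)
        linarith
      obtain ⟨hwC, hwlap⟩ := hwL x hx1
      have hu2 := ((hU β).1.contDiff_comp_norm hg.continuous).contDiffAt (x := x)
      have hmin : IsLocalMin ((fun x => U β ‖x‖) - w) x := by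
        filter_upwards [isOpen_ball.mem_nhds hx1] with y hy
        have := hw y (ball_subset_closedBall hy)
        simp only [Pi.sub_apply]
        linarith
      have hl := lapl_nonneg_of_isLocalMin (φ := (fun x => U β ‖x‖) - w) (hu2.sub hwC) hmin
      rw [lapl_sub hu2 hwC, (hU β).1.lapl_comp_norm hg.continuous, heq] at hl
      linarith
  · simp only [w, Pi.add_apply]
    linarith [he0 x]

/-- `g` is a globally Lipschitz lower approximation of `f` on `[m, k]`, with error at most `η`. -/
structure IsLowerApprox (f g : ℝ → ℝ) (a m k η : ℝ) : Prop where
  lipschitz : ∃ K, LipschitzWith K g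
  bounded : ∃ M, ∀ t, |g t| ≤ M
  nonneg : ∀ t, a ≤ t → 0 ≤ g t
  lower : ∀ t ∈ Icc m k, f t - η ≤ g t
  upper : ∀ t ∈ Icc m k, g t ≤ f t
  left : ∀ t ≤ m, g t = g m
  err_nonneg : 0 ≤ η
  err_le : η * (k - m) ≤ 1

theorem IsLowerApprox.continuous {f g : ℝ → ℝ} {a m k η : ℝ} (h : IsLowerApprox f g a m k η) :
    Continuous g :=
  h.lipschitz.choose_spec.continuous

theorem IsLowerApprox.le_bound {f g : ℝ → ℝ} {a m k η T M : ℝ} (h : IsLowerApprox f g a m k η)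
    (hmT : m ≤ T) (hTk : T ≤ k) (hM : ∀ t ∈ Icc m T, f t ≤ M) : ∀ t ≤ T, g t ≤ M := by
  intro t ht
  rcases le_total t m with htm | htm
  · rw [h.left t htm]
    exact (h.upper m ⟨le_rfl, hmT.trans hTk⟩).trans (hM m ⟨le_rfl, hmT⟩)
  · exact (h.upper t ⟨htm, ht.trans hTk⟩).trans (hM t ⟨htm, ht⟩)

theorem exists_pos_bound {f : ℝ → ℝ} (hf : Continuous f) (m T : ℝ) :
    ∃ M > 0, ∀ t ∈ Icc m T, f t ≤ M := by
  obtain ⟨M, hM⟩ := (isCompact_Icc (a := m) (b := T)).image hf |>.bddAbove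
  exact ⟨max M 1, by positivity, fun t ht => (hM (mem_image_of_mem f ht)).trans (le_max_left _ _)⟩

/-- A radius before which solutions starting below `B` stay below `B + 1`. -/
theorem exists_slow_radius {f : ℝ → ℝ} (hf : Continuous f) {a m B : ℝ} (hma : m ≤ a) (haB : a ≤ B) :
    ∃ c > 0, c ≤ 1 / 2 ∧ ∀ (d : ℕ) (g u : ℝ → ℝ) (k η : ℝ), IsLowerApprox f g a m k η → B + 1 ≤ k →
      IsRadialSol d g u → u 0 ≤ B → u c ≤ B + 1 := by
  obtain ⟨M, hM0, hM⟩ := exists_pos_bound hf m (B + 1)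
  refine ⟨min (1 / 2) (1 / (2 * M)), by positivity, min_le_left _ _, fun d g u k η hg hk hu hu0 => ?_⟩
  by_contra hcon
  have hc : min (1 / 2) (1 / (2 * M)) ≤ 1 := (min_le_left _ _).trans (by norm_num)
  have h1 := hu.one_le_mul_sub hg.continuous hg.nonneg haB
    (hg.le_bound (by linarith) hk hM) le_rfl (by positivity) hc hu0 (not_le.1 hcon).le
  have h2 : M * min (1 / 2) (1 / (2 * M)) ≤ M * (1 / (2 * M)) :=
    mul_le_mul_of_nonneg_left (min_le_right _ _) hM0.le
  have h3 : M * (1 / (2 * M)) = 1 / 2 := by field_simp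
  linarith

section

variable {f F : ℝ → ℝ} {a m : ℝ}

/-- Solutions with a start in a fixed bounded interval exceed any given level at radius `1`. -/
theorem exists_start_exceeding (d : ℕ) (hf : Continuous f) (ha : 0 < f a)
    (hfpos : ∀ t, a < t → 0 ≤ f t) (hF : ∀ t, F t = ∫ s in a..t, f s)
    (hKO : ∃ M, a < M ∧ IntegrableOn (fun t => 1 / Real.sqrt (F t)) (Ici M))
    (hma : m ≤ a) {A : ℝ} (haA : a < A) :
    ∃ q, ∀ (k η : ℝ) (g : ℝ → ℝ), q ≤ k → IsLowerApprox f g a m k η →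
      ∀ U : ℝ → ℝ → ℝ, Continuous (Function.uncurry U) →
        (∀ β, IsRadialSol d g (U β) ∧ U β 0 = β) → ∃ γ ∈ Icc A q, k < U γ 1 := by
  obtain ⟨c, hc, hc2, hslow⟩ := exists_slow_radius hf hma haA.le
  obtain ⟨p, q, hAp, hap, hpq, hFp, hFq, hε⟩ := exists_levels_of_kellerOsserman hf ha hfpos hF hKO
    (A + 1) (η := c ^ d / 16) (by positivity)
  refine ⟨q, fun k η g hqk hg U hUc hU => ?_⟩
  obtain ⟨α, hα, hfast⟩ := exists_level_time_le hf hg.continuous ha hfpos hF hg.nonneg hg.lower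
    hg.err_nonneg hg.err_le hma hap hpq hqk hFp hFq hε
  have hAα : A + 1 ≤ α := hAp.trans hα.1
  have hcd : 0 < c ^ d := by positivity
  rcases le_total α (U A (1 / 2)) with h | h
  · refine ⟨A, ⟨le_rfl, by linarith [hα.2]⟩, ?_⟩
    by_contra hcon
    have h1 := hslow d g (U A) k η hg (by linarith) (hU A).1 (hU A).2.le
    have := hfast d (U A) (hU A).1 c (1 / 2) hc hc2 (by norm_num) (h1.trans hAα) h (not_lt.1 hcon)
    linarith
  · have hαα : α ≤ U α (1 / 2) := by
      have := ((hU α).1.monotone_after hg.continuous hg.nonneg le_rfl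
        (by rw [(hU α).2]; linarith)).1 self_mem_Ici (mem_Ici.2 one_half_pos.le) one_half_pos.le
      rwa [(hU α).2] at this
    have hc' : Continuous fun β => U β (1 / 2) := hUc.comp (continuous_id.prodMk continuous_const)
    obtain ⟨γ, hγ, hγα⟩ := intermediate_value_Icc (by linarith) hc'.continuousOn
      (show α ∈ Icc (U A (1 / 2)) (U α (1 / 2)) from ⟨h, hαα⟩)
    refine ⟨γ, ⟨hγ.1, hγ.2.trans hα.2.le⟩, ?_⟩
    by_contra hcon
    have h1 := hfast d (U γ) (hU γ).1 (1 / 2) (1 / 2) one_half_pos le_rfl (by norm_num) hγα.le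
      hγα.ge (not_lt.1 hcon)
    have h2 : c ^ d ≤ (1 / 2) ^ d := pow_le_pow_left₀ hc.le hc2 d
    linarith

/-- Solutions of the approximate problem with boundary value `k` above a subsolution. -/
theorem exists_approx_solution (d : ℕ) (hf : Continuous f) (ha : 0 < f a)
    (hfpos : ∀ t, a < t → 0 ≤ f t) (hF : ∀ t, F t = ∫ s in a..t, f s)
    (hKO : ∃ M, a < M ∧ IntegrableOn (fun t => 1 / Real.sqrt (F t)) (Ici M))
    (hma : m ≤ a) {v : EuclideanSpace ℝ (Fin (d + 1)) → ℝ}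
    (hvcont : ContinuousOn v (closedBall 0 1)) (hvC2 : ContDiffOn ℝ 2 v (ball 0 1))
    (hvsub : ∀ x ∈ ball 0 1, f (v x) ≤ lapl v x) (hmv : ∀ x ∈ closedBall 0 1, m ≤ v x) :
    ∃ q, ∀ (k η : ℝ) (g : ℝ → ℝ), q ≤ k → IsLowerApprox f g a m k η →
      ∃ u, IsRadialSol d g u ∧ u 1 = k ∧ u 0 ≤ q ∧ ∀ x ∈ closedBall 0 1, v x ≤ u ‖x‖ := by
  obtain ⟨V₀, hV₀⟩ := ((isCompact_closedBall (0 : EuclideanSpace ℝ (Fin (d + 1))) 1).image_of_continuousOn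
    hvcont).bddAbove
  have hV₀' : ∀ x ∈ closedBall 0 1, v x ≤ V₀ := fun x hx => hV₀ (mem_image_of_mem v hx)
  set A := max a V₀ + 1
  have haA : a < A := (le_max_left a V₀).trans_lt (lt_add_one _)
  have hVA : V₀ < A := (le_max_right a V₀).trans_lt (lt_add_one _)
  obtain ⟨q, hq⟩ := exists_start_exceeding d hf ha hfpos hF hKO hma haA
  refine ⟨max q A, fun k η g hk hg => ?_⟩
  have hqk : q ≤ k := (le_max_left _ _).trans hk
  have hAk : A ≤ k := (le_max_right _ _).trans hk
  obtain ⟨K, hK⟩ := hg.lipschitz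
  obtain ⟨M, hM⟩ := hg.bounded
  obtain ⟨U, hUc, hU⟩ := exists_isRadialSol d hK hM
  obtain ⟨γ, hγ, hγk⟩ := hq k η g hqk hg U hUc hU
  obtain ⟨β, hβγ, hβk, hβv⟩ := exists_isRadialSol_above hK hg.nonneg hUc hU hvcont hvC2
    (fun x hx => (hg.upper _ ⟨hmv x (ball_subset_closedBall hx),
      (hV₀' x (ball_subset_closedBall hx)).trans (hVA.le.trans hAk)⟩).trans (hvsub x hx))
    (haA.trans_le hγ.1) hγk
    (fun x hx => (hV₀' x hx).trans_lt (hVA.trans_le hγ.1))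
    (fun x hx => (hV₀' x hx).trans_lt (hVA.trans_le hAk))
  exact ⟨U β, (hU β).1, hβk, (hU β).2.le.trans (hβγ.trans (hγ.2.trans (le_max_left _ _))), hβv⟩

/-- Interior upper bound, uniform in the approximation. -/
theorem exists_interior_bound (d : ℕ) (hf : Continuous f) (ha : 0 < f a)
    (hfpos : ∀ t, a < t → 0 ≤ f t) (hF : ∀ t, F t = ∫ s in a..t, f s)
    (hKO : ∃ M, a < M ∧ IntegrableOn (fun t => 1 / Real.sqrt (F t)) (Ici M))
    (hma : m ≤ a) (B : ℝ) {R : ℝ} (hR : R < 1) :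
    ∃ q, m ≤ q ∧ ∀ (k η : ℝ) (g u : ℝ → ℝ), q ≤ k → IsLowerApprox f g a m k η → IsRadialSol d g u →
      u 0 ≤ B → u 1 ≤ k → ∀ s ∈ Icc 0 R, u s ≤ q := by
  obtain ⟨c, hc, hc2, hslow⟩ := exists_slow_radius hf hma (le_max_left a B)
  set R' := max R (1 / 2)
  have hR' : R' < 1 := max_lt hR (by norm_num)
  have hcd : 0 < c ^ d := by positivity
  obtain ⟨p, q, hAp, hap, hpq, hFp, hFq, hε⟩ := exists_levels_of_kellerOsserman hf ha hfpos hF hKO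
    (max a B + 1) (η := c ^ d * (1 - R') / 8) (by have := sub_pos.2 hR'; positivity)
  refine ⟨q, by linarith, fun k η g u hqk hg hu hu0 hu1 s hs => ?_⟩
  obtain ⟨α, hα, hfast⟩ := exists_level_time_le hf hg.continuous ha hfpos hF hg.nonneg hg.lower
    hg.err_nonneg hg.err_le hma hap hpq hqk hFp hFq hε
  by_contra hcon
  push Not at hcon
  have h1 := (hu.monotone_after hg.continuous hg.nonneg hs.1 (by linarith : a < u s)).1
    self_mem_Ici (mem_Ici.2 (hs.2.trans (le_max_left R (1 / 2)))) (hs.2.trans (le_max_left R (1 / 2)))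
  have h2 := hslow d g u k η hg (by linarith) hu (hu0.trans (le_max_right a B))
  have h3 := hfast d u hu c R' hc (hc2.trans (le_max_right _ _)) hR'.le
    (h2.trans (hAp.trans hα.1)) (by linarith [hα.2]) hu1
  have := mul_pos hcd (sub_pos.2 hR')
  linarith

end

/-- Pointwise limits of equi-Lipschitz functions on a compact set are uniform. -/
theorem eventually_forall_abs_sub_le {ι : Type*} {l : Filter ι} [l.NeBot] {w : ι → ℝ → ℝ}
    {u : ℝ → ℝ} {s : Set ℝ} (hs : IsCompact s) {L : ℝ}
    (hL : ∀ᶠ n in l, ∀ x ∈ s, ∀ y ∈ s, |w n x - w n y| ≤ L * |x - y|)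
    (hlim : ∀ x ∈ s, Tendsto (fun n => w n x) l (nhds (u x))) :
    (∀ x ∈ s, ∀ y ∈ s, |u x - u y| ≤ L * |x - y|) ∧
      ∀ ε > 0, ∀ᶠ n in l, ∀ x ∈ s, |w n x - u x| ≤ ε := by
  have hu : ∀ x ∈ s, ∀ y ∈ s, |u x - u y| ≤ L * |x - y| := fun x hx y hy =>
    le_of_tendsto ((hlim x hx).sub (hlim y hy)).abs (by filter_upwards [hL] with n hn using hn x hx y hy)
  refine ⟨hu, fun ε hε => ?_⟩
  set δ := ε / (3 * (|L| + 1))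
  have hδ : 0 < δ := by positivity
  have hLδ : |L| * δ ≤ ε / 3 := by
    have : (|L| + 1) * δ = ε / 3 := by simp only [δ]; field_simp
    nlinarith
  obtain ⟨t, hts, htf, hcov⟩ := hs.finite_cover_balls hδ
  have hev : ∀ᶠ n in l, ∀ y ∈ t, |w n y - u y| ≤ ε / 3 := by
    rw [htf.eventually_all]
    intro y hy
    have := (hlim y (hts hy)).eventually (closedBall_mem_nhds (u y) (show 0 < ε / 3 by positivity))
    filter_upwards [this] with n hn
    rwa [Real.dist_eq] at hn
  filter_upwards [hL, hev] with n hn hn' x hx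
  obtain ⟨y, hy, hxy⟩ := mem_iUnion₂.1 (hcov hx)
  rw [mem_ball, Real.dist_eq] at hxy
  have h0 : L * |x - y| ≤ |L| * δ :=
    mul_le_mul (le_abs_self L) hxy.le (abs_nonneg _) (abs_nonneg _)
  have h1 := abs_le.1 ((hn x hx y (hts hy)).trans h0)
  have h2 := abs_le.1 (hn' y hy)
  have h3 := abs_le.1 ((hu x hx y (hts hy)).trans h0)
  rw [abs_le]
  constructor <;> linarith [h1.1, h1.2, h2.1, h2.2, h3.1, h3.2]

/-- Passage to the limit in the radial integral equation. -/
theorem isRadialSol_limit {ι : Type*} {l : Filter ι} [l.NeBot] {d : ℕ} {f : ℝ → ℝ}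
    (hf : Continuous f) {g w : ι → ℝ → ℝ} {u : ℝ → ℝ} {η : ι → ℝ} {m q R : ℝ} (hR : 0 ≤ R)
    (hg : ∀ᶠ n in l, Continuous (g n)) (hw : ∀ᶠ n in l, IsRadialSol d (g n) (w n))
    (hmq : ∀ᶠ n in l, ∀ s ∈ Icc 0 R, w n s ∈ Icc m q)
    (hgf : ∀ᶠ n in l, ∀ t ∈ Icc m q, |g n t - f t| ≤ η n) (hη : Tendsto η l (nhds 0))
    (hlim : ∀ s ∈ Icc 0 R, Tendsto (fun n => w n s) l (nhds (u s))) :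
    Continuous (fun s => u (max 0 (min R s))) ∧ ∀ r ∈ Icc 0 R,
      u r = u 0 + ∫ s in (0 : ℝ)..r, s * radAvg d (fun s => f (u (max 0 (min R s)))) s := by
  have hclamp : ∀ s, max 0 (min R s) ∈ Icc 0 R := fun s =>
    ⟨le_max_left _ _, max_le hR (min_le_left _ _)⟩
  have hclamp_eq : ∀ s ∈ Icc 0 R, max 0 (min R s) = s := fun s hs => by
    rw [min_eq_right hs.2, max_eq_right hs.1]
  obtain ⟨M, hM⟩ := (isCompact_Icc (a := m) (b := q)).exists_bound_of_continuousOn hf.continuousOn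
  have hgM : ∀ᶠ n in l, ∀ t ∈ Icc m q, |g n t| ≤ M + 1 := by
    filter_upwards [hgf, hη.eventually (gt_mem_nhds one_pos)] with n hn hn' t ht
    have h1 := hM t ht
    rw [Real.norm_eq_abs] at h1
    have h2 := hn t ht
    have h3 := abs_add_le (g n t - f t) (f t)
    rw [sub_add_cancel] at h3
    linarith
  have hL : ∀ᶠ n in l, ∀ x ∈ Icc 0 R, ∀ y ∈ Icc 0 R,
      |w n x - w n y| ≤ R * (M + 1) * |x - y| := by
    filter_upwards [hg, hw, hmq, hgM] with n hgn hwn hmqn hgMn x hx y hy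
    have := (convex_Icc 0 R).norm_image_sub_le_of_norm_hasDerivWithin_le (f := w n)
      (C := R * (M + 1)) (fun s _ => (hwn.hasDerivAt hgn s).hasDerivWithinAt) (fun s hs => by
        rw [norm_mul, Real.norm_eq_abs, Real.norm_eq_abs, abs_of_nonneg hs.1]
        refine mul_le_mul hs.2 (abs_radAvg_le d (hgn.comp hwn.cont) fun τ hτ => ?_)
          (abs_nonneg _) hR
        exact hgMn _ (hmqn _ ⟨mul_nonneg hs.1 hτ.1,
          (mul_le_of_le_one_right hs.1 hτ.2).trans hs.2⟩)) hy hx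
    simpa [Real.norm_eq_abs] using this
  obtain ⟨huL, hunif⟩ := eventually_forall_abs_sub_le isCompact_Icc hL hlim
  have huc : ContinuousOn u (Icc 0 R) := by
    refine (LipschitzOnWith.of_dist_le_mul (K := Real.toNNReal (R * (M + 1)))
      fun x hx y hy => ?_).continuousOn
    rw [Real.dist_eq, Real.dist_eq]
    exact (huL x hx y hy).trans (mul_le_mul_of_nonneg_right (Real.le_coe_toNNReal _) (abs_nonneg _))
  have hucl : Continuous (fun s => u (max 0 (min R s))) :=
    huc.comp_continuous (by fun_prop) hclamp
  refine ⟨hucl, fun r hr => ?_⟩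
  have humq : ∀ s ∈ Icc 0 R, u s ∈ Icc m q := fun s hs =>
    isClosed_Icc.mem_of_tendsto (hlim s hs) (by filter_upwards [hmq] with n hn using hn s hs)
  have hcomp : ∀ ε > 0, ∀ᶠ n in l, ∀ s ∈ Icc 0 R, |g n (w n s) - f (u s)| ≤ ε := by
    intro ε hε
    obtain ⟨δ, hδ, hfδ⟩ := Metric.uniformContinuousOn_iff_le.1
      ((isCompact_Icc (a := m) (b := q)).uniformContinuousOn_of_continuous hf.continuousOn)
      (ε / 2) (by positivity)
    filter_upwards [hgf, hη.eventually (gt_mem_nhds (half_pos hε)), hunif δ hδ, hmq]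
      with n hn hn' hn'' hmqn s hs
    have h1 := hfδ _ (hmqn s hs) _ (humq s hs) (by rw [Real.dist_eq]; exact hn'' s hs)
    rw [Real.dist_eq] at h1
    have h2 := hn _ (hmqn s hs)
    have h3 := abs_add_le (g n (w n s) - f (w n s)) (f (w n s) - f (u s))
    rw [sub_add_sub_cancel] at h3
    linarith
  set h : ℝ → ℝ := fun s => f (u (max 0 (min R s)))
  have hh : Continuous h := hf.comp hucl
  have hint : Tendsto (fun n => ∫ s in (0 : ℝ)..r, s * radAvg d (g n ∘ w n) s) l
      (nhds (∫ s in (0 : ℝ)..r, s * radAvg d h s)) := by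
    rw [Metric.tendsto_nhds]
    intro ε hε
    have hε' : 0 < ε / (2 * (R + 1) ^ 2) := by positivity
    filter_upwards [hg, hw, hcomp _ hε'] with n hgn hwn hn
    have hgw := hgn.comp hwn.cont
    have hc1 := continuous_radAvg d hgw
    have hc2 := continuous_radAvg d hh
    have hi1 : Continuous fun s => s * radAvg d (g n ∘ w n) s := by fun_prop
    have hi2 : Continuous fun s => s * radAvg d h s := by fun_prop
    rw [dist_eq_norm, ← intervalIntegral.integral_sub (hi1.intervalIntegrable _ _)
      (hi2.intervalIntegrable _ _)]
    have hb := intervalIntegral.norm_integral_le_of_norm_le_const (a := 0) (b := r)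
      (f := fun s => s * radAvg d (g n ∘ w n) s - s * radAvg d h s)
      (C := R * (ε / (2 * (R + 1) ^ 2))) (fun s hs => by
        rw [uIoc_of_le hr.1] at hs
        have hsR : s ≤ R := hs.2.trans hr.2
        rw [← mul_sub, norm_mul, Real.norm_eq_abs, Real.norm_eq_abs, abs_of_pos hs.1]
        refine mul_le_mul hsR (abs_radAvg_sub_le d hgw hh fun τ hτ => ?_) (abs_nonneg _) hR
        have hτR : s * τ ∈ Icc 0 R := ⟨mul_nonneg hs.1.le hτ.1,
          (mul_le_of_le_one_right hs.1.le hτ.2).trans hsR⟩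
        simp only [h, hclamp_eq _ hτR]
        exact hn _ hτR)
    refine hb.trans_lt ?_
    rw [sub_zero, abs_of_nonneg hr.1]
    have h1 : R * (ε / (2 * (R + 1) ^ 2)) * r ≤ (R + 1) ^ 2 * (ε / (2 * (R + 1) ^ 2)) := by
      have : R * r ≤ (R + 1) ^ 2 := by nlinarith [hr.1, hr.2]
      nlinarith
    have h2 : (R + 1) ^ 2 * (ε / (2 * (R + 1) ^ 2)) = ε / 2 := by field_simp
    linarith
  refine tendsto_nhds_unique (hlim r hr) (((hlim 0 ⟨le_rfl, hR⟩).add hint).congr' ?_)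
  filter_upwards [hw] with n hn
  exact (hn.eq r).symm

theorem exists_isLowerApprox {f : ℝ → ℝ} (hf : Continuous f) {a m k η : ℝ} (ha : 0 < f a)
    (hpos : ∀ t, a < t → 0 ≤ f t) (hma : m ≤ a) (hak : a ≤ k) (hη : 0 < η)
    (hηk : η * (k - m) ≤ 1) : ∃ g, IsLowerApprox f g a m k η := by
  obtain ⟨g, K, M, hK, hM, hg0, hfg, hleft⟩ := exists_lipschitz_approx hf ha hpos hma hak hη
  exact ⟨g, ⟨K, hK⟩, ⟨M, hM⟩, hg0, fun t ht => (hfg t ht).1, fun t ht => (hfg t ht).2, hleft,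
    hη.le, hηk⟩

section

variable {f F : ℝ → ℝ} {a m : ℝ}

theorem exists_approx_seq (d : ℕ) (hf : Continuous f) (ha : 0 < f a)
    (hfpos : ∀ t, a < t → 0 ≤ f t) (hF : ∀ t, F t = ∫ s in a..t, f s)
    (hKO : ∃ M, a < M ∧ IntegrableOn (fun t => 1 / Real.sqrt (F t)) (Ici M))
    (hma : m ≤ a) {v : EuclideanSpace ℝ (Fin (d + 1)) → ℝ}
    (hvcont : ContinuousOn v (closedBall 0 1)) (hvC2 : ContDiffOn ℝ 2 v (ball 0 1))
    (hvsub : ∀ x ∈ ball 0 1, f (v x) ≤ lapl v x) (hmv : ∀ x ∈ closedBall 0 1, m ≤ v x) :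
    ∃ (B : ℝ) (k η : ℕ → ℝ) (g u : ℕ → ℝ → ℝ), Tendsto k atTop atTop ∧
      Tendsto η atTop (nhds 0) ∧ ∀ n, IsLowerApprox f (g n) a m (k n) (η n) ∧
        IsRadialSol d (g n) (u n) ∧ u n 1 = k n ∧ u n 0 ≤ B ∧
        ∀ x ∈ closedBall 0 1, v x ≤ u n ‖x‖ := by
  obtain ⟨q, hq⟩ := exists_approx_solution d hf ha hfpos hF hKO hma hvcont hvC2 hvsub hmv
  set k : ℕ → ℝ := fun n => max q a + n
  set η : ℕ → ℝ := fun n => 1 / ((n + 1 : ℝ) + (k n - m))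
  have hqk : ∀ n, q ≤ k n := fun n => by
    have := le_max_left q a
    have : (0 : ℝ) ≤ n := n.cast_nonneg
    simp only [k]; linarith
  have hak : ∀ n, a ≤ k n := fun n => by
    have := le_max_right q a
    have : (0 : ℝ) ≤ n := n.cast_nonneg
    simp only [k]; linarith
  have hden : ∀ n : ℕ, (0 : ℝ) < (n + 1 : ℝ) + (k n - m) := fun n => by
    have := hak n
    have : (0 : ℝ) ≤ n := n.cast_nonneg
    linarith
  have hη : ∀ n, 0 < η n := fun n => one_div_pos.2 (hden n)
  have hηk : ∀ n, η n * (k n - m) ≤ 1 := fun n => by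
    have : (0 : ℝ) ≤ n := n.cast_nonneg
    rw [one_div_mul_eq_div, div_le_one (hden n)]
    linarith
  choose g hg using fun n => exists_isLowerApprox hf ha hfpos hma (hak n) (hη n) (hηk n)
  choose u hu using fun n => hq (k n) (η n) (g n) (hqk n) (hg n)
  refine ⟨q, k, η, g, u, tendsto_atTop_add_const_left _ _ tendsto_natCast_atTop_atTop, ?_,
    fun n => ⟨hg n, hu n⟩⟩
  refine squeeze_zero (fun n => (hη n).le) (fun n => ?_) tendsto_one_div_add_atTop_nhds_zero_nat
  exact one_div_le_one_div_of_le (by positivity) (by linarith [hak n])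

/-- A radial function solving the integrated equation near `x` solves the equation at `x`. -/
theorem contDiffAt_and_lapl_of_integral_eq {d : ℕ} {h u : ℝ → ℝ} (hh : Continuous h) {β R : ℝ}
    (hu : ∀ r ∈ Icc 0 R, u r = β + ∫ s in (0 : ℝ)..r, s * radAvg d h s)
    {x : EuclideanSpace ℝ (Fin (d + 1))} (hx : ‖x‖ < R) :
    ContDiffAt ℝ 2 (fun y : EuclideanSpace ℝ (Fin (d + 1)) => u ‖y‖) x ∧
      lapl (fun y : EuclideanSpace ℝ (Fin (d + 1)) => u ‖y‖) x = h ‖x‖ := by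
  have heq : (fun y : EuclideanSpace ℝ (Fin (d + 1)) => u ‖y‖) =ᶠ[nhds x]
      fun y => β + ∫ s in (0 : ℝ)..‖y‖, s * radAvg d h s := by
    filter_upwards [continuous_norm.continuousAt.eventually (gt_mem_nhds hx)] with y hy
    exact hu _ ⟨norm_nonneg y, hy.le⟩
  refine ⟨(contDiff_radial d hh β).contDiffAt.congr_of_eventuallyEq heq, ?_⟩
  rw [← lapl_radial d hh β x, lapl, lapl, (heq.iteratedFDeriv ℝ 2).eq_of_nhds]

theorem exists_radial_largeSolution (d : ℕ) (hf : Continuous f) (ha : 0 < f a)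
    (hfpos : ∀ t, a < t → 0 ≤ f t) (hF : ∀ t, F t = ∫ s in a..t, f s)
    (hKO : ∃ M, a < M ∧ IntegrableOn (fun t => 1 / Real.sqrt (F t)) (Ici M))
    (hma : m ≤ a) {v : EuclideanSpace ℝ (Fin (d + 1)) → ℝ}
    (hvcont : ContinuousOn v (closedBall 0 1)) (hvC2 : ContDiffOn ℝ 2 v (ball 0 1))
    (hvsub : ∀ x ∈ ball 0 1, f (v x) ≤ lapl v x) (hmv : ∀ x ∈ closedBall 0 1, m ≤ v x) :
    ∃ w : ℝ → ℝ, IsLargeSolution f (fun x : EuclideanSpace ℝ (Fin (d + 1)) => w ‖x‖) ∧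
      ∀ x ∈ ball 0 1, v x ≤ w ‖x‖ := by
  obtain ⟨B, k, η, g, w, hk, hη, hseq⟩ :=
    exists_approx_seq d hf ha hfpos hF hKO hma hvcont hvC2 hvsub hmv
  choose hg hw hw1 hw0 hvw using hseq
  set l : Ultrafilter ℕ := hyperfilter ℕ
  have hl : (l : Filter ℕ) ≤ atTop := Nat.hyperfilter_le_atTop
  have hmw : ∀ n, ∀ s ∈ Icc (0 : ℝ) 1, m ≤ w n s := fun n s hs => by
    have hns : ‖(EuclideanSpace.single 0 s : EuclideanSpace ℝ (Fin (d + 1)))‖ = s := by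
      rw [PiLp.norm_single, Real.norm_eq_abs, abs_of_nonneg hs.1]
    have hmem : (EuclideanSpace.single 0 s : EuclideanSpace ℝ (Fin (d + 1))) ∈ closedBall 0 1 := by
      rw [mem_closedBall_zero_iff, hns]; exact hs.2
    have := (hmv _ hmem).trans (hvw n _ hmem)
    rwa [hns] at this
  have hbound : ∀ R < 1, ∃ q, ∀ᶠ n in atTop, q ≤ k n ∧ ∀ s ∈ Icc 0 R, w n s ∈ Icc m q := by
    intro R hR
    obtain ⟨q, -, hq⟩ := exists_interior_bound d hf ha hfpos hF hKO hma B hR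
    refine ⟨q, ?_⟩
    filter_upwards [hk.eventually_ge_atTop q] with n hn
    exact ⟨hn, fun s hs => ⟨hmw n s ⟨hs.1, hs.2.trans hR.le⟩,
      hq _ _ _ _ hn (hg n) (hw n) (hw0 n) (hw1 n).le s hs⟩⟩
  have hlimex : ∀ s, ∃ y, s ∈ Ico (0 : ℝ) 1 → Tendsto (fun n => w n s) l (nhds y) := by
    intro s
    by_cases hs : s ∈ Ico (0 : ℝ) 1
    · obtain ⟨q, hq⟩ := hbound s hs.2
      obtain ⟨y, -, hy⟩ := (isCompact_Icc (a := m) (b := q)).ultrafilter_le_nhds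
        (l.map fun n => w n s) (by
          rw [le_principal_iff]
          exact (hq.filter_mono hl).mono fun n hn => hn.2 s ⟨hs.1, le_rfl⟩)
      exact ⟨y, fun _ => hy⟩
    · exact ⟨0, fun h => absurd h hs⟩
  choose u hu using hlimex
  have hsol : ∀ x ∈ ball (0 : EuclideanSpace ℝ (Fin (d + 1))) 1,
      ContDiffAt ℝ 2 (fun y : EuclideanSpace ℝ (Fin (d + 1)) => u ‖y‖) x ∧
      lapl (fun y : EuclideanSpace ℝ (Fin (d + 1)) => u ‖y‖) x = f (u ‖x‖) := by
    intro x hx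
    rw [mem_ball_zero_iff] at hx
    have hx0 := norm_nonneg x
    set R := (‖x‖ + 1) / 2
    have hxR : ‖x‖ < R := by simp only [R]; linarith
    have hR1 : R < 1 := by simp only [R]; linarith
    have hR0 : 0 ≤ R := hx0.trans hxR.le
    obtain ⟨q, hq⟩ := hbound R hR1
    have hq' := hq.filter_mono hl
    obtain ⟨hc, he⟩ := isRadialSol_limit (l := (l : Filter ℕ)) (d := d) (u := u) (w := w) (g := g)
      (m := m) (q := q) hf hR0
      (Eventually.of_forall fun n => (hg n).continuous) (Eventually.of_forall hw)
      (hq'.mono fun n hn => hn.2)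
      (hq'.mono fun n hn t ht => by
        have htk : t ∈ Icc m (k n) := ⟨ht.1, ht.2.trans hn.1⟩
        rw [abs_le]
        constructor
        · linarith [(hg n).lower t htk]
        · linarith [(hg n).upper t htk, (hg n).err_nonneg])
      (hη.mono_left hl) (fun s hs => hu s ⟨hs.1, hs.2.trans_lt hR1⟩)
    obtain ⟨h1, h2⟩ := contDiffAt_and_lapl_of_integral_eq (hf.comp hc) he hxR
    refine ⟨h1, h2.trans ?_⟩
    simp only [Function.comp_apply]
    rw [min_eq_right hxR.le, max_eq_right hx0]
  have hblow : ∀ T, ∃ ρ < 1, ∀ s ∈ Ico (0 : ℝ) 1, ρ < s → T ≤ u s := by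
    intro T
    set T' := max a T
    obtain ⟨M, hM0, hM⟩ := exists_pos_bound hf m (T' + 1)
    refine ⟨1 - 1 / M, by linarith [one_div_pos.2 hM0], fun s hs hρ => ?_⟩
    refine ge_of_tendsto (hu s hs) ?_
    filter_upwards [(hk.eventually_ge_atTop (T' + 1)).filter_mono hl] with n hn
    by_contra hcon
    have h1 := (hw n).one_le_mul_sub (hg n).continuous (hg n).nonneg (le_max_left a T)
      ((hg n).le_bound (by linarith [le_max_left a T]) hn hM) hs.1 hs.2.le le_rfl
      ((not_le.1 hcon).le.trans (le_max_right a T)) (hn.trans (hw1 n).ge)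
    have h2 : M * (1 - s) < M * (1 / M) := mul_lt_mul_of_pos_left (by linarith) hM0
    rw [mul_one_div_cancel hM0.ne'] at h2
    linarith
  refine ⟨u, ⟨fun x hx => (hsol x hx).1.contDiffWithinAt, fun x hx => (hsol x hx).2,
    fun x₀ hx₀ => tendsto_atTop.2 fun T => ?_⟩, fun x hx => ?_⟩
  · obtain ⟨ρ, hρ, hT⟩ := hblow T
    have hx₀' : ρ < ‖x₀‖ := by rwa [mem_sphere_zero_iff_norm.1 hx₀]
    filter_upwards [self_mem_nhdsWithin, nhdsWithin_le_nhds
      (continuous_norm.continuousAt.eventually (lt_mem_nhds hx₀'))] with x hx hxρ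
    exact hT _ ⟨norm_nonneg x, mem_ball_zero_iff.1 hx⟩ hxρ
  · exact ge_of_tendsto (hu ‖x‖ ⟨norm_nonneg x, mem_ball_zero_iff.1 hx⟩)
      (Eventually.of_forall fun n => hvw n x (ball_subset_closedBall hx))

end

theorem stmt13 {N : ℕ} (hN : 1 ≤ N)
    (f : ℝ → ℝ) (hf : Continuous f)
    (a : ℝ) (ha : 0 < f a) (hfpos : ∀ t, a < t → 0 ≤ f t)
    (F : ℝ → ℝ) (hF : ∀ t, F t = ∫ s in a..t, f s)
    (hKO : ∃ M, a < M ∧ IntegrableOn (fun t => 1 / Real.sqrt (F t)) (Ici M))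
    (v : EuclideanSpace ℝ (Fin N) → ℝ)
    (hvcont : ContinuousOn v (closedBall 0 1))
    (hvC2 : ContDiffOn ℝ 2 v (ball 0 1))
    (hvsub : ∀ x ∈ ball (0 : EuclideanSpace ℝ (Fin N)) 1, f (v x) ≤ lapl v x) :
    ∃ V : EuclideanSpace ℝ (Fin N) → ℝ, IsLargeSolution f V ∧
      (∃ w : ℝ → ℝ, ∀ x ∈ ball (0 : EuclideanSpace ℝ (Fin N)) 1, V x = w ‖x‖) ∧
      ∀ x ∈ ball (0 : EuclideanSpace ℝ (Fin N)) 1, v x ≤ V x := by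
  obtain ⟨d, rfl⟩ : ∃ d, N = d + 1 := ⟨N - 1, by omega⟩
  obtain ⟨m, hm⟩ := ((isCompact_closedBall (0 : EuclideanSpace ℝ (Fin (d + 1))) 1).image_of_continuousOn
    hvcont).bddBelow
  obtain ⟨w, hw, hvw⟩ := exists_radial_largeSolution d hf ha hfpos hF hKO (min_le_left a m)
    hvcont hvC2 hvsub fun x hx => (min_le_right a m).trans (hm (mem_image_of_mem v hx))
  exact ⟨fun x => w ‖x‖, hw, ⟨w, fun x _ => rfl⟩, hvw⟩
end
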